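/- arXiv:1712.09743 — 2 statements merged into one kernel-verified Lean document; each statement's English description precedes it below -/
import Mathlib

section
/- Suppose assumptions (H1) and (H2) hold and z̄ = (x̄, ū) is a locally weak Pareto solution of (MCP). Then, for each z = (x, u) in the critical cone 𝒞(z̄), there exist a vector λ ∈ ℝ^m₊ with |λ| = 1, an absolutely continuous function p̄ : [0,1] → ℝⁿ, and a function θ ∈ L¹([0,1], ℝ) such that: (i) θ ∈ N(Q; g[·]); (ii) the adjoint equation holds: ṗ̄(t) = −λᵀ L_x[t] − φ_x[t]ᵀ p̄(t) − θ(t) g_x[t] for a.e. t ∈ [0,1], with p̄(1) = 0; (iii) the stationarity condition λᵀ L_u[t] + p̄(t)ᵀ φ_u[t] + θ(t) g_u[t] = 0 holds for a.e. t ∈ [0,1]; and (iv) ∫₀¹ (Σ_{j=1}^m λ_j ∇²L_j[t] z(t), z(t)) dt + ∫₀¹ (p̄(t)ᵀ ∇²φ[t] z(t), z(t)) dt + ∫₀¹ (θ(t) ∇²g[t] z(t), z(t)) dt ≥ 0. -/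
open Filter Topology MeasureTheory

/-- Lebesgue measure restricted to `[0,1]`. -/
noncomputable def mu01 : Measure ℝ := volume.restrict (Set.Icc (0:ℝ) 1)

/-- Assumption (H1) for the data `L = (L₁,…,L_m)`, `φ`, `g` of problem (MCP):
Carathéodory and `C²`-smoothness conditions, local Lipschitz continuity of the data
and of their first and second derivatives in `(x,u)` uniformly in `t` on bounded sets,
and essential boundedness at `(t,0,0)`. -/
def HypH1 {n l m : ℕ}
    (L : Fin m → ℝ → (Fin n → ℝ) × (Fin l → ℝ) → ℝ)
    (φ : ℝ → (Fin n → ℝ) × (Fin l → ℝ) → (Fin n → ℝ))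
    (g : ℝ → (Fin n → ℝ) × (Fin l → ℝ) → ℝ) : Prop :=
  (∀ j p, Measurable (fun t => L j t p)) ∧
  (∀ᵐ t ∂mu01, ∀ j, ContDiff ℝ 2 (L j t)) ∧
  Continuous (Function.uncurry φ) ∧ Continuous (Function.uncurry g) ∧
  (∀ t, ContDiff ℝ 2 (φ t)) ∧ (∀ t, ContDiff ℝ 2 (g t)) ∧
  (∀ M > (0:ℝ), ∃ k > (0:ℝ), ∀ᵐ t ∂mu01, ∀ j p₁ p₂, ‖p₁‖ ≤ M → ‖p₂‖ ≤ M →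
    |L j t p₁ - L j t p₂| + ‖fderiv ℝ (L j t) p₁ - fderiv ℝ (L j t) p₂‖ +
      ‖fderiv ℝ (fderiv ℝ (L j t)) p₁ - fderiv ℝ (fderiv ℝ (L j t)) p₂‖ ≤
      k * ‖p₁ - p₂‖) ∧
  (∀ M > (0:ℝ), ∃ k > (0:ℝ), ∀ (t : ℝ) p₁ p₂, ‖p₁‖ ≤ M → ‖p₂‖ ≤ M →
    ‖φ t p₁ - φ t p₂‖ + |g t p₁ - g t p₂| +
      ‖fderiv ℝ (φ t) p₁ - fderiv ℝ (φ t) p₂‖ + ‖fderiv ℝ (g t) p₁ - fderiv ℝ (g t) p₂‖ +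
      ‖fderiv ℝ (fderiv ℝ (φ t)) p₁ - fderiv ℝ (fderiv ℝ (φ t)) p₂‖ +
      ‖fderiv ℝ (fderiv ℝ (g t)) p₁ - fderiv ℝ (fderiv ℝ (g t)) p₂‖ ≤ k * ‖p₁ - p₂‖) ∧
  (∃ C : ℝ, ∀ᵐ t ∂mu01, ∀ j,
    |L j t 0| + ‖fderiv ℝ (L j t) 0‖ + ‖fderiv ℝ (fderiv ℝ (L j t)) 0‖ ≤ C) ∧
  (∃ C : ℝ, ∀ᵐ t ∂mu01,
    ‖φ t 0‖ + |g t 0| + ‖fderiv ℝ (φ t) 0‖ + ‖fderiv ℝ (g t) 0‖ +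
      ‖fderiv ℝ (fderiv ℝ (φ t)) 0‖ + ‖fderiv ℝ (fderiv ℝ (g t)) 0‖ ≤ C)

/-- Assumption (H2) at `(x̄, ū)`: some control-partial derivative of `g` is uniformly
bounded away from zero. -/
def HypH2 {n l : ℕ} (g : ℝ → (Fin n → ℝ) × (Fin l → ℝ) → ℝ)
    (xb : ℝ → Fin n → ℝ) (ub : ℝ → Fin l → ℝ) : Prop :=
  ∃ i₀ : Fin l, ∃ α > (0:ℝ), ∀ᵐ t ∂mu01,
    α ≤ |fderiv ℝ (g t) (xb t, ub t) (0, Pi.single i₀ 1)|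

/-- Feasibility for (MCP): `x` continuous, `u` measurable and essentially bounded,
the state equation `x(t) = x₀ + ∫₀ᵗ φ(s, x(s), u(s)) ds`, and the mixed constraint
`g(t, x(t), u(t)) ≤ 0` a.e. -/
def FeasibleMCP {n l : ℕ}
    (φ : ℝ → (Fin n → ℝ) × (Fin l → ℝ) → (Fin n → ℝ))
    (g : ℝ → (Fin n → ℝ) × (Fin l → ℝ) → ℝ) (x₀ : Fin n → ℝ)
    (x : ℝ → Fin n → ℝ) (u : ℝ → Fin l → ℝ) : Prop :=
  ContinuousOn x (Set.Icc 0 1) ∧ Measurable u ∧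
  (∃ C : ℝ, ∀ᵐ t ∂mu01, ‖u t‖ ≤ C) ∧
  (∀ t ∈ Set.Icc (0:ℝ) 1, x t = x₀ + ∫ s in (0:ℝ)..t, φ s (x s, u s)) ∧
  (∀ᵐ t ∂mu01, g t (x t, u t) ≤ 0)

/-- Conditions (c₁)–(c₃) defining the interior critical set `𝒞₀(z̄)` of (MCP). -/
def MemC0 {n l m : ℕ}
    (L : Fin m → ℝ → (Fin n → ℝ) × (Fin l → ℝ) → ℝ)
    (φ : ℝ → (Fin n → ℝ) × (Fin l → ℝ) → (Fin n → ℝ))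
    (g : ℝ → (Fin n → ℝ) × (Fin l → ℝ) → ℝ)
    (xb : ℝ → Fin n → ℝ) (ub : ℝ → Fin l → ℝ)
    (x : ℝ → Fin n → ℝ) (u : ℝ → Fin l → ℝ) : Prop :=
  ContinuousOn x (Set.Icc 0 1) ∧ Measurable u ∧
  (∃ C : ℝ, ∀ᵐ t ∂mu01, ‖u t‖ ≤ C) ∧
  -- (c₁)
  (∀ j, (∫ t in (0:ℝ)..1, fderiv ℝ (L j t) (xb t, ub t) (x t, u t)) ≤ 0) ∧
  -- (c₂)
  (∀ t ∈ Set.Icc (0:ℝ) 1,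
    x t = ∫ s in (0:ℝ)..t, fderiv ℝ (φ s) (xb s, ub s) (x s, u s)) ∧
  -- (c₃): `g_x[·]x + g_u[·]u ∈ cone(Q − g(·, x̄, ū))`
  (∃ c : ℝ, 0 < c ∧ ∃ v : ℝ → ℝ, Measurable v ∧ (∃ C : ℝ, ∀ᵐ t ∂mu01, |v t| ≤ C) ∧
    (∀ᵐ t ∂mu01, v t ≤ 0) ∧
    (∀ᵐ t ∂mu01,
      fderiv ℝ (g t) (xb t, ub t) (x t, u t) = c * (v t - g t (xb t, ub t))))

/-- Membership in the critical cone `𝒞(z̄)`: the closure of `𝒞₀(z̄)` in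
`C([0,1],ℝⁿ) × L^∞([0,1],ℝˡ)`. -/
def MemCriticalCone {n l m : ℕ}
    (L : Fin m → ℝ → (Fin n → ℝ) × (Fin l → ℝ) → ℝ)
    (φ : ℝ → (Fin n → ℝ) × (Fin l → ℝ) → (Fin n → ℝ))
    (g : ℝ → (Fin n → ℝ) × (Fin l → ℝ) → ℝ)
    (xb : ℝ → Fin n → ℝ) (ub : ℝ → Fin l → ℝ)
    (x : ℝ → Fin n → ℝ) (u : ℝ → Fin l → ℝ) : Prop :=
  ContinuousOn x (Set.Icc 0 1) ∧ Measurable u ∧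
  (∃ C : ℝ, ∀ᵐ t ∂mu01, ‖u t‖ ≤ C) ∧
  ∃ (xk : ℕ → ℝ → Fin n → ℝ) (uk : ℕ → ℝ → Fin l → ℝ),
    (∀ k, MemC0 L φ g xb ub (xk k) (uk k)) ∧
    (∀ ε > (0:ℝ), ∃ K : ℕ, ∀ k ≥ K,
      (∀ t ∈ Set.Icc (0:ℝ) 1, ‖xk k t - x t‖ ≤ ε) ∧
      (∀ᵐ t ∂mu01, ‖uk k t - u t‖ ≤ ε))

/-- Everywhere bounded measurable functions of time. -/
def BddMeas {V : Type*} [NormedAddCommGroup V] [MeasurableSpace V] (h : ℝ → V) : Prop :=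
  Measurable h ∧ ∃ C : ℝ, ∀ t, ‖h t‖ ≤ C

namespace BddMeas

variable {V : Type*} [NormedAddCommGroup V] [MeasurableSpace V]

lemma exists_pos {h : ℝ → V} (hh : BddMeas h) : ∃ C : ℝ, 0 < C ∧ ∀ t, ‖h t‖ ≤ C := by
  obtain ⟨C, hC⟩ := hh.2
  exact ⟨max C 1, by positivity, fun t => (hC t).trans (le_max_left _ _)⟩

lemma intervalIntegrable [BorelSpace V] [SecondCountableTopology V] {h : ℝ → V}
    (hh : BddMeas h) (a b : ℝ) : IntervalIntegrable h volume a b := by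
  obtain ⟨C, hC⟩ := hh.2
  exact (intervalIntegrable_const (c := C)).mono_fun hh.1.aestronglyMeasurable
    (Eventually.of_forall fun t => (hC t).trans (le_abs_self C))

lemma const (c : V) : BddMeas (fun _ : ℝ => c) := ⟨measurable_const, ‖c‖, fun _ => le_rfl⟩

lemma add [BorelSpace V] [SecondCountableTopology V] {f h : ℝ → V} (hf : BddMeas f)
    (hh : BddMeas h) : BddMeas (fun t => f t + h t) := by
  obtain ⟨C, hC⟩ := hf.2
  obtain ⟨D, hD⟩ := hh.2
  exact ⟨hf.1.add hh.1, C + D, fun t => (norm_add_le _ _).trans (add_le_add (hC t) (hD t))⟩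

lemma sub [BorelSpace V] [SecondCountableTopology V] {f h : ℝ → V} (hf : BddMeas f)
    (hh : BddMeas h) : BddMeas (fun t => f t - h t) := by
  obtain ⟨C, hC⟩ := hf.2
  obtain ⟨D, hD⟩ := hh.2
  exact ⟨hf.1.sub hh.1, C + D, fun t => (norm_sub_le _ _).trans (add_le_add (hC t) (hD t))⟩

lemma smul [BorelSpace V] [NormedSpace ℝ V] [SecondCountableTopology V]
    {c : ℝ → ℝ} {h : ℝ → V} (hc : BddMeas c)
    (hh : BddMeas h) : BddMeas (fun t => c t • h t) := by
  obtain ⟨C, hC⟩ := hc.2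
  obtain ⟨D, hD⟩ := hh.2
  refine ⟨hc.1.smul hh.1, C * D, fun t => ?_⟩
  rw [norm_smul]
  exact mul_le_mul (hC t) (hD t) (norm_nonneg _) ((norm_nonneg _).trans (hC t))

lemma mul {c h : ℝ → ℝ} (hc : BddMeas c) (hh : BddMeas h) : BddMeas (fun t => c t * h t) :=
  hc.smul hh

lemma neg {h : ℝ → ℝ} (hh : BddMeas h) : BddMeas (fun t => -h t) := by
  simpa using (BddMeas.const (-1 : ℝ)).mul hh

lemma sum {ι : Type*} (s : Finset ι) {f : ι → ℝ → ℝ} (hf : ∀ i ∈ s, BddMeas (f i)) :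
    BddMeas (fun t => ∑ i ∈ s, f i t) := by
  classical
  induction s using Finset.induction_on with
  | empty => simpa using BddMeas.const (0 : ℝ)
  | insert a s ha ih =>
    simp only [Finset.sum_insert ha]
    exact (hf a (by simp)).add (ih fun i hi => hf i (by simp [hi]))

lemma eval {n : ℕ} {h : ℝ → Fin n → ℝ} (hh : BddMeas h) (i : Fin n) :
    BddMeas (fun t => h t i) := by
  obtain ⟨C, hC⟩ := hh.2
  exact ⟨(measurable_pi_apply i).comp hh.1, C, fun t => (norm_le_pi_norm _ i).trans (hC t)⟩

lemma pi {n : ℕ} {h : ℝ → Fin n → ℝ} (hh : ∀ i, BddMeas (fun t => h t i)) : BddMeas h := by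
  choose C hC using fun i => (hh i).exists_pos
  refine ⟨measurable_pi_lambda _ fun i => (hh i).1, ∑ i, C i, fun t => ?_⟩
  refine (pi_norm_le_iff_of_nonneg (Finset.sum_nonneg fun i _ => (hC i).1.le)).2 fun i => ?_
  exact ((hC i).2 t).trans
    (Finset.single_le_sum (f := C) (fun i _ => (hC i).1.le) (Finset.mem_univ i))

lemma prodMk {W : Type*} [NormedAddCommGroup W] [MeasurableSpace W] {f : ℝ → V} {h : ℝ → W}
    (hf : BddMeas f) (hh : BddMeas h) : BddMeas (fun t => (f t, h t)) := by
  obtain ⟨C, hC⟩ := hf.2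
  obtain ⟨D, hD⟩ := hh.2
  exact ⟨hf.1.prodMk hh.1, max C D, fun t => max_le_max (hC t) (hD t)⟩

end BddMeas

/-- Global existence with an a priori bound for Carathéodory differential equations whose
right-hand side is Lipschitz in the state. -/
lemma exists_caratheodory_solution {V : Type*} [NormedAddCommGroup V] [NormedSpace ℝ V]
    [CompleteSpace V] [MeasurableSpace V] [BorelSpace V] [SecondCountableTopology V]
    (f : ℝ → V → V) (hm : Measurable (Function.uncurry f)) {K b : ℝ} (hK : 0 ≤ K)
    (hl : ∀ t x y, ‖f t x - f t y‖ ≤ K * ‖x - y‖) (hb : ∀ t, ‖f t 0‖ ≤ b) :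
    ∃ x : ℝ → V, Continuous x ∧ (∀ t ∈ Set.Icc (0:ℝ) 1, x t = ∫ s in (0:ℝ)..t, f s (x s)) ∧
      ∀ t, ‖x t‖ ≤ 2 * Real.exp (2 * K + 1) * b := by
  set N : ℝ := 2 * K + 1 with hN
  have hN0 : 0 < N := by positivity
  have hb0 : 0 ≤ b := (norm_nonneg _).trans (hb 0)
  let pr : ℝ → Set.Icc (0:ℝ) 1 := Set.projIcc 0 1 zero_le_one
  have hpr : Continuous pr := continuous_projIcc
  let W : C(Set.Icc (0:ℝ) 1, V) → ℝ → V := fun η s => Real.exp (N * (pr s : ℝ)) • η (pr s)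
  have hWc : ∀ η, Continuous (W η) := fun η => by fun_prop
  have hexp : ∀ s, Real.exp (N * (pr s : ℝ)) ≤ Real.exp N := fun s => by
    apply Real.exp_le_exp.2
    have := (pr s).2.2
    nlinarith
  have hWb : ∀ η s, ‖W η s‖ ≤ Real.exp N * ‖η‖ := fun η s => by
    simp only [W, norm_smul, Real.norm_eq_abs, Real.abs_exp]
    exact mul_le_mul (hexp s) (η.norm_coe_le_norm _) (norm_nonneg _) (Real.exp_pos _).le
  have hfb : ∀ t x, ‖f t x‖ ≤ b + K * ‖x‖ := fun t x => by
    have h1 := hl t x 0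
    have h2 := norm_le_norm_add_norm_sub' (f t x) (f t 0)
    rw [sub_zero] at h1
    linarith [hb t]
  have hBM : ∀ η, BddMeas (fun s => f s (W η s)) := fun η =>
    ⟨hm.comp (measurable_id.prodMk (hWc η).measurable), b + K * (Real.exp N * ‖η‖), fun s =>
      (hfb s _).trans (by gcongr; exact hWb η s)⟩
  let T : C(Set.Icc (0:ℝ) 1, V) → C(Set.Icc (0:ℝ) 1, V) := fun η =>
    ⟨fun t => Real.exp (-(N * (t:ℝ))) • ∫ s in (0:ℝ)..t, f s (W η s), by
      have := intervalIntegral.continuous_primitive (μ := volume) (hBM η).intervalIntegrable 0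
      fun_prop⟩
  have hprs : ∀ {s : ℝ}, s ∈ Set.Icc (0:ℝ) 1 → (pr s : ℝ) = s := fun {s} hs => by
    simp only [pr, Set.projIcc_of_mem zero_le_one hs]
  have hint : ∀ t : ℝ, ∫ s in (0:ℝ)..t, Real.exp (N * s) = (Real.exp (N * t) - 1) / N := by
    intro t
    rw [intervalIntegral.integral_comp_mul_left (fun x => Real.exp x) hN0.ne', integral_exp]
    simp [div_eq_inv_mul]
  have hTl : ∀ η η', ‖T η - T η'‖ ≤ (1/2 : ℝ) * ‖η - η'‖ := by
    intro η η'
    refine (ContinuousMap.norm_le _ (by positivity)).2 fun t => ?_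
    have ht := t.2
    change ‖Real.exp (-(N * (t:ℝ))) • (∫ s in (0:ℝ)..t, f s (W η s)) -
      Real.exp (-(N * (t:ℝ))) • (∫ s in (0:ℝ)..t, f s (W η' s))‖ ≤ _
    rw [← smul_sub, ← intervalIntegral.integral_sub ((hBM η).intervalIntegrable _ _)
      ((hBM η').intervalIntegrable _ _), norm_smul, Real.norm_eq_abs, Real.abs_exp]
    have h1 : ‖∫ s in (0:ℝ)..t, (f s (W η s) - f s (W η' s))‖ ≤
        ∫ s in (0:ℝ)..t, K * ‖η - η'‖ * Real.exp (N * s) := by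
      refine intervalIntegral.norm_integral_le_of_norm_le ht.1 (Eventually.of_forall ?_)
        (Continuous.intervalIntegrable (by fun_prop) _ _)
      intro s hs
      have hs' : s ∈ Set.Icc (0:ℝ) 1 := ⟨hs.1.le, hs.2.trans ht.2⟩
      refine (hl s _ _).trans ?_
      have : W η s - W η' s = Real.exp (N * s) • ((η - η') (pr s)) := by
        simp only [W, hprs hs', ← smul_sub]; rfl
      rw [this, norm_smul, Real.norm_eq_abs, Real.abs_exp]
      have := (η - η').norm_coe_le_norm (pr s)
      have h3 := mul_le_mul_of_nonneg_left this (Real.exp_pos (N * s)).le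
      nlinarith
    rw [intervalIntegral.integral_const_mul, hint] at h1
    have hE : Real.exp (-(N * (t:ℝ))) * ((Real.exp (N * t) - 1) / N) ≤ 1 / N := by
      rw [← mul_div_assoc, mul_sub, ← Real.exp_add]
      gcongr
      have := Real.exp_pos (-(N * (t:ℝ)))
      simp only [neg_add_cancel, Real.exp_zero, mul_one]
      linarith
    have hKN : K * (1 / N) ≤ 1 / 2 := by
      rw [mul_one_div, div_le_div_iff₀ hN0 two_pos]; linarith
    calc _ ≤ Real.exp (-(N * (t:ℝ))) * (K * ‖η - η'‖ * ((Real.exp (N * t) - 1) / N)) := by gcongr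
      _ = K * ‖η - η'‖ * (Real.exp (-(N * (t:ℝ))) * ((Real.exp (N * t) - 1) / N)) := by ring
      _ ≤ K * ‖η - η'‖ * (1 / N) := by gcongr
      _ = (K * (1 / N)) * ‖η - η'‖ := by ring
      _ ≤ _ := by gcongr
  have hTc : ContractingWith (1/2) T := by
    refine ⟨by norm_num, LipschitzWith.of_dist_le_mul fun η η' => ?_⟩
    rw [dist_eq_norm, dist_eq_norm]
    simpa using hTl η η'
  set η := hTc.fixedPoint with hη
  have hfix : T η = η := hTc.fixedPoint_isFixedPt
  have hT0 : ‖T 0‖ ≤ b := by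
    refine (ContinuousMap.norm_le _ hb0).2 fun t => ?_
    have ht := t.2
    change ‖Real.exp (-(N * (t:ℝ))) • (∫ s in (0:ℝ)..t, f s (W 0 s))‖ ≤ b
    rw [norm_smul, Real.norm_eq_abs, Real.abs_exp]
    have h1 : ‖∫ s in (0:ℝ)..t, f s (W 0 s)‖ ≤ b * |(t:ℝ) - 0| :=
      intervalIntegral.norm_integral_le_of_norm_le_const fun s _ => by
        simpa [W] using hb s
    have h2 : Real.exp (-(N * (t:ℝ))) ≤ 1 := Real.exp_le_one_iff.2 (by
      have := mul_nonneg hN0.le ht.1; linarith)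
    rw [sub_zero, abs_of_nonneg ht.1] at h1
    have h3 : b * (t:ℝ) ≤ b := by nlinarith [ht.2]
    calc _ ≤ 1 * b := by gcongr; exact h1.trans h3
      _ = b := one_mul b
  have hηn : ‖η‖ ≤ 2 * b := by
    have h1 := hTl η 0
    have h2 := norm_le_norm_add_norm_sub' (T η) (T 0)
    rw [sub_zero] at h1
    rw [hfix] at h1 h2
    linarith
  refine ⟨W η, hWc η, fun t ht => ?_, fun t => (hWb η t).trans ?_⟩
  · have h1 : η (pr t) = T η (pr t) := by rw [hfix]
    have h2 : T η (pr t) = Real.exp (-(N * (pr t:ℝ))) • ∫ s in (0:ℝ)..(pr t), f s (W η s) := rfl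
    change Real.exp (N * (pr t : ℝ)) • η (pr t) = _
    rw [h1, h2, smul_smul, ← Real.exp_add, hprs ht]
    simp
  · calc _ ≤ Real.exp N * (2 * b) := by gcongr
      _ = _ := by ring

section CLM

variable {E F : Type*} [NormedAddCommGroup E] [NormedSpace ℝ E] [MeasurableSpace E] [BorelSpace E]
  [SecondCountableTopology E] [NormedAddCommGroup F] [NormedSpace ℝ F] [MeasurableSpace F]
  [BorelSpace F]

lemma BddMeas.clm_apply {A : ℝ → E →L[ℝ] F} {K : ℝ} (hA : ∀ v, Measurable fun t => A t v)
    (hK : ∀ t, ‖A t‖ ≤ K) {h : ℝ → E} (hh : BddMeas h) : BddMeas (fun t => A t (h t)) := by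
  obtain ⟨C, hC⟩ := hh.2
  have h1 : Measurable (Function.uncurry fun v t => A t v) :=
    measurable_uncurry_of_continuous_of_measurable (fun t => (A t).continuous) hA
  refine ⟨h1.comp (hh.1.prodMk measurable_id), K * C, fun t => ?_⟩
  exact ((A t).le_opNorm _).trans
    (mul_le_mul (hK t) (hC t) (norm_nonneg _) ((norm_nonneg _).trans (hK t)))

lemma BddMeas.clm_apply₂ {B : ℝ → E →L[ℝ] E →L[ℝ] F} {K : ℝ}
    (hB : ∀ v w, Measurable fun t => B t v w) (hK : ∀ t, ‖B t‖ ≤ K) {h k : ℝ → E}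
    (hh : BddMeas h) (hk : BddMeas k) : BddMeas (fun t => B t (h t) (k t)) := by
  obtain ⟨C, hC⟩ := hh.2
  obtain ⟨D, hD⟩ := hk.2
  have h1 : Measurable (Function.uncurry fun (p : E × E) t => B t p.1 p.2) :=
    measurable_uncurry_of_continuous_of_measurable (fun t => by fun_prop) (fun p => hB p.1 p.2)
  refine ⟨h1.comp ((hh.1.prodMk hk.1).prodMk measurable_id), K * C * D, fun t => ?_⟩
  have hK0 : 0 ≤ K := le_trans (norm_nonneg (B t)) (hK t)
  have hC0 : 0 ≤ C := (norm_nonneg _).trans (hC t)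
  refine ((B t).le_opNorm₂ _ _).trans ?_
  gcongr
  exacts [hK t, hC t, hD t]

end CLM

/-- `f t` vanishes at the origin and has there the first and second derivatives `A t`, `B t`, with
remainder estimates on the unit ball that are uniform in `t`. -/
structure Taylor2 {E F : Type*} [NormedAddCommGroup E] [NormedSpace ℝ E] [MeasurableSpace E]
    [NormedAddCommGroup F] [NormedSpace ℝ F] [MeasurableSpace F] (K : ℝ) (f : ℝ → E → F)
    (A : ℝ → E →L[ℝ] F) (B : ℝ → E →L[ℝ] E →L[ℝ] F) : Prop where
  meas : Measurable (Function.uncurry f)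
  measA : ∀ v, Measurable fun t => A t v
  measB : ∀ v w, Measurable fun t => B t v w
  normA : ∀ t, ‖A t‖ ≤ K
  normB : ∀ t, ‖B t‖ ≤ K
  strict : ∀ t r h h', r ≤ 1 → ‖h‖ ≤ r → ‖h'‖ ≤ r →
    ‖f t h - f t h' - A t (h - h')‖ ≤ K * r * ‖h - h'‖
  taylor : ∀ t h, ‖h‖ ≤ 1 → ‖f t h - A t h - (1 / 2 : ℝ) • B t h h‖ ≤ K * ‖h‖ ^ 3

namespace Taylor2

variable {E F : Type*} [NormedAddCommGroup E] [NormedSpace ℝ E] [MeasurableSpace E]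
    [NormedAddCommGroup F] [NormedSpace ℝ F] [MeasurableSpace F] {K : ℝ} {f : ℝ → E → F}
    {A : ℝ → E →L[ℝ] F} {B : ℝ → E →L[ℝ] E →L[ℝ] F}

lemma nonneg (H : Taylor2 K f A B) : 0 ≤ K := (norm_nonneg _).trans (H.normA 0)

lemma mono (H : Taylor2 K f A B) {K' : ℝ} (hK : K ≤ K') : Taylor2 K' f A B where
  meas := H.meas
  measA := H.measA
  measB := H.measB
  normA t := (H.normA t).trans hK
  normB t := (H.normB t).trans hK
  strict t r h h' hr h1 h2 := (H.strict t r h h' hr h1 h2).trans (by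
    have := (norm_nonneg _).trans h1
    gcongr)
  taylor t h h1 := (H.taylor t h h1).trans (by gcongr)

lemma lip (H : Taylor2 K f A B) (t : ℝ) {h h' : E} (h1 : ‖h‖ ≤ 1) (h2 : ‖h'‖ ≤ 1) :
    ‖f t h - f t h'‖ ≤ 2 * K * ‖h - h'‖ := by
  have h3 := H.strict t 1 h h' le_rfl h1 h2
  have h4 := (A t).le_of_opNorm_le (H.normA t) (h - h')
  have h5 := norm_le_norm_add_norm_sub' (f t h - f t h') (A t (h - h'))
  linarith

lemma zero (H : Taylor2 K f A B) (t : ℝ) : f t 0 = 0 := by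
  simpa using H.taylor t 0 (by simp)

lemma second_order (H : Taylor2 K f A B) (t : ℝ) {z y : E} {M s : ℝ} (hM : 1 ≤ M)
    (hz : ‖z‖ ≤ M) (hy : ‖y‖ ≤ M) (hs : 0 ≤ s) (hs1 : 2 * M * s ≤ 1) :
    ‖f t (s • z + s ^ 2 • y) - (s • A t z + s ^ 2 • (A t y + (1 / 2 : ℝ) • B t z z))‖ ≤
      10 * K * M ^ 3 * s ^ 3 := by
  have hK := H.nonneg
  have hs2 : s ≤ 1 := by nlinarith
  have hM0 : 0 ≤ M := by linarith
  have hh : ‖s • z + s ^ 2 • y‖ ≤ 2 * M * s := by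
    refine (norm_add_le _ _).trans ?_
    rw [norm_smul, norm_smul, Real.norm_of_nonneg hs, Real.norm_of_nonneg (sq_nonneg s)]
    have h1 : s * ‖z‖ ≤ s * M := by gcongr
    have h2 : s ^ 2 * ‖y‖ ≤ (s * 1) * M := by rw [sq]; gcongr
    linarith
  have h1 := H.taylor t _ (hh.trans hs1)
  have h2 : K * ‖s • z + s ^ 2 • y‖ ^ 3 ≤ K * (2 * M * s) ^ 3 := by gcongr
  have hB : ∀ v w : E, ‖v‖ ≤ M → ‖w‖ ≤ M → ‖B t v w‖ ≤ K * M * M := fun v w hv hw =>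
    ((B t).le_opNorm₂ v w).trans (by gcongr; exact H.normB t)
  have h3 : f t (s • z + s ^ 2 • y) - (s • A t z + s ^ 2 • (A t y + (1 / 2 : ℝ) • B t z z)) =
      (f t (s • z + s ^ 2 • y) - A t (s • z + s ^ 2 • y) -
        (1 / 2 : ℝ) • B t (s • z + s ^ 2 • y) (s • z + s ^ 2 • y)) +
      (s ^ 3 / 2) • (B t z y + B t y z + s • B t y y) := by
    simp only [map_add, map_smul, _root_.add_apply, _root_.smul_apply]
    module
  have h4 : ‖B t z y + B t y z + s • B t y y‖ ≤ 3 * (K * M * M) := by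
    refine (norm_add₃_le).trans ?_
    have h5 : ‖s • B t y y‖ ≤ 1 * (K * M * M) := by
      rw [norm_smul, Real.norm_of_nonneg hs]
      exact mul_le_mul hs2 (hB y y hy hy) (norm_nonneg _) zero_le_one
    linarith [hB z y hz hy, hB y z hy hz]
  rw [h3]
  refine (norm_add_le _ _).trans ?_
  rw [norm_smul, Real.norm_of_nonneg (by positivity : 0 ≤ s ^ 3 / 2)]
  have h6 : s ^ 3 / 2 * ‖B t z y + B t y z + s • B t y y‖ ≤ s ^ 3 / 2 * (3 * (K * M * M)) := by
    gcongr
  have h7 : K * M * M ≤ K * M ^ 3 := by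
    have : K * M * M * 1 ≤ K * M * M * M := by gcongr
    nlinarith
  have h8 : s ^ 3 * (K * M * M) ≤ s ^ 3 * (K * M ^ 3) := by gcongr
  have h9 : 0 ≤ s ^ 3 * (K * M ^ 3) := by positivity
  nlinarith

end Taylor2

/-- Parametric fixed points of scalar contractions: measurability, Lipschitz dependence on the
parameter, and an a priori bound. -/
lemma exists_implicit_contraction {V : Type*} [NormedAddCommGroup V] [MeasurableSpace V]
    (T : ℝ → V → ℝ → ℝ) {K : ℝ}
    (hm : Measurable fun q : (ℝ × V) × ℝ => T q.1.1 q.1.2 q.2)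
    (hc : ∀ t x a b, |T t x a - T t x b| ≤ 1 / 2 * |a - b|)
    (hl : ∀ t x y a, |T t x a - T t y a| ≤ K * ‖x - y‖) :
    ∃ Z : ℝ → V → ℝ, Measurable (Function.uncurry Z) ∧ (∀ t x, T t x (Z t x) = Z t x) ∧
      (∀ t x y, |Z t x - Z t y| ≤ 2 * K * ‖x - y‖) ∧ ∀ t x, |Z t x| ≤ 2 * |T t x 0| := by
  have hT : ∀ t x, ContractingWith (1/2) (T t x) := fun t x => by
    refine ⟨by norm_num, LipschitzWith.of_dist_le_mul fun a b => ?_⟩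
    simpa [Real.dist_eq] using hc t x a b
  have hfix : ∀ t x, T t x ((hT t x).fixedPoint) = (hT t x).fixedPoint :=
    fun t x => (hT t x).fixedPoint_isFixedPt
  refine ⟨fun t x => (hT t x).fixedPoint, ?_, hfix, fun t x y => ?_, fun t x => ?_⟩
  · have hmk : ∀ k : ℕ, Measurable fun q : ℝ × V => (T q.1 q.2)^[k] 0 := by
      intro k
      induction k with
      | zero => exact measurable_const
      | succ k ih =>
        simp only [Function.iterate_succ_apply']
        exact hm.comp (measurable_id.prodMk ih)
    refine measurable_of_tendsto_metrizable hmk ?_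
    rw [tendsto_pi_nhds]
    exact fun q => (hT q.1 q.2).tendsto_iterate_fixedPoint 0
  · have h1 := hc t x (hT t x).fixedPoint (hT t y).fixedPoint
    have h2 := hl t x y (hT t y).fixedPoint
    have h3 := abs_sub_le (T t x (hT t x).fixedPoint) (T t x (hT t y).fixedPoint)
      (T t y (hT t y).fixedPoint)
    rw [hfix, hfix] at h3
    rw [hfix] at h1 h2
    beta_reduce
    linarith
  · have h1 := hc t x (hT t x).fixedPoint 0
    rw [hfix, sub_zero] at h1
    have h2 := abs_sub_abs_le_abs_sub (hT t x).fixedPoint (T t x 0)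
    linarith

/-- Truncation of a real number to `[-r, r]`. -/
def truncAt (r x : ℝ) : ℝ := max (-r) (min r x)

lemma continuous_truncAt (r : ℝ) : Continuous (truncAt r) := by unfold truncAt; fun_prop

lemma abs_truncAt_le {r : ℝ} (hr : 0 ≤ r) (x : ℝ) : |truncAt r x| ≤ r :=
  abs_le.2 ⟨le_max_left _ _, max_le (by linarith) (min_le_left _ _)⟩

lemma truncAt_of_abs_le {r x : ℝ} (h : |x| ≤ r) : truncAt r x = x := by
  rw [truncAt, min_eq_right (abs_le.1 h).2, max_eq_right (abs_le.1 h).1]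

lemma abs_truncAt_sub_le (r x y : ℝ) : |truncAt r x - truncAt r y| ≤ |x - y| := by
  have h1 := abs_max_sub_max_le_max (-r) (min r x) (-r) (min r y)
  have h2 := abs_min_sub_min_le_max r x r y
  simp only [sub_self, abs_zero, abs_nonneg, max_eq_right] at h1 h2
  exact h1.trans h2

/-- Coordinatewise truncation. -/
def truncVec {n : ℕ} (r : ℝ) (x : Fin n → ℝ) : Fin n → ℝ := fun i => truncAt r (x i)

lemma continuous_truncVec {n : ℕ} (r : ℝ) : Continuous (truncVec (n := n) r) :=
  continuous_pi fun i => (continuous_truncAt r).comp (continuous_apply i)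

lemma norm_truncVec_le {n : ℕ} {r : ℝ} (hr : 0 ≤ r) (x : Fin n → ℝ) : ‖truncVec r x‖ ≤ r :=
  (pi_norm_le_iff_of_nonneg hr).2 fun i => abs_truncAt_le hr (x i)

lemma truncVec_of_norm_le {n : ℕ} {r : ℝ} {x : Fin n → ℝ} (h : ‖x‖ ≤ r) : truncVec r x = x :=
  funext fun i => truncAt_of_abs_le ((norm_le_pi_norm x i).trans h)

lemma norm_truncVec_sub_le {n : ℕ} (r : ℝ) (x y : Fin n → ℝ) :
    ‖truncVec r x - truncVec r y‖ ≤ ‖x - y‖ :=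
  (pi_norm_le_iff_of_nonneg (norm_nonneg _)).2 fun i =>
    (abs_truncAt_sub_le r (x i) (y i)).trans (norm_le_pi_norm (x - y) i)

set_option maxHeartbeats 1000000 in
/-- A second-order tangential direction of a state equation with a regular mixed constraint is
followed, up to a third-order error, by exact solutions of the state equation along which the
constraint function takes a prescribed second-order expansion. -/
lemma exists_corrected_path {n l : ℕ} {K α : ℝ}
    {φ : ℝ → (Fin n → ℝ) × (Fin l → ℝ) → (Fin n → ℝ)}
    {Aφ : ℝ → (Fin n → ℝ) × (Fin l → ℝ) →L[ℝ] (Fin n → ℝ)}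
    {Bφ : ℝ → (Fin n → ℝ) × (Fin l → ℝ) →L[ℝ] (Fin n → ℝ) × (Fin l → ℝ) →L[ℝ] (Fin n → ℝ)}
    (Hφ : Taylor2 K φ Aφ Bφ)
    {g : ℝ → (Fin n → ℝ) × (Fin l → ℝ) → ℝ} {Ag : ℝ → (Fin n → ℝ) × (Fin l → ℝ) →L[ℝ] ℝ}
    {Bg : ℝ → (Fin n → ℝ) × (Fin l → ℝ) →L[ℝ] (Fin n → ℝ) × (Fin l → ℝ) →L[ℝ] ℝ}
    (Hg : Taylor2 K g Ag Bg)
    (e : Fin l → ℝ) (he : ‖e‖ ≤ 1) (hα : 0 < α) (ha : ∀ t, α ≤ |Ag t (0, e)|)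
    {z y : ℝ → (Fin n → ℝ) × (Fin l → ℝ)} (hz : BddMeas z) (hy : BddMeas y)
    (hzeq : ∀ t ∈ Set.Icc (0:ℝ) 1, (z t).1 = ∫ s in (0:ℝ)..t, Aφ s (z s))
    (hyeq : ∀ t ∈ Set.Icc (0:ℝ) 1,
      (y t).1 = ∫ s in (0:ℝ)..t, (Aφ s (y s) + (1 / 2 : ℝ) • Bφ s (z s) (z s))) :
    ∃ C > 0, ∃ s₀ > 0, ∀ s, 0 < s → s < s₀ → ∃ h : ℝ → (Fin n → ℝ) × (Fin l → ℝ),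
      BddMeas h ∧ (∀ t, ‖h t‖ ≤ 1) ∧ ContinuousOn (fun t => (h t).1) (Set.Icc 0 1) ∧
      (∀ t ∈ Set.Icc (0:ℝ) 1, (h t).1 = ∫ r in (0:ℝ)..t, φ r (h r)) ∧
      (∀ t, ‖h t - (s • z t + s ^ 2 • y t)‖ ≤ C * s ^ 3) ∧
      ∀ t, g t (h t) = s • Ag t (z t) + s ^ 2 • (Ag t (y t) + (1 / 2 : ℝ) • Bg t (z t) (z t)) := by
  have hK := Hφ.nonneg
  obtain ⟨M, hM, hzM, hyM⟩ : ∃ M, 1 ≤ M ∧ (∀ t, ‖z t‖ ≤ M) ∧ ∀ t, ‖y t‖ ≤ M := by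
    obtain ⟨M₁, h1⟩ := hz.2
    obtain ⟨M₂, h2⟩ := hy.2
    exact ⟨max 1 (max M₁ M₂), le_max_left _ _, fun t => (h1 t).trans (by simp),
      fun t => (h2 t).trans (by simp)⟩
  set ρ : ℝ := min (1 / 2) (α / (4 * K + 4)) with hρ
  have hρ0 : 0 < ρ := by positivity
  have hρ1 : 2 * ρ ≤ 1 := by have := min_le_left (1 / 2 : ℝ) (α / (4 * K + 4)); linarith
  have hρ2 : α⁻¹ * (K * (2 * ρ)) ≤ 1 / 2 := by
    have h1 : ρ ≤ α / (4 * K + 4) := min_le_right _ _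
    rw [le_div_iff₀ (by positivity)] at h1
    rw [inv_mul_le_iff₀ hα]
    nlinarith
  set C₁ : ℝ := 10 * K * M ^ 3 with hC₁
  have hC₁0 : 0 ≤ C₁ := by positivity
  set Kf : ℝ := 2 * K * (1 + 2 * (α⁻¹ * (2 * K))) with hKf
  have hKf0 : 0 ≤ Kf := by positivity
  set C₀ : ℝ := 2 * (α⁻¹ * C₁) with hC₀
  have hC₀0 : 0 ≤ C₀ := by positivity
  set C₂ : ℝ := 2 * Real.exp (2 * Kf + 1) * (2 * K * C₀ + C₁) with hC₂
  have hC₂0 : 0 ≤ C₂ := by positivity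
  set C₃ : ℝ := 2 * (α⁻¹ * (2 * K)) * C₂ + C₀ with hC₃
  have hC₃0 : 0 ≤ C₃ := by positivity
  set C : ℝ := C₂ + C₃ + 1 with hC
  have hC0 : 0 < C := by positivity
  refine ⟨C, hC0, min 1 (min (ρ / (2 * M)) (ρ / C)), by positivity, fun s hs hs₀ => ?_⟩
  have hs1 : s ≤ 1 := hs₀.le.trans (min_le_left _ _)
  have hsM : 2 * M * s ≤ ρ := by
    have h1 : s ≤ ρ / (2 * M) := hs₀.le.trans ((min_le_right _ _).trans (min_le_left _ _))
    rw [le_div_iff₀ (by positivity)] at h1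
    linarith
  have hsC : C * s ^ 3 ≤ ρ := by
    have h1 : s ≤ ρ / C := hs₀.le.trans ((min_le_right _ _).trans (min_le_right _ _))
    rw [le_div_iff₀ (by positivity)] at h1
    have h2 : s ^ 3 ≤ s := by
      calc s ^ 3 ≤ s ^ 1 := pow_le_pow_of_le_one hs.le hs1 (by norm_num)
        _ = s := pow_one s
    nlinarith
  have hsM1 : 2 * M * s ≤ 1 := by linarith
  let h₀ : ℝ → (Fin n → ℝ) × (Fin l → ℝ) := fun t => s • z t + s ^ 2 • y t
  have hh₀m : Measurable h₀ := (hz.1.const_smul s).add (hy.1.const_smul (s ^ 2))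
  have hh₀ : ∀ t, ‖h₀ t‖ ≤ ρ := fun t => by
    refine (norm_add_le _ _).trans (le_trans ?_ hsM)
    rw [norm_smul, norm_smul, Real.norm_of_nonneg hs.le, Real.norm_of_nonneg (sq_nonneg s)]
    have h1 : s * ‖z t‖ ≤ s * M := by gcongr; exact hzM t
    have h2 : s ^ 2 * ‖y t‖ ≤ (s * 1) * M := by rw [sq]; gcongr; exact hyM t
    linarith
  have hh₀1 : ∀ t, ‖h₀ t‖ ≤ 1 := fun t => (hh₀ t).trans (by linarith)
  let H : ℝ → (Fin n → ℝ) → ℝ → (Fin n → ℝ) × (Fin l → ℝ) :=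
    fun t ξ ζ => h₀ t + (truncVec ρ ξ, truncAt ρ ζ • e)
  have hH : ∀ t ξ ζ, ‖H t ξ ζ‖ ≤ 2 * ρ := fun t ξ ζ => by
    have h1 : ‖((truncVec ρ ξ, truncAt ρ ζ • e) : (Fin n → ℝ) × (Fin l → ℝ))‖ ≤ ρ := by
      refine max_le (norm_truncVec_le hρ0.le ξ) ?_
      change ‖truncAt ρ ζ • e‖ ≤ ρ
      rw [norm_smul, Real.norm_eq_abs]
      have := abs_truncAt_le hρ0.le ζ
      calc _ ≤ ρ * 1 := by gcongr
        _ = ρ := mul_one ρ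
    linarith [norm_add_le (h₀ t) (truncVec ρ ξ, truncAt ρ ζ • e), hh₀ t]
  have hH1 : ∀ t ξ ζ, ‖H t ξ ζ‖ ≤ 1 := fun t ξ ζ => (hH t ξ ζ).trans hρ1
  have hHsub : ∀ t ξ ζ ξ' ζ', ‖H t ξ ζ - H t ξ' ζ'‖ ≤ ‖ξ - ξ'‖ + |ζ - ζ'| := by
    intro t ξ ζ ξ' ζ'
    have h1 : H t ξ ζ - H t ξ' ζ' =
        (truncVec ρ ξ - truncVec ρ ξ', (truncAt ρ ζ - truncAt ρ ζ') • e) := by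
      simp only [H, add_sub_add_left_eq_sub, Prod.mk_sub_mk, sub_smul]
    rw [h1]
    refine max_le ((norm_truncVec_sub_le _ _ _).trans (by simp)) ?_
    change ‖(truncAt ρ ζ - truncAt ρ ζ') • e‖ ≤ _
    rw [norm_smul, Real.norm_eq_abs]
    have h2 := abs_truncAt_sub_le ρ ζ ζ'
    calc _ ≤ |ζ - ζ'| * 1 := by gcongr
      _ ≤ _ := by simp
  have hH0 : ∀ t, H t 0 0 = h₀ t := fun t => by
    simp [H, truncVec_of_norm_le (x := (0 : Fin n → ℝ)) (by simpa using hρ0.le),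
      truncAt_of_abs_le (x := 0) (by simpa using hρ0.le)]
  have hHm : Measurable fun q : (ℝ × (Fin n → ℝ)) × ℝ => H q.1.1 q.1.2 q.2 := by
    refine (hh₀m.comp (measurable_fst.comp measurable_fst)).add (Measurable.prodMk ?_ ?_)
    · exact (continuous_truncVec ρ).measurable.comp (measurable_snd.comp measurable_fst)
    · exact ((continuous_truncAt ρ).measurable.comp measurable_snd).smul_const e
  let a : ℝ → ℝ := fun t => Ag t (0, e)
  have ham : Measurable a := Hg.measA _
  have ha0 : ∀ t, a t ≠ 0 := fun t => abs_pos.1 (hα.trans_le (ha t))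
  have hainv : ∀ t, |(a t)⁻¹| ≤ α⁻¹ := fun t => by
    rw [abs_inv]; exact inv_anti₀ hα (ha t)
  let τ : ℝ → ℝ := fun t =>
    s • Ag t (z t) + s ^ 2 • (Ag t (y t) + (1 / 2 : ℝ) • Bg t (z t) (z t))
  have hτ : BddMeas τ :=
    ((BddMeas.const s).smul (BddMeas.clm_apply Hg.measA Hg.normA hz)).add
      ((BddMeas.const (s ^ 2)).smul ((BddMeas.clm_apply Hg.measA Hg.normA hy).add
        ((BddMeas.const (1 / 2 : ℝ)).smul (BddMeas.clm_apply₂ Hg.measB Hg.normB hz hz))))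
  let σ : ℝ → (Fin n → ℝ) := fun t =>
    s • Aφ t (z t) + s ^ 2 • (Aφ t (y t) + (1 / 2 : ℝ) • Bφ t (z t) (z t))
  have hAz := BddMeas.clm_apply Hφ.measA Hφ.normA hz
  have hσ₂ := (BddMeas.clm_apply Hφ.measA Hφ.normA hy).add
        ((BddMeas.const (1 / 2 : ℝ)).smul (BddMeas.clm_apply₂ Hφ.measB Hφ.normB hz hz))
  have hσ : BddMeas σ := ((BddMeas.const s).smul hAz).add ((BddMeas.const (s ^ 2)).smul hσ₂)
  obtain ⟨Z, hZm, hZfix, hZl, hZ0⟩ := exists_implicit_contraction (K := α⁻¹ * (2 * K))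
    (fun t ξ ζ => truncAt ρ ζ - (a t)⁻¹ * (g t (H t ξ ζ) - τ t))
    (by
      have h1 : Measurable fun q : (ℝ × (Fin n → ℝ)) × ℝ => g q.1.1 (H q.1.1 q.1.2 q.2) :=
        Hg.meas.comp ((measurable_fst.comp measurable_fst).prodMk hHm)
      have h2 : Measurable fun q : (ℝ × (Fin n → ℝ)) × ℝ => (a q.1.1)⁻¹ :=
        (ham.comp (measurable_fst.comp measurable_fst)).inv
      have h3 : Measurable fun q : (ℝ × (Fin n → ℝ)) × ℝ => τ q.1.1 :=
        hτ.1.comp (measurable_fst.comp measurable_fst)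
      exact ((continuous_truncAt ρ).measurable.comp measurable_snd).sub (h2.mul (h1.sub h3)))
    (by
      intro t ξ ζ ζ'
      have h1 := Hg.strict t (2 * ρ) _ _ hρ1 (hH t ξ ζ) (hH t ξ ζ')
      have h2 : Ag t (H t ξ ζ - H t ξ ζ') = a t * (truncAt ρ ζ - truncAt ρ ζ') := by
        have h3 : H t ξ ζ - H t ξ ζ' =
            (truncAt ρ ζ - truncAt ρ ζ') • ((0, e) : (Fin n → ℝ) × (Fin l → ℝ)) := by
          simp only [H, add_sub_add_left_eq_sub, Prod.mk_sub_mk, sub_self, Prod.smul_mk, smul_zero,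
            sub_smul]
        rw [h3, map_smul, smul_eq_mul, mul_comm]
      have h4 : (truncAt ρ ζ - (a t)⁻¹ * (g t (H t ξ ζ) - τ t)) -
          (truncAt ρ ζ' - (a t)⁻¹ * (g t (H t ξ ζ') - τ t)) =
          -((a t)⁻¹ * (g t (H t ξ ζ) - g t (H t ξ ζ') - Ag t (H t ξ ζ - H t ξ ζ'))) := by
        rw [h2]
        have := ha0 t
        field_simp
        ring
      have h5 : ‖H t ξ ζ - H t ξ ζ'‖ ≤ |ζ - ζ'| := by simpa using hHsub t ξ ζ ξ ζ'
      rw [h4, abs_neg, abs_mul]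
      rw [Real.norm_eq_abs] at h1
      calc _ ≤ α⁻¹ * (K * (2 * ρ) * |ζ - ζ'|) := by
            gcongr
            · exact hainv t
            · exact h1.trans (by gcongr)
        _ = α⁻¹ * (K * (2 * ρ)) * |ζ - ζ'| := by ring
        _ ≤ _ := by gcongr)
    (by
      intro t ξ ξ' ζ
      have h1 := Hg.lip t (hH1 t ξ ζ) (hH1 t ξ' ζ)
      have h4 : (truncAt ρ ζ - (a t)⁻¹ * (g t (H t ξ ζ) - τ t)) -
          (truncAt ρ ζ - (a t)⁻¹ * (g t (H t ξ' ζ) - τ t)) =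
          -((a t)⁻¹ * (g t (H t ξ ζ) - g t (H t ξ' ζ))) := by ring
      have h5 : ‖H t ξ ζ - H t ξ' ζ‖ ≤ ‖ξ - ξ'‖ := by simpa using hHsub t ξ ζ ξ' ζ
      rw [h4, abs_neg, abs_mul]
      rw [Real.norm_eq_abs] at h1
      calc _ ≤ α⁻¹ * (2 * K * ‖ξ - ξ'‖) := by
            gcongr
            · exact hainv t
            · exact h1.trans (by gcongr)
        _ = _ := by ring)
  have hZ00 : ∀ t, |Z t 0| ≤ C₀ * s ^ 3 := fun t => by
    have h1 := hZ0 t 0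
    have h2 := Hg.second_order t hM (hzM t) (hyM t) hs.le hsM1
    rw [hH0, truncAt_of_abs_le (x := 0) (by simpa using hρ0.le), zero_sub, abs_neg, abs_mul] at h1
    rw [Real.norm_eq_abs] at h2
    calc _ ≤ 2 * (|(a t)⁻¹| * |g t (h₀ t) - τ t|) := h1
      _ ≤ 2 * (α⁻¹ * (C₁ * s ^ 3)) := by gcongr; exact hainv t
      _ = _ := by ring
  let f : ℝ → (Fin n → ℝ) → (Fin n → ℝ) := fun t ξ => φ t (H t ξ (Z t ξ)) - σ t
  have hHZm : Measurable fun q : ℝ × (Fin n → ℝ) => H q.1 q.2 (Z q.1 q.2) :=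
    hHm.comp (measurable_id.prodMk hZm)
  have hfm : Measurable (Function.uncurry f) :=
    (Hφ.meas.comp (measurable_fst.prodMk hHZm)).sub (hσ.1.comp measurable_fst)
  have hfl : ∀ t ξ ξ', ‖f t ξ - f t ξ'‖ ≤ Kf * ‖ξ - ξ'‖ := fun t ξ ξ' => by
    simp only [f, sub_sub_sub_cancel_right]
    refine (Hφ.lip t (hH1 _ _ _) (hH1 _ _ _)).trans ?_
    have h1 := hHsub t ξ (Z t ξ) ξ' (Z t ξ')
    have h2 := hZl t ξ ξ'
    calc _ ≤ 2 * K * (‖ξ - ξ'‖ + 2 * (α⁻¹ * (2 * K)) * ‖ξ - ξ'‖) := by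
          gcongr; linarith
      _ = _ := by ring
  have hf0 : ∀ t, ‖f t 0‖ ≤ (2 * K * C₀ + C₁) * s ^ 3 := fun t => by
    have h1 := Hφ.second_order t hM (hzM t) (hyM t) hs.le hsM1
    have h2 := Hφ.lip t (hH1 t 0 (Z t 0)) (hH1 t 0 0)
    have h3 : ‖H t 0 (Z t 0) - H t 0 0‖ ≤ C₀ * s ^ 3 := by
      refine (hHsub t 0 (Z t 0) 0 0).trans ?_
      simpa using hZ00 t
    rw [hH0] at h2 h3
    have h4 : f t 0 = (φ t (H t 0 (Z t 0)) - φ t (h₀ t)) + (φ t (h₀ t) - σ t) := by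
      simp only [f]; abel
    rw [h4]
    refine (norm_add_le _ _).trans ?_
    have h5 : 2 * K * ‖H t 0 (Z t 0) - h₀ t‖ ≤ 2 * K * (C₀ * s ^ 3) := by gcongr
    have h6 : ‖φ t (h₀ t) - σ t‖ ≤ C₁ * s ^ 3 := h1
    linarith
  obtain ⟨ξ, hξc, hξeq, hξb⟩ := exists_caratheodory_solution f hfm hKf0 hfl hf0
  have hξ2 : ∀ t, ‖ξ t‖ ≤ C₂ * s ^ 3 := fun t => (hξb t).trans_eq (by ring)
  have hζ3 : ∀ t, |Z t (ξ t)| ≤ C₃ * s ^ 3 := fun t => by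
    have h1 := hZl t (ξ t) 0
    have h2 := abs_sub_abs_le_abs_sub (Z t (ξ t)) (Z t 0)
    rw [sub_zero] at h1
    have h3 : 2 * (α⁻¹ * (2 * K)) * ‖ξ t‖ ≤ 2 * (α⁻¹ * (2 * K)) * (C₂ * s ^ 3) := by
      gcongr; exact hξ2 t
    linarith [hZ00 t]
  have hs3 : 0 < s ^ 3 := by positivity
  have hξρ : ∀ t, ‖ξ t‖ ≤ C * s ^ 3 := fun t => (hξ2 t).trans (by gcongr; linarith)
  have hζρ : ∀ t, |Z t (ξ t)| ≤ C * s ^ 3 := fun t => (hζ3 t).trans (by gcongr; linarith)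
  have hHeq : ∀ t, H t (ξ t) (Z t (ξ t)) = h₀ t + (ξ t, Z t (ξ t) • e) := fun t => by
    simp only [H, truncVec_of_norm_le ((hξρ t).trans hsC), truncAt_of_abs_le ((hζρ t).trans hsC)]
  have hhm : Measurable fun t => H t (ξ t) (Z t (ξ t)) :=
    hHZm.comp (measurable_id.prodMk hξc.measurable)
  have hφB : BddMeas fun t => φ t (H t (ξ t) (Z t (ξ t))) := by
    refine ⟨Hφ.meas.comp (measurable_id.prodMk hhm), 2 * K, fun t => ?_⟩
    have h1 := Hφ.lip t (hH1 t (ξ t) (Z t (ξ t))) (h' := 0) (by simp)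
    rw [Hφ.zero, sub_zero, sub_zero] at h1
    calc _ ≤ 2 * K * 1 := h1.trans (by gcongr; exact hH1 _ _ _)
      _ = 2 * K := mul_one _
  have hstate : ∀ t ∈ Set.Icc (0:ℝ) 1, (H t (ξ t) (Z t (ξ t))).1 =
      ∫ r in (0:ℝ)..t, φ r (H r (ξ r) (Z r (ξ r))) := fun t ht => by
    have h1 : ∫ r in (0:ℝ)..t, σ r = s • (z t).1 + s ^ 2 • (y t).1 := by
      rw [hzeq t ht, hyeq t ht, ← intervalIntegral.integral_smul, ← intervalIntegral.integral_smul,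
        ← intervalIntegral.integral_add]
      · exact ((BddMeas.const s).smul hAz).intervalIntegrable _ _
      · exact ((BddMeas.const (s ^ 2)).smul hσ₂).intervalIntegrable _ _
    have h2 := hξeq t ht
    simp only [f] at h2
    rw [intervalIntegral.integral_sub (hφB.intervalIntegrable _ _) (hσ.intervalIntegrable _ _),
      h1] at h2
    rw [hHeq]
    simp only [h₀, Prod.fst_add, Prod.smul_fst]
    rw [h2]
    abel
  refine ⟨fun t => H t (ξ t) (Z t (ξ t)), ⟨hhm, 1, fun t => hH1 _ _ _⟩, fun t => hH1 _ _ _,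
    ?_, hstate, fun t => ?_, fun t => ?_⟩
  · exact (intervalIntegral.continuous_primitive (μ := volume)
      hφB.intervalIntegrable 0).continuousOn.congr hstate
  · simp only [hHeq, h₀, add_sub_cancel_left]
    refine max_le (hξρ t) ?_
    change ‖Z t (ξ t) • e‖ ≤ _
    rw [norm_smul, Real.norm_eq_abs]
    calc _ ≤ |Z t (ξ t)| * 1 := by gcongr
      _ ≤ _ := by simpa using hζρ t
  · have h1 := hZfix t (ξ t)
    rw [truncAt_of_abs_le ((hζρ t).trans hsC)] at h1
    have h2 : (a t)⁻¹ * (g t (H t (ξ t) (Z t (ξ t))) - τ t) = 0 := by linarith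
    rcases mul_eq_zero.1 h2 with h3 | h3
    · exact absurd (inv_eq_zero.1 h3) (ha0 t)
    · exact sub_eq_zero.1 h3

lemma integral_mul_add_mul_of_primitive {p y q r : ℝ → ℝ} (hq : BddMeas q) (hr : BddMeas r)
    (hp : ∀ t ∈ Set.Icc (0:ℝ) 1, p t = p 0 + ∫ s in (0:ℝ)..t, q s)
    (hy : ∀ t ∈ Set.Icc (0:ℝ) 1, y t = ∫ s in (0:ℝ)..t, r s) :
    ∫ t in (0:ℝ)..1, (q t * y t + p t * r t) = p 1 * y 1 := by
  have hqi := hq.intervalIntegrable 0 1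
  have hri := hr.intervalIntegrable 0 1
  have hQ := hqi.absolutelyContinuousOnInterval_intervalIntegral (c := 0) (by simp)
  have hR := hri.absolutelyContinuousOnInterval_intervalIntegral (c := 0) (by simp)
  have h1 := hQ.integral_deriv_mul_eq_sub hR
  have h2 : ∫ t in (0:ℝ)..1, (q t * y t + p t * r t) =
      ∫ t in (0:ℝ)..1, ((deriv (fun x => ∫ v in (0:ℝ)..x, q v) t * (∫ v in (0:ℝ)..t, r v) +
        (∫ v in (0:ℝ)..t, q v) * deriv (fun x => ∫ v in (0:ℝ)..x, r v) t) + p 0 * r t) := by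
    apply intervalIntegral.integral_congr_ae
    filter_upwards [hqi.ae_hasDerivAt_integral, hri.ae_hasDerivAt_integral] with t h3 h4 ht
    have ht' : t ∈ Set.uIcc (0:ℝ) 1 := Set.uIoc_subset_uIcc ht
    have ht'' : t ∈ Set.Icc (0:ℝ) 1 := by rwa [Set.uIcc_of_le zero_le_one] at ht'
    rw [(h3 ht' 0 (by simp)).deriv, (h4 ht' 0 (by simp)).deriv, hp t ht'', hy t ht'']
    ring
  rw [h2, intervalIntegral.integral_add, h1, intervalIntegral.integral_const_mul,
    hp 1 (by simp), hy 1 (by simp)]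
  · simp only [intervalIntegral.integral_same]; ring
  · exact (hQ.intervalIntegrable_deriv.mul_continuousOn hR.continuousOn).add
      (hR.intervalIntegrable_deriv.continuousOn_mul hQ.continuousOn)
  · exact hri.const_mul _

lemma abs_sum_mul_le {n : ℕ} (p v : Fin n → ℝ) : |∑ k, p k * v k| ≤ n * (‖p‖ * ‖v‖) := by
  refine (Finset.abs_sum_le_sum_abs _ _).trans ?_
  calc _ ≤ ∑ _k : Fin n, ‖p‖ * ‖v‖ := Finset.sum_le_sum fun k _ => by
        rw [abs_mul]
        exact mul_le_mul (norm_le_pi_norm p k) (norm_le_pi_norm v k) (abs_nonneg _) (norm_nonneg _)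
    _ = _ := by simp

section Adjoint

variable {n l : ℕ}
  {AL Ag : ℝ → (Fin n → ℝ) × (Fin l → ℝ) →L[ℝ] ℝ}
  {Aφ : ℝ → (Fin n → ℝ) × (Fin l → ℝ) →L[ℝ] (Fin n → ℝ)}

/-- The derivative of the Hamiltonian `AL + p ⬝ Aφ + θ Ag` in the direction `v`. -/
def hamDeriv (AL Ag : ℝ → (Fin n → ℝ) × (Fin l → ℝ) →L[ℝ] ℝ)
    (Aφ : ℝ → (Fin n → ℝ) × (Fin l → ℝ) →L[ℝ] (Fin n → ℝ)) (p : ℝ → Fin n → ℝ) (θ : ℝ → ℝ)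
    (t : ℝ) (v : (Fin n → ℝ) × (Fin l → ℝ)) : ℝ :=
  AL t v + (∑ k, p t k * Aφ t v k) + θ t * Ag t v

lemma hamDeriv_add (p : ℝ → Fin n → ℝ) (θ : ℝ → ℝ) (t : ℝ) (v w : (Fin n → ℝ) × (Fin l → ℝ)) :
    hamDeriv AL Ag Aφ p θ t (v + w) = hamDeriv AL Ag Aφ p θ t v + hamDeriv AL Ag Aφ p θ t w := by
  simp only [hamDeriv, map_add, Pi.add_apply, mul_add, Finset.sum_add_distrib]
  ring

lemma hamDeriv_smul (p : ℝ → Fin n → ℝ) (θ : ℝ → ℝ) (t c : ℝ) (v : (Fin n → ℝ) × (Fin l → ℝ)) :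
    hamDeriv AL Ag Aφ p θ t (c • v) = c * hamDeriv AL Ag Aφ p θ t v := by
  have h1 : ∑ k, p t k * (c * Aφ t v k) = c * ∑ k, p t k * Aφ t v k := by
    rw [Finset.mul_sum]
    exact Finset.sum_congr rfl fun k _ => by ring
  simp only [hamDeriv, map_smul, Pi.smul_apply, smul_eq_mul, h1]
  ring

lemma hamDeriv_state (p : ℝ → Fin n → ℝ) (θ : ℝ → ℝ) (t : ℝ) (x : Fin n → ℝ) :
    hamDeriv AL Ag Aφ p θ t (x, 0) =
      ∑ i, x i * hamDeriv AL Ag Aφ p θ t (Pi.single i 1, 0) := by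
  have h1 : ((x, 0) : (Fin n → ℝ) × (Fin l → ℝ)) =
      ∑ i, x i • ((Pi.single i 1, 0) : (Fin n → ℝ) × (Fin l → ℝ)) := by
    ext j
    · simp [Prod.fst_sum, Finset.sum_apply, Pi.single_apply]
    · simp [Prod.snd_sum]
  let T : (Fin n → ℝ) × (Fin l → ℝ) →ₗ[ℝ] ℝ :=
    { toFun := hamDeriv AL Ag Aφ p θ t
      map_add' := hamDeriv_add p θ t
      map_smul' := hamDeriv_smul p θ t }
  change T _ = ∑ i, x i * T _
  rw [h1, map_sum]
  exact Finset.sum_congr rfl fun i _ => by rw [map_smul, smul_eq_mul]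

lemma norm_pi_single_one_le (i : Fin n) : ‖(Pi.single i 1 : Fin n → ℝ)‖ ≤ 1 := by
  refine (pi_norm_le_iff_of_nonneg zero_le_one).2 fun j => ?_
  rcases eq_or_ne j i with rfl | h
  · simp
  · simp [h]

lemma BddMeas.hamDeriv {K : ℝ} (hALm : ∀ v, Measurable fun t => AL t v) (hALb : ∀ t, ‖AL t‖ ≤ K)
    (hAφm : ∀ v, Measurable fun t => Aφ t v) (hAφb : ∀ t, ‖Aφ t‖ ≤ K)
    (hAgm : ∀ v, Measurable fun t => Ag t v) (hAgb : ∀ t, ‖Ag t‖ ≤ K)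
    {p : ℝ → Fin n → ℝ} {θ : ℝ → ℝ} {v : ℝ → (Fin n → ℝ) × (Fin l → ℝ)}
    (hp : BddMeas p) (hθ : BddMeas θ) (hv : BddMeas v) :
    BddMeas fun t => hamDeriv AL Ag Aφ p θ t (v t) :=
  ((BddMeas.clm_apply hALm hALb hv).add (BddMeas.sum _ fun k _ =>
    (hp.eval k).mul ((BddMeas.clm_apply hAφm hAφb hv).eval k))).add
    (hθ.mul (BddMeas.clm_apply hAgm hAgb hv))

lemma exists_adjoint {K α : ℝ} (hK : 0 ≤ K)
    (hALm : ∀ v, Measurable fun t => AL t v) (hALb : ∀ t, ‖AL t‖ ≤ K)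
    (hAφm : ∀ v, Measurable fun t => Aφ t v) (hAφb : ∀ t, ‖Aφ t‖ ≤ K)
    (hAgm : ∀ v, Measurable fun t => Ag t v) (hAgb : ∀ t, ‖Ag t‖ ≤ K)
    (e : Fin l → ℝ) (he : ‖e‖ ≤ 1) (hα : 0 < α) (ha : ∀ t, α ≤ |Ag t (0, e)|) :
    ∃ (p : ℝ → Fin n → ℝ) (θ : ℝ → ℝ), BddMeas p ∧ BddMeas θ ∧ p 1 = 0 ∧
      (∀ t ∈ Set.Icc (0:ℝ) 1, p t = p 0 + ∫ s in (0:ℝ)..t,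
        (fun i => -hamDeriv AL Ag Aφ p θ s (Pi.single i 1, 0))) ∧
      ∀ t, hamDeriv AL Ag Aφ p θ t (0, e) = 0 := by
  let a : ℝ → ℝ := fun t => Ag t (0, e)
  have ha0 : ∀ t, a t ≠ 0 := fun t => abs_pos.1 (hα.trans_le (ha t))
  have hainv : ∀ t, |(a t)⁻¹| ≤ α⁻¹ := fun t => by
    rw [abs_inv]; exact inv_anti₀ hα (ha t)
  have ham : Measurable a := hAgm _
  let Θ : ℝ → (Fin n → ℝ) → ℝ := fun t x =>
    -((a t)⁻¹ * (AL t (0, e) + ∑ k, x k * Aφ t (0, e) k))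
  let G : ℝ → (Fin n → ℝ) → (Fin n → ℝ) := fun t x i =>
    AL t (Pi.single i 1, 0) + (∑ k, x k * Aφ t (Pi.single i 1, 0) k) +
      Θ t x * Ag t (Pi.single i 1, 0)
  have hAφk : ∀ v k, Measurable fun t => Aφ t v k := fun v k =>
    (measurable_pi_apply k).comp (hAφm v)
  have hpair : ∀ v, Measurable fun q : ℝ × (Fin n → ℝ) => ∑ k, q.2 k * Aφ q.1 v k := fun v =>
    Finset.measurable_sum _ fun k _ =>
      ((measurable_pi_apply k).comp measurable_snd).mul ((hAφk v k).comp measurable_fst)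
  have hΘm : Measurable (Function.uncurry Θ) :=
    ((ham.comp measurable_fst).inv.mul (((hALm _).comp measurable_fst).add (hpair _))).neg
  have hGm : Measurable (Function.uncurry G) := measurable_pi_lambda _ fun i =>
    (((hALm _).comp measurable_fst).add (hpair _)).add (hΘm.mul ((hAgm _).comp measurable_fst))
  have he' : ‖((0, e) : (Fin n → ℝ) × (Fin l → ℝ))‖ ≤ 1 := max_le (by simp) he
  have hi' : ∀ i, ‖((Pi.single i 1, 0) : (Fin n → ℝ) × (Fin l → ℝ))‖ ≤ 1 := fun i =>
    max_le (norm_pi_single_one_le i) (by simp)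
  have hALv : ∀ t v, ‖v‖ ≤ 1 → |AL t v| ≤ K := fun t v hv =>
    ((AL t).le_of_opNorm_le_of_le (hALb t) hv).trans_eq (mul_one K)
  have hAgv : ∀ t v, ‖v‖ ≤ 1 → |Ag t v| ≤ K := fun t v hv =>
    ((Ag t).le_of_opNorm_le_of_le (hAgb t) hv).trans_eq (mul_one K)
  have hAφv : ∀ t v, ‖v‖ ≤ 1 → ‖Aφ t v‖ ≤ K := fun t v hv =>
    ((Aφ t).le_of_opNorm_le_of_le (hAφb t) hv).trans_eq (mul_one K)
  have hpl : ∀ (t : ℝ) (v : (Fin n → ℝ) × (Fin l → ℝ)) (x y : Fin n → ℝ), ‖v‖ ≤ 1 →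
      |∑ k, x k * Aφ t v k - ∑ k, y k * Aφ t v k| ≤ n * K * ‖x - y‖ := by
    intro t v x y hv
    rw [← Finset.sum_sub_distrib]
    have h1 := abs_sum_mul_le (x - y) (Aφ t v)
    simp only [Pi.sub_apply, sub_mul] at h1
    refine h1.trans ?_
    calc _ ≤ n * (‖x - y‖ * K) := by gcongr; exact hAφv t v hv
      _ = _ := by ring
  have hΘl : ∀ t x y, |Θ t x - Θ t y| ≤ α⁻¹ * (n * K * ‖x - y‖) := by
    intro t x y
    have h1 : Θ t x - Θ t y =
        -((a t)⁻¹ * (∑ k, x k * Aφ t (0, e) k - ∑ k, y k * Aφ t (0, e) k)) := by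
      simp only [Θ]; ring
    rw [h1, abs_neg, abs_mul]
    exact mul_le_mul (hainv t) (hpl t _ x y he') (abs_nonneg _) (by positivity)
  have hΘ0 : ∀ t, |Θ t 0| ≤ α⁻¹ * K := fun t => by
    simp only [Θ, Pi.zero_apply, zero_mul, Finset.sum_const_zero, add_zero, abs_neg, abs_mul]
    exact mul_le_mul (hainv t) (hALv t _ he') (abs_nonneg _) (by positivity)
  have hGl : ∀ t x y, ‖G t x - G t y‖ ≤ (n * K + α⁻¹ * (n * K) * K) * ‖x - y‖ := by
    intro t x y
    refine (pi_norm_le_iff_of_nonneg (by positivity)).2 fun i => ?_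
    have h1 : (G t x - G t y) i = (∑ k, x k * Aφ t (Pi.single i 1, 0) k -
        ∑ k, y k * Aφ t (Pi.single i 1, 0) k) + (Θ t x - Θ t y) * Ag t (Pi.single i 1, 0) := by
      simp only [G, Pi.sub_apply]; ring
    rw [h1]
    refine (norm_add_le _ _).trans ?_
    have h2 := hpl t _ x y (hi' i)
    have h3 := mul_le_mul (hΘl t x y) (hAgv t _ (hi' i)) (abs_nonneg _) (by positivity)
    rw [Real.norm_eq_abs, Real.norm_eq_abs, abs_mul]
    linarith
  have hG0 : ∀ t, ‖G t 0‖ ≤ K + α⁻¹ * K * K := fun t => by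
    refine (pi_norm_le_iff_of_nonneg (by positivity)).2 fun i => ?_
    have h3 := mul_le_mul (hΘ0 t) (hAgv t _ (hi' i)) (abs_nonneg _) (by positivity)
    have h1 : G t 0 i = AL t (Pi.single i 1, 0) + Θ t 0 * Ag t (Pi.single i 1, 0) := by
      simp [G]
    rw [h1]
    refine (norm_add_le _ _).trans ?_
    rw [Real.norm_eq_abs, Real.norm_eq_abs, abs_mul]
    linarith [hALv t _ (hi' i)]
  obtain ⟨P, hPc, hPeq, hPb⟩ := exists_caratheodory_solution (fun s x => G (1 - s) x)
    (hGm.comp (g := Function.uncurry G) (f := fun q : ℝ × (Fin n → ℝ) => (1 - q.1, q.2))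
      ((measurable_const.sub measurable_fst).prodMk measurable_snd))
    (by positivity) (fun t => hGl (1 - t)) (fun t => hG0 (1 - t))
  have hP0 : P 0 = 0 := by simpa using hPeq 0 (by simp)
  let p : ℝ → Fin n → ℝ := fun t => P (1 - t)
  have hpB : BddMeas p := ⟨hPc.measurable.comp (measurable_const.sub measurable_id), _,
    fun t => hPb (1 - t)⟩
  let θ : ℝ → ℝ := fun t => Θ t (p t)
  have hθB : BddMeas θ := by
    obtain ⟨D, hD0, hD⟩ := hpB.exists_pos
    refine ⟨hΘm.comp (measurable_id.prodMk hpB.1), α⁻¹ * (n * K * D) + α⁻¹ * K, fun t => ?_⟩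
    have h1 := hΘl t (p t) 0
    have h2 := abs_sub_abs_le_abs_sub (Θ t (p t)) (Θ t 0)
    rw [sub_zero] at h1
    have h3 : α⁻¹ * (n * K * ‖p t‖) ≤ α⁻¹ * (n * K * D) := by gcongr; exact hD t
    rw [Real.norm_eq_abs]
    linarith [hΘ0 t]
  have hGB : BddMeas fun s => G s (p s) := BddMeas.pi fun i =>
    BddMeas.hamDeriv hALm hALb hAφm hAφb hAgm hAgb hpB hθB (BddMeas.const (Pi.single i 1, 0))
  have hpeq : ∀ t ∈ Set.Icc (0:ℝ) 1, p t = ∫ s in t..1, G s (p s) := fun t ht => by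
    have h1 := hPeq (1 - t) ⟨by linarith [ht.2], by linarith [ht.1]⟩
    have h2 := intervalIntegral.integral_comp_sub_left (a := 0) (b := 1 - t)
      (fun s => G s (p s)) 1
    simp only [p, sub_sub_cancel, sub_zero] at h2
    simp only [p]
    rw [h1, h2]
  refine ⟨p, θ, hpB, hθB, by simpa [p] using hP0, fun t ht => ?_, fun t => ?_⟩
  · change p t = p 0 + ∫ s in (0:ℝ)..t, -G s (p s)
    rw [hpeq t ht, hpeq 0 (by simp), intervalIntegral.integral_neg, ← sub_eq_add_neg,
      intervalIntegral.integral_interval_sub_left (hGB.intervalIntegrable _ _)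
        (hGB.intervalIntegrable _ _)]
  · have := ha0 t
    change AL t (0, e) + (∑ k, p t k * Aφ t (0, e) k) +
      -((a t)⁻¹ * (AL t (0, e) + ∑ k, p t k * Aφ t (0, e) k)) * a t = 0
    field_simp
    ring

/-- Duality between the linearized state equation and the adjoint equation. -/
lemma integral_adjoint_identity {K : ℝ}
    (hALm : ∀ v, Measurable fun t => AL t v) (hALb : ∀ t, ‖AL t‖ ≤ K)
    (hAφm : ∀ v, Measurable fun t => Aφ t v) (hAφb : ∀ t, ‖Aφ t‖ ≤ K)
    (hAgm : ∀ v, Measurable fun t => Ag t v) (hAgb : ∀ t, ‖Ag t‖ ≤ K)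
    {p : ℝ → Fin n → ℝ} {θ : ℝ → ℝ} (hp : BddMeas p) (hθ : BddMeas θ) (hp1 : p 1 = 0)
    (hpeq : ∀ t ∈ Set.Icc (0:ℝ) 1, p t = p 0 + ∫ s in (0:ℝ)..t,
        (fun i => -hamDeriv AL Ag Aφ p θ s (Pi.single i 1, 0)))
    {y : ℝ → (Fin n → ℝ) × (Fin l → ℝ)} {b : ℝ → Fin n → ℝ} (hy : BddMeas y) (hb : BddMeas b)
    (hyeq : ∀ t ∈ Set.Icc (0:ℝ) 1, (y t).1 = ∫ s in (0:ℝ)..t, (Aφ s (y s) + b s)) :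
    ∫ t in (0:ℝ)..1, AL t (y t) = ∫ t in (0:ℝ)..1, (hamDeriv AL Ag Aφ p θ t (0, (y t).2) -
      θ t * Ag t (y t) + ∑ k, p t k * b t k) := by
  let q : ℝ → Fin n → ℝ := fun s i => -hamDeriv AL Ag Aφ p θ s (Pi.single i 1, 0)
  let r : ℝ → Fin n → ℝ := fun s => Aφ s (y s) + b s
  have hy1 : BddMeas fun t => (y t).1 := by
    obtain ⟨C, hC⟩ := hy.2
    exact ⟨hy.1.fst, C, fun t => (norm_fst_le _).trans (hC t)⟩
  have hy2 : BddMeas fun t => (y t).2 := by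
    obtain ⟨C, hC⟩ := hy.2
    exact ⟨hy.1.snd, C, fun t => (norm_snd_le _).trans (hC t)⟩
  have hqk : ∀ i, BddMeas fun t => q t i := fun i =>
    (BddMeas.hamDeriv hALm hALb hAφm hAφb hAgm hAgb hp hθ (BddMeas.const (Pi.single i 1, 0))).neg
  have hq : BddMeas q := BddMeas.pi hqk
  have hr : BddMeas r := (BddMeas.clm_apply hAφm hAφb hy).add hb
  have hcomp : ∀ (h : ℝ → Fin n → ℝ), BddMeas h → ∀ (t : ℝ) (k : Fin n),
      (∫ s in (0:ℝ)..t, h s) k = ∫ s in (0:ℝ)..t, h s k := fun h hh t k =>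
    ((ContinuousLinearMap.proj (R := ℝ) (φ := fun _ : Fin n => ℝ) k).intervalIntegral_comp_comm
      (hh.intervalIntegrable 0 t)).symm
  have hk : ∀ k, ∫ t in (0:ℝ)..1, (q t k * (y t).1 k + p t k * r t k) = 0 := fun k => by
    rw [integral_mul_add_mul_of_primitive (p := fun t => p t k) (y := fun t => (y t).1 k)
      (hq.eval k) (hr.eval k)]
    · simp [hp1]
    · intro t ht
      rw [hpeq t ht, Pi.add_apply]
      exact congrArg _ (hcomp q hq t k)
    · intro t ht
      rw [hyeq t ht]
      exact hcomp r hr t k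
  have hkB : ∀ k, BddMeas fun t => q t k * (y t).1 k + p t k * r t k := fun k =>
    ((hq.eval k).mul (hy1.eval k)).add ((hp.eval k).mul (hr.eval k))
  have hsum : ∫ t in (0:ℝ)..1, ∑ k, (q t k * (y t).1 k + p t k * r t k) = 0 := by
    rw [intervalIntegral.integral_finsetSum fun k _ => (hkB k).intervalIntegrable _ _]
    exact Finset.sum_eq_zero fun k _ => hk k
  have h0y2 : BddMeas fun t => ((0, (y t).2) : (Fin n → ℝ) × (Fin l → ℝ)) :=
    (BddMeas.const 0).prodMk hy2
  have hR : BddMeas fun t => hamDeriv AL Ag Aφ p θ t (0, (y t).2) - θ t * Ag t (y t) +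
      ∑ k, p t k * b t k :=
    ((BddMeas.hamDeriv hALm hALb hAφm hAφb hAgm hAgb hp hθ h0y2).sub
      (hθ.mul (BddMeas.clm_apply hAgm hAgb hy))).add
      (BddMeas.sum _ fun k _ => (hp.eval k).mul (hb.eval k))
  have hpt : ∀ t, AL t (y t) = (hamDeriv AL Ag Aφ p θ t (0, (y t).2) - θ t * Ag t (y t) +
      ∑ k, p t k * b t k) - ∑ k, (q t k * (y t).1 k + p t k * r t k) := by
    intro t
    have h1 : y t = ((y t).1, 0) + (0, (y t).2) := by simp
    have h2 : hamDeriv AL Ag Aφ p θ t (y t) =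
        -(∑ k, q t k * (y t).1 k) + hamDeriv AL Ag Aφ p θ t (0, (y t).2) := by
      conv_lhs => rw [h1, hamDeriv_add, hamDeriv_state]
      rw [← Finset.sum_neg_distrib]
      congr 1
      exact Finset.sum_congr rfl fun k _ => by simp only [q]; ring
    have h3 : hamDeriv AL Ag Aφ p θ t (y t) =
        AL t (y t) + (∑ k, p t k * Aφ t (y t) k) + θ t * Ag t (y t) := rfl
    have h4 : ∑ k, (q t k * (y t).1 k + p t k * r t k) = ∑ k, q t k * (y t).1 k +
        (∑ k, p t k * Aφ t (y t) k + ∑ k, p t k * b t k) := by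
      rw [← Finset.sum_add_distrib, ← Finset.sum_add_distrib]
      exact Finset.sum_congr rfl fun k _ => by simp only [r, Pi.add_apply]; ring
    rw [h4]
    linarith
  simp_rw [hpt]
  rw [intervalIntegral.integral_sub (hR.intervalIntegrable _ _)
    ((BddMeas.sum _ fun k _ => hkB k).intervalIntegrable _ _), hsum, sub_zero]

end Adjoint

/-- A multiobjective control problem translated to the origin: objective integrands `L`, dynamics
`φ` and constraint `g0 + g ≤ 0`, all with second-order Taylor expansions at the origin. -/
structure LocalProblem (n l m : ℕ) where
  K : ℝ
  α : ℝ
  e : Fin l → ℝ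
  L : Fin m → ℝ → (Fin n → ℝ) × (Fin l → ℝ) → ℝ
  AL : Fin m → ℝ → (Fin n → ℝ) × (Fin l → ℝ) →L[ℝ] ℝ
  BL : Fin m → ℝ → (Fin n → ℝ) × (Fin l → ℝ) →L[ℝ] (Fin n → ℝ) × (Fin l → ℝ) →L[ℝ] ℝ
  φ : ℝ → (Fin n → ℝ) × (Fin l → ℝ) → (Fin n → ℝ)
  Aφ : ℝ → (Fin n → ℝ) × (Fin l → ℝ) →L[ℝ] (Fin n → ℝ)
  Bφ : ℝ → (Fin n → ℝ) × (Fin l → ℝ) →L[ℝ] (Fin n → ℝ) × (Fin l → ℝ) →L[ℝ] (Fin n → ℝ)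
  g : ℝ → (Fin n → ℝ) × (Fin l → ℝ) → ℝ
  Ag : ℝ → (Fin n → ℝ) × (Fin l → ℝ) →L[ℝ] ℝ
  Bg : ℝ → (Fin n → ℝ) × (Fin l → ℝ) →L[ℝ] (Fin n → ℝ) × (Fin l → ℝ) →L[ℝ] ℝ
  g0 : ℝ → ℝ
  taylorL : ∀ j, Taylor2 K (L j) (AL j) (BL j)
  taylorφ : Taylor2 K φ Aφ Bφ
  taylorg : Taylor2 K g Ag Bg
  norm_e : ‖e‖ ≤ 1
  α_pos : 0 < α
  regular : ∀ t, α ≤ |Ag t (0, e)|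
  bddMeas_g0 : BddMeas g0
  g0_nonpos : ∀ᵐ t ∂mu01, g0 t ≤ 0

namespace LocalProblem

variable {n l m : ℕ} (P : LocalProblem n l m)

/-- The origin is a local weak Pareto solution. -/
def IsPareto (ε : ℝ) : Prop :=
  ∀ h : ℝ → (Fin n → ℝ) × (Fin l → ℝ), BddMeas h → (∀ t, ‖h t‖ ≤ 1) → (∀ t, ‖h t‖ ≤ ε) →
    ContinuousOn (fun t => (h t).1) (Set.Icc 0 1) →
    (∀ t ∈ Set.Icc (0:ℝ) 1, (h t).1 = ∫ s in (0:ℝ)..t, P.φ s (h s)) →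
    (∀ᵐ t ∂mu01, P.g0 t + P.g t (h t) ≤ 0) →
    ¬ ∀ j, ∫ t in (0:ℝ)..1, P.L j t (h t) < 0

/-- The interior critical directions. -/
structure IsCritical (z : ℝ → (Fin n → ℝ) × (Fin l → ℝ)) : Prop where
  bddMeas : BddMeas z
  eq : ∀ t ∈ Set.Icc (0:ℝ) 1, (z t).1 = ∫ s in (0:ℝ)..t, P.Aφ s (z s)
  descent : ∀ j, ∫ t in (0:ℝ)..1, P.AL j t (z t) ≤ 0
  tangent : ∃ c : ℝ, 0 ≤ c ∧ ∀ᵐ t ∂mu01, P.Ag t (z t) ≤ -(c * P.g0 t)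

variable {P}

lemma not_forall_second_order_descent {ε : ℝ} (hε : 0 < ε) (hP : P.IsPareto ε)
    {z y : ℝ → (Fin n → ℝ) × (Fin l → ℝ)} (hz : P.IsCritical z) (hy : BddMeas y)
    (hyeq : ∀ t ∈ Set.Icc (0:ℝ) 1,
      (y t).1 = ∫ s in (0:ℝ)..t, (P.Aφ s (y s) + (1 / 2 : ℝ) • P.Bφ s (z s) (z s)))
    {c₂ : ℝ} (hc₂ : 0 ≤ c₂)
    (hyg : ∀ᵐ t ∂mu01, P.Ag t (y t) + (1 / 2 : ℝ) * P.Bg t (z t) (z t) ≤ -(c₂ * P.g0 t)) :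
    ¬ ∀ j, ∫ t in (0:ℝ)..1, (P.AL j t (y t) + (1 / 2 : ℝ) * P.BL j t (z t) (z t)) < 0 := by
  intro hF
  set F : Fin m → ℝ := fun j =>
    ∫ t in (0:ℝ)..1, (P.AL j t (y t) + (1 / 2 : ℝ) * P.BL j t (z t) (z t)) with hFdef
  have hK := P.taylorφ.nonneg
  obtain ⟨c, hc, hzg⟩ := hz.tangent
  obtain ⟨M, hM, hzM, hyM⟩ : ∃ M, 1 ≤ M ∧ (∀ t, ‖z t‖ ≤ M) ∧ ∀ t, ‖y t‖ ≤ M := by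
    obtain ⟨M₁, h1⟩ := hz.bddMeas.2
    obtain ⟨M₂, h2⟩ := hy.2
    exact ⟨max 1 (max M₁ M₂), le_max_left _ _, fun t => (h1 t).trans (by simp),
      fun t => (h2 t).trans (by simp)⟩
  obtain ⟨C, hC, s₀, hs₀, hpath⟩ := exists_corrected_path P.taylorφ P.taylorg P.e P.norm_e
    P.α_pos P.regular hz.bddMeas hy hz.eq hyeq
  set D : ℝ := 2 * P.K * C + 10 * P.K * M ^ 3 with hD
  have htend : ∀ a b : ℝ, Tendsto (fun s : ℝ => a + b * s) (𝓝[>] 0) (𝓝 a) := fun a b => by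
    have : Tendsto (fun s : ℝ => a + b * s) (𝓝 0) (𝓝 (a + b * 0)) :=
      (Continuous.tendsto (by fun_prop) 0)
    rw [mul_zero, add_zero] at this
    exact this.mono_left nhdsWithin_le_nhds
  have hlin : ∀ a b : ℝ, 0 < b → ∀ᶠ s in 𝓝[>] (0:ℝ), a * s ≤ b := fun a b hb => by
    filter_upwards [(htend 0 a).eventually_lt_const hb] with s hs
    linarith
  have hev : ∀ᶠ s in 𝓝[>] (0:ℝ), 0 < s ∧ s < s₀ ∧ (∀ j, F j + D * s < 0) ∧ 2 * M * s ≤ 1 ∧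
      (c + c₂) * s ≤ 1 ∧ (2 * M + C) * s ≤ ε := by
    have h1 : ∀ᶠ s in 𝓝[>] (0:ℝ), 0 < s := eventually_mem_nhdsWithin
    have h2 : ∀ᶠ s in 𝓝[>] (0:ℝ), s < s₀ := mem_nhdsWithin_of_mem_nhds (Iio_mem_nhds hs₀)
    refine h1.and (h2.and ?_)
    refine (eventually_all.2 fun j => (htend (F j) D).eventually_lt_const (hF j)).and ?_
    exact (hlin _ _ one_pos).and ((hlin _ _ one_pos).and (hlin _ _ hε))
  obtain ⟨s, hs, hss₀, hFs, hMs, hcs, hεs⟩ := hev.exists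
  obtain ⟨h, hhB, hh1, hhc, hheq, hhs, hhg⟩ := hpath s hs hss₀
  have hs1 : s ≤ 1 := by nlinarith
  have hzy : ∀ t, ‖s • z t + s ^ 2 • y t‖ ≤ s * M + s ^ 2 * M := fun t => by
    refine (norm_add_le _ _).trans ?_
    rw [norm_smul, norm_smul, Real.norm_eq_abs, Real.norm_eq_abs, abs_of_pos hs,
      abs_of_pos (pow_pos hs 2)]
    gcongr
    exacts [hzM t, hyM t]
  have hs2 : s ^ 2 ≤ s := by nlinarith
  have hs3 : s ^ 3 ≤ s := by nlinarith
  refine hP h hhB hh1 (fun t => ?_) hhc hheq ?_ fun j => ?_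
  · have h1 := norm_le_norm_add_norm_sub' (h t) (s • z t + s ^ 2 • y t)
    have h2 : C * s ^ 3 ≤ C * s := by gcongr
    have h3 : s ^ 2 * M ≤ s * M := by gcongr
    linarith [hzy t, hhs t]
  · filter_upwards [hzg, hyg, P.g0_nonpos] with t h1 h2 h3
    rw [hhg t, smul_eq_mul, smul_eq_mul, smul_eq_mul]
    have h4 : s * P.Ag t (z t) ≤ s * -(c * P.g0 t) := by gcongr
    have h5 : s ^ 2 * (P.Ag t (y t) + 1 / 2 * P.Bg t (z t) (z t)) ≤ s ^ 2 * -(c₂ * P.g0 t) := by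
      gcongr
    have h6 : s * c + s ^ 2 * c₂ ≤ 1 := by nlinarith
    nlinarith
  · have hT := P.taylorL j
    have hpt : ∀ t, P.L j t (h t) ≤ s * P.AL j t (z t) +
        s ^ 2 * (P.AL j t (y t) + (1 / 2 : ℝ) * P.BL j t (z t) (z t)) + D * s ^ 3 := fun t => by
      have hn : ‖s • z t + s ^ 2 • y t‖ ≤ 1 := (hzy t).trans (by nlinarith)
      have h1 := (hT.lip t (hh1 t) hn).trans
        (mul_le_mul_of_nonneg_left (hhs t) (by positivity))
      have h2 := hT.second_order t hM (hzM t) (hyM t) hs.le hMs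
      rw [Real.norm_eq_abs] at h1 h2
      rw [smul_eq_mul, smul_eq_mul, smul_eq_mul] at h2
      have h3 := le_of_abs_le h1
      have h4 := le_of_abs_le h2
      rw [hD]
      linarith
    have hb1 := BddMeas.clm_apply hT.measA hT.normA hz.bddMeas
    have hb2 := BddMeas.clm_apply hT.measA hT.normA hy
    have hb3 := BddMeas.clm_apply₂ hT.measB hT.normB hz.bddMeas hz.bddMeas
    have hb4 := hb2.add ((BddMeas.const (1 / 2 : ℝ)).mul hb3)
    have hb5 := (BddMeas.const s).mul hb1
    have hb6 := (BddMeas.const (s ^ 2)).mul hb4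
    have hbh : BddMeas fun t => P.L j t (h t) :=
      ⟨hT.meas.comp (measurable_id.prodMk hhB.1), 2 * P.K, fun t => by
        have := hT.lip t (hh1 t) (h' := 0) (by simp)
        rw [hT.zero, sub_zero, sub_zero] at this
        exact this.trans (by nlinarith [hh1 t, norm_nonneg (h t)])⟩
    have hle : ∫ t in (0:ℝ)..1, P.L j t (h t) ≤ ∫ t in (0:ℝ)..1, (s * P.AL j t (z t) +
        s ^ 2 * (P.AL j t (y t) + (1 / 2 : ℝ) * P.BL j t (z t) (z t)) + D * s ^ 3) :=
      intervalIntegral.integral_mono zero_le_one (hbh.intervalIntegrable _ _)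
        (((hb5.add hb6).add (BddMeas.const (D * s ^ 3))).intervalIntegrable _ _) hpt
    rw [intervalIntegral.integral_add ((hb5.add hb6).intervalIntegrable _ _) (by simp),
      intervalIntegral.integral_add (hb5.intervalIntegrable _ _) (hb6.intervalIntegrable _ _),
      intervalIntegral.integral_const_mul, intervalIntegral.integral_const_mul,
      intervalIntegral.integral_const] at hle
    have h1 := hz.descent j
    have h2 := hFs j
    have h3 : s * ∫ t in (0:ℝ)..1, P.AL j t (z t) ≤ 0 := mul_nonpos_of_nonneg_of_nonpos hs.le h1
    have h4 : s ^ 2 * (F j + D * s) < 0 := mul_neg_of_pos_of_neg (by positivity) h2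
    simp only [sub_zero, one_smul] at hle
    have h5 : s ^ 2 * (F j + D * s) = s ^ 2 * F j + D * s ^ 3 := by ring
    rw [h5] at h4
    linarith

/-- The multipliers of the `j`-th objective: adjoint state and constraint multiplier chosen so that
the Hamiltonian is stationary in the direction `e`. -/
structure AdjointFamily (P : LocalProblem n l m) where
  p : Fin m → ℝ → Fin n → ℝ
  θ : Fin m → ℝ → ℝ
  bddMeas_p : ∀ j, BddMeas (p j)
  bddMeas_θ : ∀ j, BddMeas (θ j)
  p_one : ∀ j, p j 1 = 0
  eq : ∀ j, ∀ t ∈ Set.Icc (0:ℝ) 1, p j t = p j 0 + ∫ s in (0:ℝ)..t,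
    (fun i => -hamDeriv (P.AL j) P.Ag P.Aφ (p j) (θ j) s (Pi.single i 1, 0))
  stationary : ∀ j t, hamDeriv (P.AL j) P.Ag P.Aφ (p j) (θ j) t (0, P.e) = 0

variable (P) in
lemma nonempty_adjointFamily : Nonempty P.AdjointFamily := by
  have h1 := fun j => exists_adjoint P.taylorφ.nonneg (P.taylorL j).measA (P.taylorL j).normA
    P.taylorφ.measA P.taylorφ.normA P.taylorg.measA P.taylorg.normA P.e P.norm_e P.α_pos P.regular
  choose p θ h using h1
  exact ⟨⟨p, θ, fun j => (h j).1, fun j => (h j).2.1, fun j => (h j).2.2.1,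
    fun j => (h j).2.2.2.1, fun j => (h j).2.2.2.2⟩⟩

namespace AdjointFamily

variable (W : P.AdjointFamily)

/-- Derivative of the `j`-th Hamiltonian in the control direction `v`. -/
noncomputable def ham (j : Fin m) (t : ℝ) (v : (Fin n → ℝ) × (Fin l → ℝ)) : ℝ :=
  hamDeriv (P.AL j) P.Ag P.Aφ (W.p j) (W.θ j) t v

/-- Second derivative of the `j`-th Hamiltonian along `v`. -/
noncomputable def hess (j : Fin m) (t : ℝ) (v : (Fin n → ℝ) × (Fin l → ℝ)) : ℝ :=
  P.BL j t v v + (∑ k, W.p j t k * P.Bφ t v v k) + W.θ j t * P.Bg t v v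

lemma bddMeas_ham (j : Fin m) {v : ℝ → (Fin n → ℝ) × (Fin l → ℝ)} (hv : BddMeas v) :
    BddMeas fun t => W.ham j t (v t) :=
  BddMeas.hamDeriv (P.taylorL j).measA (P.taylorL j).normA P.taylorφ.measA P.taylorφ.normA
    P.taylorg.measA P.taylorg.normA (W.bddMeas_p j) (W.bddMeas_θ j) hv

lemma bddMeas_hess (j : Fin m) {v : ℝ → (Fin n → ℝ) × (Fin l → ℝ)} (hv : BddMeas v) :
    BddMeas fun t => W.hess j t (v t) :=
  ((BddMeas.clm_apply₂ (P.taylorL j).measB (P.taylorL j).normB hv hv).add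
    (BddMeas.sum _ fun k _ => ((W.bddMeas_p j).eval k).mul
      ((BddMeas.clm_apply₂ P.taylorφ.measB P.taylorφ.normB hv hv).eval k))).add
    ((W.bddMeas_θ j).mul (BddMeas.clm_apply₂ P.taylorg.measB P.taylorg.normB hv hv))

lemma ham_control (j : Fin m) (t : ℝ) (v : Fin l → ℝ) :
    W.ham j t (0, v) = ∑ i, v i * W.ham j t (0, Pi.single i 1) := by
  have h1 : ((0, v) : (Fin n → ℝ) × (Fin l → ℝ)) =
      ∑ i, v i • ((0, Pi.single i 1) : (Fin n → ℝ) × (Fin l → ℝ)) := by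
    ext j
    · simp [Prod.fst_sum]
    · simp [Prod.snd_sum, Finset.sum_apply, Pi.single_apply]
  let T : (Fin n → ℝ) × (Fin l → ℝ) →ₗ[ℝ] ℝ :=
    { toFun := W.ham j t
      map_add' := hamDeriv_add _ _ t
      map_smul' := hamDeriv_smul _ _ t }
  change T _ = ∑ i, v i * T _
  rw [h1, map_sum]
  exact Finset.sum_congr rfl fun i _ => by rw [map_smul, smul_eq_mul]

end AdjointFamily

lemma exists_second_order_direction {z : ℝ → (Fin n → ℝ) × (Fin l → ℝ)} (hz : BddMeas z)
    {v : ℝ → Fin l → ℝ} {w : ℝ → ℝ} (hv : BddMeas v) (hw : BddMeas w) :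
    ∃ (x : ℝ → Fin n → ℝ) (κ : ℝ → ℝ), BddMeas x ∧ BddMeas κ ∧
      (∀ t ∈ Set.Icc (0:ℝ) 1, x t = ∫ s in (0:ℝ)..t,
        (P.Aφ s (x s, v s + κ s • P.e) + (1 / 2 : ℝ) • P.Bφ s (z s) (z s))) ∧
      ∀ t, P.Ag t (x t, v t + κ t • P.e) + (1 / 2 : ℝ) * P.Bg t (z t) (z t) = w t := by
  have hK := P.taylorφ.nonneg
  have hα := P.α_pos
  let a : ℝ → ℝ := fun t => P.Ag t (0, P.e)
  have ha0 : ∀ t, a t ≠ 0 := fun t => abs_pos.1 (P.α_pos.trans_le (P.regular t))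
  have haB : BddMeas fun t => (a t)⁻¹ := ⟨(P.taylorg.measA _).inv, P.α⁻¹, fun t => by
    rw [Real.norm_eq_abs, abs_inv]; exact inv_anti₀ P.α_pos (P.regular t)⟩
  have hainv : ∀ t, |(a t)⁻¹| ≤ P.α⁻¹ := fun t => by
    rw [abs_inv]; exact inv_anti₀ P.α_pos (P.regular t)
  have hBφ := BddMeas.clm_apply₂ P.taylorφ.measB P.taylorφ.normB hz hz
  have hBg := BddMeas.clm_apply₂ P.taylorg.measB P.taylorg.normB hz hz
  let κ₀ : ℝ → (Fin n → ℝ) → ℝ := fun t x =>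
    (a t)⁻¹ * (w t - (1 / 2 : ℝ) * P.Bg t (z t) (z t) - P.Ag t (x, v t))
  let f : ℝ → (Fin n → ℝ) → (Fin n → ℝ) := fun t x =>
    P.Aφ t (x, v t + κ₀ t x • P.e) + (1 / 2 : ℝ) • P.Bφ t (z t) (z t)
  have hκB : ∀ x, BddMeas x → BddMeas fun t => κ₀ t (x t) := fun x hx =>
    haB.mul ((hw.sub ((BddMeas.const (1 / 2 : ℝ)).mul hBg)).sub
      (BddMeas.clm_apply P.taylorg.measA P.taylorg.normA (hx.prodMk hv)))
  have hfB : ∀ x, BddMeas x → BddMeas fun t => f t (x t) := fun x hx =>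
    (BddMeas.clm_apply P.taylorφ.measA P.taylorφ.normA
      (hx.prodMk (hv.add ((hκB x hx).smul (BddMeas.const P.e))))).add
      ((BddMeas.const (1 / 2 : ℝ)).smul hBφ)
  have hκl : ∀ t x y, |κ₀ t x - κ₀ t y| ≤ P.α⁻¹ * (P.K * ‖x - y‖) := fun t x y => by
    have h1 : κ₀ t x - κ₀ t y = -((a t)⁻¹ * P.Ag t (x - y, 0)) := by
      have : ((x - y, 0) : (Fin n → ℝ) × (Fin l → ℝ)) = (x, v t) - (y, v t) := by simp
      rw [this, map_sub]
      simp only [κ₀]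
      ring
    rw [h1, abs_neg, abs_mul]
    refine mul_le_mul (hainv t) ?_ (abs_nonneg _) (by positivity)
    refine (P.Ag t).le_of_opNorm_le_of_le (P.taylorg.normA t) ?_
    simp
  have hfl : ∀ t x y, ‖f t x - f t y‖ ≤ (P.K * (1 + P.α⁻¹ * P.K)) * ‖x - y‖ := fun t x y => by
    have h1 : f t x - f t y = P.Aφ t (x - y, (κ₀ t x - κ₀ t y) • P.e) := by
      have : ((x - y, (κ₀ t x - κ₀ t y) • P.e) : (Fin n → ℝ) × (Fin l → ℝ)) =
          (x, v t + κ₀ t x • P.e) - (y, v t + κ₀ t y • P.e) := by simp [sub_smul]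
      rw [this, map_sub]
      simp only [f]
      abel
    have h2 : ‖((x - y, (κ₀ t x - κ₀ t y) • P.e) : (Fin n → ℝ) × (Fin l → ℝ))‖ ≤
        (1 + P.α⁻¹ * P.K) * ‖x - y‖ := by
      have h3 : 0 ≤ P.α⁻¹ * P.K * ‖x - y‖ := by positivity
      refine max_le (by linarith) ?_
      rw [norm_smul]
      have h4 := mul_le_mul (hκl t x y) P.norm_e (norm_nonneg _) (by positivity)
      rw [Real.norm_eq_abs]
      linarith [norm_nonneg (x - y)]
    rw [h1, mul_assoc]
    exact (P.Aφ t).le_of_opNorm_le_of_le (P.taylorφ.normA t) h2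
  have hfm : Measurable (Function.uncurry f) := by
    have hcont : ∀ t, Continuous (f t) := fun t => by simp only [f, κ₀]; fun_prop
    have h1 : Measurable (Function.uncurry fun x t => f t x) :=
      measurable_uncurry_of_continuous_of_measurable hcont
        fun x => (hfB (fun _ => x) (BddMeas.const x)).1
    exact h1.comp measurable_swap
  obtain ⟨b, hb⟩ := (hfB (fun _ => 0) (BddMeas.const 0)).2
  obtain ⟨x, hxc, hxeq, hxb⟩ := exists_caratheodory_solution f hfm (by positivity) hfl hb
  have hxB : BddMeas x := ⟨hxc.measurable, _, hxb⟩
  refine ⟨x, fun t => κ₀ t (x t), hxB, hκB x hxB, hxeq, fun t => ?_⟩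
  have h1 : ((x t, v t + κ₀ t (x t) • P.e) : (Fin n → ℝ) × (Fin l → ℝ)) =
      (x t, v t) + κ₀ t (x t) • (0, P.e) := by simp
  have h2 : κ₀ t (x t) * a t =
      w t - (1 / 2 : ℝ) * P.Bg t (z t) (z t) - P.Ag t (x t, v t) := by
    simp only [κ₀]
    field_simp [ha0 t]
  rw [h1, map_add, map_smul, smul_eq_mul]
  change _ + κ₀ t (x t) * a t + _ = _
  rw [h2]
  ring

/-- The alternative produced by weak Pareto optimality, in terms of the multipliers. -/
lemma exists_nonneg_variation {ε : ℝ} (hε : 0 < ε) (hP : P.IsPareto ε) (W : P.AdjointFamily)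
    {z : ℝ → (Fin n → ℝ) × (Fin l → ℝ)} (hz : P.IsCritical z)
    {v : ℝ → Fin l → ℝ} {w : ℝ → ℝ} (hv : BddMeas v) (hw : BddMeas w) {c : ℝ} (hc : 0 ≤ c)
    (hwc : ∀ᵐ t ∂mu01, w t ≤ -(c * P.g0 t)) :
    ∃ j, 0 ≤ (∫ t in (0:ℝ)..1, (W.ham j t (0, v t) - W.θ j t * w t)) +
      1 / 2 * ∫ t in (0:ℝ)..1, W.hess j t (z t) := by
  obtain ⟨x, κ, hx, hκ, hxeq, hxw⟩ := exists_second_order_direction (P := P) hz.bddMeas hv hw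
  let y : ℝ → (Fin n → ℝ) × (Fin l → ℝ) := fun t => (x t, v t + κ t • P.e)
  have hy : BddMeas y := hx.prodMk (hv.add (hκ.smul (BddMeas.const P.e)))
  have hBφ := BddMeas.clm_apply₂ P.taylorφ.measB P.taylorφ.normB hz.bddMeas hz.bddMeas
  have hb : BddMeas fun t => (1 / 2 : ℝ) • P.Bφ t (z t) (z t) :=
    (BddMeas.const (1 / 2 : ℝ)).smul hBφ
  have h1 := not_forall_second_order_descent hε hP hz hy hxeq hc
    (hwc.mono fun t ht => (hxw t).trans_le ht)
  push Not at h1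
  obtain ⟨j, hj⟩ := h1
  refine ⟨j, hj.trans_eq ?_⟩
  have hT := P.taylorL j
  have hAL := BddMeas.clm_apply hT.measA hT.normA hy
  have hBL := BddMeas.clm_apply₂ hT.measB hT.normB hz.bddMeas hz.bddMeas
  have h0v : BddMeas fun t => ((0, v t) : (Fin n → ℝ) × (Fin l → ℝ)) :=
    (BddMeas.const 0).prodMk hv
  have hham := (W.bddMeas_ham j h0v).sub ((W.bddMeas_θ j).mul hw)
  have hhess := (BddMeas.const (1 / 2 : ℝ)).mul (W.bddMeas_hess j hz.bddMeas)
  have h0y2 : BddMeas fun t => ((0, (y t).2) : (Fin n → ℝ) × (Fin l → ℝ)) :=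
    (BddMeas.const 0).prodMk (hv.add (hκ.smul (BddMeas.const P.e)))
  have hrhs : BddMeas fun t => W.ham j t (0, (y t).2) - W.θ j t * P.Ag t (y t) +
      ∑ k, W.p j t k * ((1 / 2 : ℝ) • P.Bφ t (z t) (z t)) k :=
    ((W.bddMeas_ham j h0y2).sub ((W.bddMeas_θ j).mul
      (BddMeas.clm_apply P.taylorg.measA P.taylorg.normA hy))).add
      (BddMeas.sum _ fun k _ => ((W.bddMeas_p j).eval k).mul (hb.eval k))
  have hid := integral_adjoint_identity hT.measA hT.normA P.taylorφ.measA P.taylorφ.normA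
    P.taylorg.measA P.taylorg.normA (W.bddMeas_p j) (W.bddMeas_θ j) (W.p_one j) (W.eq j) hy hb hxeq
  rw [intervalIntegral.integral_add (hAL.intervalIntegrable _ _)
    (((BddMeas.const (1 / 2 : ℝ)).mul hBL).intervalIntegrable _ _), hid,
    ← intervalIntegral.integral_const_mul,
    ← intervalIntegral.integral_add (hham.intervalIntegrable _ _) (hhess.intervalIntegrable _ _)]
  refine (intervalIntegral.integral_add (hrhs.intervalIntegrable _ _)
    (((BddMeas.const (1 / 2 : ℝ)).mul hBL).intervalIntegrable _ _)).symm.trans ?_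
  refine intervalIntegral.integral_congr fun t _ => ?_
  have h2 : ((0, (y t).2) : (Fin n → ℝ) × (Fin l → ℝ)) = (0, v t) + κ t • (0, P.e) := by simp [y]
  have h3 : W.ham j t (0, (y t).2) = W.ham j t (0, v t) := by
    have := W.stationary j t
    rw [h2]
    simp only [AdjointFamily.ham, hamDeriv_add, hamDeriv_smul, this, mul_zero, add_zero]
  have h4 : P.Ag t (y t) = w t - (1 / 2 : ℝ) * P.Bg t (z t) (z t) := by
    have := hxw t
    change P.Ag t (y t) + _ = _ at this
    linarith
  have h5 : ∑ k, W.p j t k * ((1 / 2 : ℝ) • P.Bφ t (z t) (z t)) k =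
      1 / 2 * ∑ k, W.p j t k * P.Bφ t (z t) (z t) k := by
    rw [Finset.mul_sum]
    exact Finset.sum_congr rfl fun k _ => by simp only [Pi.smul_apply, smul_eq_mul]; ring
  simp only [h3, h4, h5, AdjointFamily.hess]
  ring

end LocalProblem

/-- A separation alternative in `ℝ^m`: if no sum of a point of a convex cone and a fixed vector has
all coordinates negative, then some normalized nonnegative functional is nonnegative on both. -/
lemma exists_nonneg_multiplier {m : ℕ} (D : Set (Fin m → ℝ)) (h0 : 0 ∈ D)
    (hadd : ∀ a ∈ D, ∀ b ∈ D, a + b ∈ D) (hsmul : ∀ c : ℝ, 0 ≤ c → ∀ a ∈ D, c • a ∈ D)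
    (h : Fin m → ℝ) (hD : ∀ d ∈ D, ∃ j, 0 ≤ d j + h j) :
    ∃ lam : Fin m → ℝ, (∀ j, 0 ≤ lam j) ∧ ∑ j, lam j ^ 2 = 1 ∧
      (∀ d ∈ D, 0 ≤ ∑ j, lam j * d j) ∧ 0 ≤ ∑ j, lam j * h j := by
  let N : Set (Fin m → ℝ) := Set.univ.pi fun _ => Set.Iio 0
  have hNc : Convex ℝ N := convex_pi fun _ _ => convex_Iio 0
  have hNo : IsOpen N := isOpen_set_pi Set.finite_univ fun _ _ => isOpen_Iio
  let T : Set (Fin m → ℝ) := (fun d => d + h) '' D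
  have hTc : Convex ℝ T := by
    have hDc : Convex ℝ D := fun a ha b hb s t hs ht _ =>
      hadd _ (hsmul s hs a ha) _ (hsmul t ht b hb)
    simpa [T, add_comm] using hDc.translate h
  have hdisj : Disjoint N T := by
    rw [Set.disjoint_left]
    rintro _ hx ⟨d, hd, rfl⟩
    obtain ⟨j, hj⟩ := hD d hd
    exact absurd (hx j trivial) (not_lt.2 hj)
  obtain ⟨F, u, hFN, hFT⟩ := geometric_hahn_banach_open hNc hNo hTc hdisj
  let μ : Fin m → ℝ := fun j => F (Pi.single j 1)
  have hF : ∀ x, F x = ∑ j, μ j * x j := fun x => by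
    have h1 : x = ∑ j, x j • (Pi.single j 1 : Fin m → ℝ) := by
      ext i; simp [Finset.sum_apply, Pi.single_apply]
    conv_lhs => rw [h1, map_sum]
    exact Finset.sum_congr rfl fun j _ => by rw [map_smul, smul_eq_mul, mul_comm]
  have hcl : ∀ x : Fin m → ℝ, (∀ j, x j ≤ 0) → F x ≤ u := fun x hx => by
    have h1 : Tendsto (fun s : ℝ => F (x - s • 1)) (𝓝[>] 0) (𝓝 (F x)) := by
      have : Tendsto (fun s : ℝ => F (x - s • 1)) (𝓝 0) (𝓝 (F (x - (0:ℝ) • 1))) :=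
        Continuous.tendsto (by fun_prop) 0
      rw [zero_smul, sub_zero] at this
      exact this.mono_left nhdsWithin_le_nhds
    refine le_of_tendsto h1 ?_
    filter_upwards [self_mem_nhdsWithin] with s hs
    refine (hFN _ fun j _ => ?_).le
    have := hx j
    have hs' : 0 < s := hs
    simp only [Pi.sub_apply, Pi.smul_apply, Pi.one_apply, smul_eq_mul, mul_one, Set.mem_Iio]
    linarith
  have hu0 : 0 ≤ u := by simpa using hcl 0 (by simp)
  have hcone : ∀ a b : ℝ, (∀ c : ℝ, 0 ≤ c → a * c + b ≥ 0) → 0 ≤ a := fun a b hab => by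
    by_contra! ha
    have := hab ((|b| + 1) / -a) (div_nonneg (by positivity) (by linarith))
    have h1 : a * ((|b| + 1) / -a) = -(|b| + 1) := by
      rw [div_neg, mul_neg, mul_div_cancel₀ _ ha.ne]
    rw [h1] at this
    linarith [le_abs_self b]
  have hμ0 : ∀ j, 0 ≤ μ j := fun j => hcone (μ j) u fun c hc => by
    have := hcl ((-c) • Pi.single j 1) fun i => by
      rcases eq_or_ne i j with rfl | hij
      · simpa using hc
      · simp [hij]
    rw [map_smul, smul_eq_mul] at this
    change -c * μ j ≤ u at this
    linarith
  have hμD : ∀ d ∈ D, 0 ≤ ∑ j, μ j * d j := fun d hd => by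
    rw [← hF]
    refine hcone (F d) (F h) fun c hc => ?_
    have := hFT _ ⟨c • d, hsmul c hc d hd, rfl⟩
    simp only [map_add, map_smul, smul_eq_mul] at this
    linarith
  have hμh : 0 ≤ ∑ j, μ j * h j := by
    rw [← hF]
    have := hFT _ ⟨0, h0, rfl⟩
    simp only [zero_add] at this
    linarith
  have hμne : 0 < ∑ j, μ j ^ 2 := by
    refine (Finset.sum_nonneg fun j _ => sq_nonneg (μ j)).lt_of_ne fun heq => ?_
    have h1 : ∀ j, μ j = 0 := fun j => by
      have := (Finset.sum_eq_zero_iff_of_nonneg fun j _ => sq_nonneg (μ j)).1 heq.symm j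
        (Finset.mem_univ j)
      exact pow_eq_zero_iff (two_ne_zero) |>.1 this
    have h2 : ∀ x, F x = 0 := fun x => by simp [hF, h1]
    have h3 := hFN (fun _ => -1) fun j _ => by simp
    have h4 := hFT _ ⟨0, h0, rfl⟩
    rw [h2] at h3 h4
    linarith
  set r := √(∑ j, μ j ^ 2) with hr
  have hr0 : 0 < r := Real.sqrt_pos.2 hμne
  have hscale : ∀ d : Fin m → ℝ, ∑ j, μ j / r * d j = (∑ j, μ j * d j) / r := fun d => by
    rw [Finset.sum_div]
    exact Finset.sum_congr rfl fun j _ => by ring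
  refine ⟨fun j => μ j / r, fun j => div_nonneg (hμ0 j) hr0.le, ?_, fun d hd => ?_, ?_⟩
  · simp only [div_pow, ← Finset.sum_div]
    rw [hr, Real.sq_sqrt hμne.le, div_self hμne.ne']
  · rw [hscale]; exact div_nonneg (hμD d hd) hr0.le
  · rw [hscale]; exact div_nonneg hμh hr0.le

namespace LocalProblem

variable {n l m : ℕ} {P : LocalProblem n l m}

/-- First-order (Lagrange multiplier) conditions satisfied by `lam` with adjoint family `W`. -/
structure IsMultiplier (W : P.AdjointFamily) (lam : Fin m → ℝ) : Prop where
  nonneg : ∀ j, 0 ≤ lam j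
  norm_one : ∑ j, lam j ^ 2 = 1
  stationary : ∀ᵐ t ∂mu01, ∀ i, ∑ j, lam j * W.ham j t (0, Pi.single i 1) = 0
  normal : ∀ v : ℝ → ℝ, BddMeas v → (∀ᵐ t ∂mu01, v t ≤ 0) →
    ∑ j, lam j * ∫ t in (0:ℝ)..1, W.θ j t * (v t - P.g0 t) ≤ 0

lemma ae_mu01_eq_zero_of_integral_nonneg {f : ℝ → ℝ} (hf : BddMeas f) (h0 : ∀ t, f t ≤ 0)
    (h1 : 0 ≤ ∫ t in (0:ℝ)..1, f t) : ∀ᵐ t ∂mu01, f t = 0 := by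
  have hi := (hf.intervalIntegrable 0 1).neg
  have h2 : ∫ t in (0:ℝ)..1, -f t = 0 := by
    refine le_antisymm ?_ (intervalIntegral.integral_nonneg zero_le_one fun t _ => by
      linarith [h0 t])
    rw [intervalIntegral.integral_neg]
    linarith
  have h3 := (intervalIntegral.integral_eq_zero_iff_of_le_of_nonneg_ae zero_le_one
    (Eventually.of_forall fun t => by simpa using h0 t) hi).1 h2
  rw [mu01, ← Measure.restrict_congr_set Ioc_ae_eq_Icc]
  filter_upwards [h3] with t ht
  simpa using ht

lemma exists_isMultiplier_of_isCritical {ε : ℝ} (hε : 0 < ε) (hP : P.IsPareto ε)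
    (W : P.AdjointFamily) {z : ℝ → (Fin n → ℝ) × (Fin l → ℝ)} (hz : P.IsCritical z) :
    ∃ lam : Fin m → ℝ, IsMultiplier W lam ∧
      0 ≤ ∑ j, lam j * ∫ t in (0:ℝ)..1, W.hess j t (z t) := by
  let Φ : (ℝ → Fin l → ℝ) → (ℝ → ℝ) → Fin m → ℝ := fun v w j =>
    ∫ t in (0:ℝ)..1, (W.ham j t (0, v t) - W.θ j t * w t)
  let D : Set (Fin m → ℝ) := {d | ∃ v w c, BddMeas v ∧ BddMeas w ∧ 0 ≤ c ∧
    (∀ᵐ t ∂mu01, w t ≤ -(c * P.g0 t)) ∧ d = Φ v w}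
  have hB : ∀ {v : ℝ → Fin l → ℝ} {w : ℝ → ℝ}, BddMeas v → BddMeas w → ∀ j,
      BddMeas fun t => W.ham j t (0, v t) - W.θ j t * w t := fun hv hw j =>
    (W.bddMeas_ham j ((BddMeas.const 0).prodMk hv)).sub ((W.bddMeas_θ j).mul hw)
  have hham0 : ∀ j t, W.ham j t (0, 0) = 0 := fun j t => by
    rw [W.ham_control]; simp
  have h0 : 0 ∈ D := by
    refine ⟨fun _ => 0, fun _ => 0, 0, BddMeas.const 0, BddMeas.const 0, le_rfl, by simp, ?_⟩
    ext j
    simp only [Φ, hham0, mul_zero, sub_zero, intervalIntegral.integral_zero, Pi.zero_apply]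
  have hadd : ∀ a ∈ D, ∀ b ∈ D, a + b ∈ D := by
    rintro _ ⟨v, w, c, hv, hw, hc, hwc, rfl⟩ _ ⟨v', w', c', hv', hw', hc', hwc', rfl⟩
    refine ⟨fun t => v t + v' t, fun t => w t + w' t, c + c', hv.add hv', hw.add hw',
      add_nonneg hc hc', ?_, ?_⟩
    · filter_upwards [hwc, hwc'] with t h1 h2
      linarith
    · ext j
      simp only [Φ, Pi.add_apply]
      rw [← intervalIntegral.integral_add ((hB hv hw j).intervalIntegrable _ _)
        ((hB hv' hw' j).intervalIntegrable _ _)]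
      refine intervalIntegral.integral_congr fun t _ => ?_
      have : ((0, v t + v' t) : (Fin n → ℝ) × (Fin l → ℝ)) = (0, v t) + (0, v' t) := by simp
      simp only [this, AdjointFamily.ham, hamDeriv_add]
      ring
  have hsmul : ∀ c : ℝ, 0 ≤ c → ∀ a ∈ D, c • a ∈ D := by
    rintro a ha _ ⟨v, w, c, hv, hw, hc, hwc, rfl⟩
    refine ⟨fun t => a • v t, fun t => a * w t, a * c, (BddMeas.const a).smul hv,
      (BddMeas.const a).mul hw, mul_nonneg ha hc, ?_, ?_⟩
    · filter_upwards [hwc] with t h1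
      have := mul_le_mul_of_nonneg_left h1 ha
      linarith
    · ext j
      simp only [Φ, Pi.smul_apply, smul_eq_mul]
      rw [← intervalIntegral.integral_const_mul]
      refine intervalIntegral.integral_congr fun t _ => ?_
      have : ((0, a • v t) : (Fin n → ℝ) × (Fin l → ℝ)) = a • (0, v t) := by simp
      simp only [this, AdjointFamily.ham, hamDeriv_smul]
      ring
  have hDH : ∀ d ∈ D, ∃ j, 0 ≤ d j + 1 / 2 * ∫ t in (0:ℝ)..1, W.hess j t (z t) := by
    rintro _ ⟨v, w, c, hv, hw, hc, hwc, rfl⟩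
    exact exists_nonneg_variation hε hP W hz hv hw hc hwc
  obtain ⟨lam, hl0, hl1, hlD, hlh⟩ := exists_nonneg_multiplier D h0 hadd hsmul
    (fun j => 1 / 2 * ∫ t in (0:ℝ)..1, W.hess j t (z t)) hDH
  refine ⟨lam, ⟨hl0, hl1, ?_, fun v hv hv0 => ?_⟩, ?_⟩
  · let R : ℝ → Fin l → ℝ := fun t i => ∑ j, lam j * W.ham j t (0, Pi.single i 1)
    have hR : ∀ i, BddMeas fun t => R t i := fun i => BddMeas.sum _ fun j _ =>
      (BddMeas.const (lam j)).mul (W.bddMeas_ham j (BddMeas.const _))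
    let v : ℝ → Fin l → ℝ := fun t i => -R t i
    have hv : BddMeas v := BddMeas.pi fun i => (hR i).neg
    have h1 := hlD _ ⟨v, fun _ => 0, 0, hv, BddMeas.const 0, le_rfl, by simp, rfl⟩
    have h2 : ∑ j, lam j * Φ v (fun _ => 0) j = ∫ t in (0:ℝ)..1, -∑ i, R t i * R t i := by
      simp only [Φ, ← intervalIntegral.integral_const_mul]
      rw [← intervalIntegral.integral_finsetSum fun j _ =>
        ((BddMeas.const (lam j)).mul (hB hv (BddMeas.const 0) j)).intervalIntegrable _ _]
      refine intervalIntegral.integral_congr fun t _ => ?_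
      simp only [mul_zero, sub_zero]
      simp_rw [W.ham_control _ t (v t), Finset.mul_sum]
      rw [Finset.sum_comm, ← Finset.sum_neg_distrib]
      refine Finset.sum_congr rfl fun i _ => ?_
      simp only [v]
      rw [← neg_mul, show R t i = ∑ j, lam j * W.ham j t (0, Pi.single i 1) from rfl,
        Finset.mul_sum]
      exact Finset.sum_congr rfl fun j _ => by ring
    rw [h2] at h1
    have h3 := ae_mu01_eq_zero_of_integral_nonneg
      (BddMeas.sum Finset.univ fun i _ => (hR i).mul (hR i)).neg
      (fun t => neg_nonpos.2 (Finset.sum_nonneg fun i _ => mul_self_nonneg _)) h1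
    filter_upwards [h3] with t ht i
    have h4 := (Finset.sum_eq_zero_iff_of_nonneg fun i _ => mul_self_nonneg (R t i)).1
      (neg_eq_zero.1 ht) i (Finset.mem_univ i)
    exact mul_self_eq_zero.1 h4
  · have h1 := hlD _ ⟨fun _ => 0, fun t => v t - P.g0 t, 1, BddMeas.const 0,
      hv.sub P.bddMeas_g0, zero_le_one, by
        filter_upwards [hv0] with t ht
        linarith, rfl⟩
    simp only [Φ, hham0, zero_sub, intervalIntegral.integral_neg, mul_neg,
      Finset.sum_neg_distrib] at h1
    linarith
  · have h1 : ∑ j, lam j * (1 / 2 * ∫ t in (0:ℝ)..1, W.hess j t (z t)) =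
        1 / 2 * ∑ j, lam j * ∫ t in (0:ℝ)..1, W.hess j t (z t) := by
      rw [Finset.mul_sum]
      exact Finset.sum_congr rfl fun j _ => by ring
    linarith

lemma IsMultiplier.of_tendsto {W : P.AdjointFamily} {lam : ℕ → Fin m → ℝ} {lam' : Fin m → ℝ}
    (h : ∀ k, IsMultiplier W (lam k)) (hlim : Tendsto lam atTop (𝓝 lam')) :
    IsMultiplier W lam' := by
  have hj : ∀ j, Tendsto (fun k => lam k j) atTop (𝓝 (lam' j)) := tendsto_pi_nhds.1 hlim
  have hsum : ∀ a : Fin m → ℝ, Tendsto (fun k => ∑ j, lam k j * a j) atTop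
      (𝓝 (∑ j, lam' j * a j)) := fun a =>
    tendsto_finsetSum _ fun j _ => (hj j).mul_const _
  refine ⟨fun j => ge_of_tendsto' (hj j) fun k => (h k).nonneg j, ?_, ?_, fun v hv hv0 => ?_⟩
  · have h1 : Tendsto (fun k => ∑ j, lam k j ^ 2) atTop (𝓝 (∑ j, lam' j ^ 2)) :=
      tendsto_finsetSum _ fun j _ => (hj j).pow 2
    simp only [(h _).norm_one] at h1
    exact tendsto_nhds_unique h1 tendsto_const_nhds
  · filter_upwards [ae_all_iff.2 fun k => (h k).stationary] with t ht i
    have h1 := hsum fun j => W.ham j t (0, Pi.single i 1)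
    simp only [ht] at h1
    exact tendsto_nhds_unique h1 tendsto_const_nhds
  · exact le_of_tendsto' (hsum _) fun k => (h k).normal v hv hv0

lemma tendsto_integral_hess (W : P.AdjointFamily) {z : ℝ → (Fin n → ℝ) × (Fin l → ℝ)}
    {zk : ℕ → ℝ → (Fin n → ℝ) × (Fin l → ℝ)} (hz : BddMeas z) (hzk : ∀ k, BddMeas (zk k))
    (hlim : ∀ ε > (0:ℝ), ∃ N : ℕ, ∀ k ≥ N, ∀ᵐ t ∂mu01, ‖zk k t - z t‖ ≤ ε) (j : Fin m) :
    Tendsto (fun k => ∫ t in (0:ℝ)..1, W.hess j t (zk k t)) atTop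
      (𝓝 (∫ t in (0:ℝ)..1, W.hess j t (z t))) := by
  obtain ⟨M, hM0, hM⟩ := hz.exists_pos
  obtain ⟨Cp, hCp0, hCp⟩ := (W.bddMeas_p j).exists_pos
  obtain ⟨Cθ, hCθ0, hCθ⟩ := (W.bddMeas_θ j).exists_pos
  have hK := P.taylorφ.nonneg
  have hbound : ∀ t v, ‖v‖ ≤ M + 1 → |W.hess j t v| ≤
      P.K * (M + 1) * (M + 1) + n * (Cp * (P.K * (M + 1) * (M + 1))) +
        Cθ * (P.K * (M + 1) * (M + 1)) := by
    intro t v hv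
    have hq : P.K * ‖v‖ * ‖v‖ ≤ P.K * (M + 1) * (M + 1) := by gcongr
    have h1 := ((P.BL j t).le_of_opNorm₂_le_of_le ((P.taylorL j).normB t) hv hv)
    have h2 := ((P.Bφ t).le_of_opNorm₂_le_of_le (P.taylorφ.normB t) hv hv)
    have h3 := ((P.Bg t).le_of_opNorm₂_le_of_le (P.taylorg.normB t) hv hv)
    have h4 := abs_sum_mul_le (W.p j t) (P.Bφ t v v)
    have h5 : (n:ℝ) * (‖W.p j t‖ * ‖P.Bφ t v v‖) ≤ n * (Cp * (P.K * (M + 1) * (M + 1))) := by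
      gcongr
      exact hCp t
    have h6 : |W.θ j t * P.Bg t v v| ≤ Cθ * (P.K * (M + 1) * (M + 1)) := by
      rw [abs_mul]
      exact mul_le_mul (hCθ t) h3 (abs_nonneg _) hCθ0.le
    refine (abs_add_three _ _ _).trans ?_
    exact add_le_add (add_le_add h1 (h4.trans h5)) h6
  choose N hN using fun i : ℕ => hlim (1 / ((i:ℝ) + 1)) (by positivity)
  have hall : ∀ᵐ t ∂mu01, ∀ i, ∀ k ≥ N i, ‖zk k t - z t‖ ≤ 1 / ((i:ℝ) + 1) := by
    refine ae_all_iff.2 fun i => ae_all_iff.2 fun k => ?_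
    by_cases hk : k ≥ N i
    · filter_upwards [hN i k hk] with t ht _ using ht
    · exact Eventually.of_forall fun t h => absurd h hk
  have hall' : ∀ᵐ t ∂volume, t ∈ Set.uIoc (0:ℝ) 1 →
      ∀ i, ∀ k ≥ N i, ‖zk k t - z t‖ ≤ 1 / ((i:ℝ) + 1) := by
    rw [mu01, ae_restrict_iff' measurableSet_Icc] at hall
    filter_upwards [hall] with t ht h
    rw [Set.uIoc_of_le zero_le_one] at h
    exact ht ⟨h.1.le, h.2⟩
  refine intervalIntegral.tendsto_integral_filter_of_dominated_convergence
    (fun _ => P.K * (M + 1) * (M + 1) + n * (Cp * (P.K * (M + 1) * (M + 1))) +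
        Cθ * (P.K * (M + 1) * (M + 1)))
    (Eventually.of_forall fun k => (W.bddMeas_hess j (hzk k)).1.aestronglyMeasurable) ?_ (by simp) ?_
  · filter_upwards [eventually_ge_atTop (N 0)] with k hk
    filter_upwards [hall'] with t ht h
    refine hbound t _ ?_
    have h1 := ht h 0 k hk
    have h2 := norm_le_norm_add_norm_sub' (zk k t) (z t)
    norm_num at h1
    linarith [hM t]
  · filter_upwards [hall'] with t ht h
    have h1 : Tendsto (fun k => zk k t) atTop (𝓝 (z t)) := by
      refine Metric.tendsto_atTop.2 fun δ hδ => ?_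
      obtain ⟨i, hi⟩ := exists_nat_one_div_lt hδ
      exact ⟨N i, fun k hk => by rw [dist_eq_norm]; exact (ht h i k hk).trans_lt hi⟩
    have h2 : Continuous (W.hess j t) := by
      unfold AdjointFamily.hess
      fun_prop
    exact (h2.tendsto _).comp h1

/-- Second-order necessary conditions along limits of interior critical directions. -/
lemma exists_isMultiplier {ε : ℝ} (hε : 0 < ε) (hP : P.IsPareto ε)
    (W : P.AdjointFamily) {z : ℝ → (Fin n → ℝ) × (Fin l → ℝ)} (hz : BddMeas z)
    {zk : ℕ → ℝ → (Fin n → ℝ) × (Fin l → ℝ)} (hzk : ∀ k, P.IsCritical (zk k))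
    (hlim : ∀ ε > (0:ℝ), ∃ N : ℕ, ∀ k ≥ N, ∀ᵐ t ∂mu01, ‖zk k t - z t‖ ≤ ε) :
    ∃ lam : Fin m → ℝ, IsMultiplier W lam ∧
      0 ≤ ∑ j, lam j * ∫ t in (0:ℝ)..1, W.hess j t (z t) := by
  choose lam hlam hH using fun k => exists_isMultiplier_of_isCritical hε hP W (hzk k)
  have hmem : ∀ k, lam k ∈ Metric.closedBall (0 : Fin m → ℝ) 1 := fun k => by
    rw [mem_closedBall_zero_iff]
    refine (pi_norm_le_iff_of_nonneg zero_le_one).2 fun j => ?_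
    have h1 := Finset.single_le_sum (f := fun j => lam k j ^ 2) (fun j _ => sq_nonneg _)
      (Finset.mem_univ j)
    simp only [(hlam k).norm_one] at h1
    exact abs_le_one_iff_mul_self_le_one.2 (by nlinarith)
  obtain ⟨lam', -, ψ, hψ, hψlim⟩ := (isCompact_closedBall (0 : Fin m → ℝ) 1).tendsto_subseq hmem
  refine ⟨lam', IsMultiplier.of_tendsto (fun k => hlam (ψ k)) hψlim, ?_⟩
  have h1 : Tendsto (fun k => ∑ j, lam (ψ k) j * ∫ t in (0:ℝ)..1, W.hess j t (zk (ψ k) t)) atTop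
      (𝓝 (∑ j, lam' j * ∫ t in (0:ℝ)..1, W.hess j t (z t))) :=
    tendsto_finsetSum _ fun j _ => ((tendsto_pi_nhds.1 hψlim) j).mul
      ((tendsto_integral_hess W hz (fun k => (hzk k).bddMeas) hlim j).comp hψ.tendsto_atTop)
  exact ge_of_tendsto' h1 fun k => hH (ψ k)

end LocalProblem

section Smooth

variable {E F : Type*} [NormedAddCommGroup E] [NormedSpace ℝ E] [NormedAddCommGroup F]
  [NormedSpace ℝ F]

lemma norm_sub_sub_fderiv_le {f : E → F} {K r : ℝ} (hf : Differentiable ℝ f)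
    (hK : 0 ≤ K) (hl : ∀ x, ‖x‖ ≤ r → ‖fderiv ℝ f x - fderiv ℝ f 0‖ ≤ K * ‖x‖) {h h' : E}
    (h1 : ‖h‖ ≤ r) (h2 : ‖h'‖ ≤ r) :
    ‖f h - f h' - fderiv ℝ f 0 (h - h')‖ ≤ K * r * ‖h - h'‖ := by
  have h3 := (convex_closedBall (0:E) r).norm_image_sub_le_of_norm_hasFDerivWithin_le
    (f := fun x => f x - fderiv ℝ f 0 x) (f' := fun x => fderiv ℝ f x - fderiv ℝ f 0)
    (C := K * r) (x := h') (y := h)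
    (fun x _ => ((hf x).hasFDerivAt.sub (fderiv ℝ f 0).hasFDerivAt).hasFDerivWithinAt)
    (fun x hx => by
      rw [mem_closedBall_zero_iff] at hx
      exact (hl x hx).trans (by gcongr)) (by simpa using h2) (by simpa using h1)
  rw [map_sub]
  convert h3 using 2
  abel

lemma norm_taylor_two_le {f : E → F} {K : ℝ} (hf : ContDiff ℝ 2 f) (h0 : f 0 = 0) (hK : 0 ≤ K)
    {h : E} (hl : ∀ x, ‖x‖ ≤ ‖h‖ →
      ‖fderiv ℝ (fderiv ℝ f) x - fderiv ℝ (fderiv ℝ f) 0‖ ≤ K * ‖x‖) :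
    ‖f h - fderiv ℝ f 0 h - (1 / 2 : ℝ) • fderiv ℝ (fderiv ℝ f) 0 h h‖ ≤ K * ‖h‖ ^ 3 := by
  set B := fderiv ℝ (fderiv ℝ f) 0 with hB
  have hsymm : ∀ v w, B v w = B w v := fun v w =>
    (hf.contDiffAt (x := (0:E))).isSymmSndFDerivAt (by simp) v w
  have hd : Differentiable ℝ f := hf.differentiable (by norm_num)
  have hdd : Differentiable ℝ (fderiv ℝ f) :=
    (hf.fderiv_right (m := 1) (by norm_num)).differentiable (by norm_num)
  have hderiv : ∀ x, HasFDerivAt (fun x => f x - fderiv ℝ f 0 x - (1 / 2 : ℝ) • B x x)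
      (fderiv ℝ f x - fderiv ℝ f 0 - B x) x := fun x => by
    have h1 := ((hd x).hasFDerivAt.sub (fderiv ℝ f 0).hasFDerivAt).sub
      ((B.hasFDerivAt.clm_apply (hasFDerivAt_id x)).const_smul (1 / 2 : ℝ))
    refine h1.congr_fderiv ?_
    ext v
    simp only [sub_apply, smul_apply, add_apply, ContinuousLinearMap.comp_apply,
      ContinuousLinearMap.flip_apply, ContinuousLinearMap.id_apply, id_eq]
    rw [hsymm v x, ← two_smul ℝ, smul_smul]
    norm_num
  have hbound : ∀ x, ‖x‖ ≤ ‖h‖ → ‖fderiv ℝ f x - fderiv ℝ f 0 - B x‖ ≤ K * ‖h‖ * ‖h‖ := by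
    intro x hx
    have h1 := norm_sub_sub_fderiv_le hdd hK hl hx (h' := 0) (by simp)
    rw [sub_zero] at h1
    exact h1.trans (by gcongr)
  have h3 := (convex_closedBall (0:E) ‖h‖).norm_image_sub_le_of_norm_hasFDerivWithin_le
    (C := K * ‖h‖ * ‖h‖) (x := 0) (y := h) (fun x _ => (hderiv x).hasFDerivWithinAt)
    (fun x hx => hbound x (by simpa using hx)) (by simp) (by simp)
  simp only [h0, map_zero, smul_zero, sub_zero] at h3
  exact h3.trans_eq (by ring)

open Classical in
/-- The increment of `f t` at `p₀ t` for `t ∈ S`, and the linear map `a₀` for other `t`. -/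
noncomputable def shiftAt (S : Set ℝ) (p₀ : ℝ → E) (a₀ : E →L[ℝ] F) (f : ℝ → E → F) (t : ℝ)
    (h : E) : F :=
  if t ∈ S then f t (p₀ t + h) - f t (p₀ t) else a₀ h

lemma shiftAt_of_mem {S : Set ℝ} (p₀ : ℝ → E) (a₀ : E →L[ℝ] F) (f : ℝ → E → F) {t : ℝ}
    (ht : t ∈ S) : shiftAt S p₀ a₀ f t = fun h => f t (p₀ t + h) - f t (p₀ t) := by
  funext h; simp [shiftAt, ht]

lemma shiftAt_of_notMem {S : Set ℝ} (p₀ : ℝ → E) (a₀ : E →L[ℝ] F) (f : ℝ → E → F) {t : ℝ}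
    (ht : t ∉ S) : shiftAt S p₀ a₀ f t = a₀ := by
  funext h; simp [shiftAt, ht]

lemma fderiv_shiftAt_of_mem {S : Set ℝ} (p₀ : ℝ → E) (a₀ : E →L[ℝ] F) (f : ℝ → E → F) {t : ℝ}
    (ht : t ∈ S) : fderiv ℝ (shiftAt S p₀ a₀ f t) = fun h => fderiv ℝ (f t) (p₀ t + h) := by
  funext h
  rw [shiftAt_of_mem p₀ a₀ f ht, fderiv_sub_const, fderiv_comp_add_left]

lemma fderiv_shiftAt_of_notMem {S : Set ℝ} (p₀ : ℝ → E) (a₀ : E →L[ℝ] F) (f : ℝ → E → F) {t : ℝ}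
    (ht : t ∉ S) : fderiv ℝ (shiftAt S p₀ a₀ f t) = fun _ => a₀ := by
  funext h
  rw [shiftAt_of_notMem p₀ a₀ f ht, ContinuousLinearMap.fderiv]

lemma fderiv_fderiv_shiftAt_of_mem {S : Set ℝ} (p₀ : ℝ → E) (a₀ : E →L[ℝ] F) (f : ℝ → E → F)
    {t : ℝ} (ht : t ∈ S) : fderiv ℝ (fderiv ℝ (shiftAt S p₀ a₀ f t)) =
      fun h => fderiv ℝ (fderiv ℝ (f t)) (p₀ t + h) := by
  funext h
  rw [fderiv_shiftAt_of_mem p₀ a₀ f ht, fderiv_comp_add_left]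

lemma fderiv_fderiv_shiftAt_of_notMem {S : Set ℝ} (p₀ : ℝ → E) (a₀ : E →L[ℝ] F) (f : ℝ → E → F)
    {t : ℝ} (ht : t ∉ S) : fderiv ℝ (fderiv ℝ (shiftAt S p₀ a₀ f t)) =
      fun _ => 0 := by
  funext h
  rw [fderiv_shiftAt_of_notMem p₀ a₀ f ht, fderiv_fun_const]
  rfl

/-- `f t`, for `t ∈ S`, is `C²` with values and derivatives that are bounded by `C` at the origin
and `k`-Lipschitz on the ball of radius `M + 1`. -/
structure UniformC2 [MeasurableSpace F] (S : Set ℝ) (M C k : ℝ) (f : ℝ → E → F) : Prop where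
  meas : ∀ p, Measurable fun t => f t p
  contDiff : ∀ t ∈ S, ContDiff ℝ 2 (f t)
  norm_zero : ∀ t ∈ S, ‖f t 0‖ ≤ C
  norm_fderiv : ∀ t ∈ S, ‖fderiv ℝ (f t) 0‖ ≤ C
  norm_fderiv_fderiv : ∀ t ∈ S, ‖fderiv ℝ (fderiv ℝ (f t)) 0‖ ≤ C
  lip : ∀ t ∈ S, ∀ p₁ p₂, ‖p₁‖ ≤ M + 1 → ‖p₂‖ ≤ M + 1 → ‖f t p₁ - f t p₂‖ ≤ k * ‖p₁ - p₂‖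
  lip_fderiv : ∀ t ∈ S, ∀ p₁ p₂, ‖p₁‖ ≤ M + 1 → ‖p₂‖ ≤ M + 1 →
    ‖fderiv ℝ (f t) p₁ - fderiv ℝ (f t) p₂‖ ≤ k * ‖p₁ - p₂‖
  lip_fderiv_fderiv : ∀ t ∈ S, ∀ p₁ p₂, ‖p₁‖ ≤ M + 1 → ‖p₂‖ ≤ M + 1 →
    ‖fderiv ℝ (fderiv ℝ (f t)) p₁ - fderiv ℝ (fderiv ℝ (f t)) p₂‖ ≤ k * ‖p₁ - p₂‖

variable [MeasurableSpace E] [BorelSpace E] [MeasurableSpace F] [BorelSpace F]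
  [SecondCountableTopology F]

lemma measurable_of_hasFDerivAt {X : Type*} [MeasurableSpace X] {f : X → E → F} {x₀ : X → E}
    {A : X → E →L[ℝ] F} (hf : Measurable (Function.uncurry f)) (hx₀ : Measurable x₀)
    (hA : ∀ x, HasFDerivAt (f x) (A x) (x₀ x)) (v : E) : Measurable fun x => A x v := by
  refine measurable_of_tendsto_metrizable (f := fun (k : ℕ) x =>
    (k : ℝ) • (f x (x₀ x + (k : ℝ)⁻¹ • v) - f x (x₀ x))) (fun k => ?_) ?_
  · exact ((hf.comp (measurable_id.prodMk (hx₀.add_const _))).sub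
      (hf.comp (measurable_id.prodMk hx₀))).const_smul _
  · refine tendsto_pi_nhds.2 fun x => ?_
    exact (hA x).lim_real v |>.comp tendsto_natCast_atTop_atTop

lemma Taylor2.of_contDiff {f : ℝ → E → F} {K : ℝ} (hm : Measurable (Function.uncurry f))
    (hf : ∀ t, ContDiff ℝ 2 (f t)) (h0 : ∀ t, f t 0 = 0) (hA : ∀ t, ‖fderiv ℝ (f t) 0‖ ≤ K)
    (hB : ∀ t, ‖fderiv ℝ (fderiv ℝ (f t)) 0‖ ≤ K)
    (hl : ∀ t x, ‖x‖ ≤ 1 → ‖fderiv ℝ (f t) x - fderiv ℝ (f t) 0‖ ≤ K * ‖x‖)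
    (hl' : ∀ t x, ‖x‖ ≤ 1 →
      ‖fderiv ℝ (fderiv ℝ (f t)) x - fderiv ℝ (fderiv ℝ (f t)) 0‖ ≤ K * ‖x‖) :
    Taylor2 K f (fun t => fderiv ℝ (f t) 0) (fun t => fderiv ℝ (fderiv ℝ (f t)) 0) := by
  have hK : 0 ≤ K := (norm_nonneg _).trans (hA 0)
  have hd : ∀ t, Differentiable ℝ (f t) := fun t => (hf t).differentiable (by norm_num)
  have hdd : ∀ t, Differentiable ℝ (fderiv ℝ (f t)) := fun t =>
    ((hf t).fderiv_right (m := 1) (by norm_num)).differentiable (by norm_num)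
  refine ⟨hm, fun v => ?_, fun v w => ?_, hA, hB, fun t r h h' hr h1 h2 => ?_, fun t h h1 => ?_⟩
  · exact measurable_of_hasFDerivAt hm measurable_const (fun t => (hd t 0).hasFDerivAt) v
  · have h1 : Measurable fun q : ℝ × E => fderiv ℝ (f q.1) q.2 w :=
      measurable_of_hasFDerivAt (f := fun q : ℝ × E => f q.1) (x₀ := Prod.snd)
        (hm.comp ((measurable_fst.comp measurable_fst).prodMk measurable_snd)) measurable_snd
        (fun q => (hd q.1 q.2).hasFDerivAt) w
    have h2 : ∀ t, HasFDerivAt (fun h => fderiv ℝ (f t) h w)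
        ((fderiv ℝ (fderiv ℝ (f t)) 0).flip w) 0 := fun t =>
      ((hdd t 0).hasFDerivAt.clm_apply (hasFDerivAt_const w (0:E))).congr_fderiv (by simp)
    exact measurable_of_hasFDerivAt (f := fun t h => fderiv ℝ (f t) h w) h1 measurable_const h2 v
  · exact norm_sub_sub_fderiv_le (hd t) hK (fun x hx => hl t x (hx.trans hr)) h1 h2
  · exact norm_taylor_two_le (hf t) (h0 t) hK fun x hx => hl' t x (hx.trans h1)

variable [SecondCountableTopology E] {S : Set ℝ} {M C k : ℝ} {f : ℝ → E → F}

namespace UniformC2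

omit [SecondCountableTopology F] in
lemma measurable_indicator (H : UniformC2 S M C k f) (hS : MeasurableSet S) {q : ℝ × E → E}
    (hq : Measurable q) :
    Measurable ((Prod.fst ⁻¹' S).indicator fun r : ℝ × E => f r.1 (q r)) := by
  classical
  have h1 : Measurable (Function.uncurry fun p t => S.indicator (fun t => f t p) t) := by
    refine measurable_uncurry_of_continuous_of_measurable (fun t => ?_) fun p =>
      (H.meas p).indicator hS
    by_cases ht : t ∈ S
    · simpa [ht] using (H.contDiff t ht).continuous
    · simpa [ht] using continuous_const
  have h2 : (Prod.fst ⁻¹' S).indicator (fun r : ℝ × E => f r.1 (q r)) =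
      fun r => Function.uncurry (fun p t => S.indicator (fun t => f t p) t) (q r, r.1) := by
    funext r
    by_cases hr : r.1 ∈ S <;> simp [hr]
  rw [h2]
  exact h1.comp (hq.prodMk measurable_fst)

omit [SecondCountableTopology F] in
lemma bddMeas_indicator (H : UniformC2 S M C k f) (hS : MeasurableSet S) (hM : 0 ≤ M)
    (hk : 0 ≤ k) {p : ℝ → E} (hp : Measurable p) (hpM : ∀ t ∈ S, ‖p t‖ ≤ M + 1) :
    BddMeas (S.indicator fun t => f t (p t)) := by
  refine ⟨?_, |C| + k * (M + 1), fun t => ?_⟩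
  · have h1 : S.indicator (fun t => f t (p t)) = fun t =>
        (Prod.fst ⁻¹' S).indicator (fun r : ℝ × E => f r.1 (p r.1)) (t, 0) := by
      funext t
      by_cases ht : t ∈ S <;> simp [ht]
    rw [h1]
    exact (H.measurable_indicator hS (hp.comp measurable_fst)).comp
      (measurable_id.prodMk measurable_const)
  · by_cases ht : t ∈ S
    · rw [Set.indicator_of_mem ht]
      have h1 := H.lip t ht (p t) 0 (hpM t ht) (by rw [_root_.norm_zero]; positivity)
      have h2 := norm_le_norm_add_norm_sub' (f t (p t)) (f t 0)
      rw [sub_zero] at h1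
      have h3 := mul_le_mul_of_nonneg_left (hpM t ht) hk
      linarith [H.norm_zero t ht, le_abs_self C]
    · rw [Set.indicator_of_notMem ht, _root_.norm_zero]
      positivity

lemma measurable_uncurry_shiftAt (H : UniformC2 S M C k f) (hS : MeasurableSet S) {p₀ : ℝ → E}
    (hp₀ : Measurable p₀) (a₀ : E →L[ℝ] F) :
    Measurable (Function.uncurry (shiftAt S p₀ a₀ f)) := by
  classical
  have h2 : Function.uncurry (shiftAt S p₀ a₀ f) = fun q : ℝ × E => if q.1 ∈ S then
      (Prod.fst ⁻¹' S).indicator (fun r : ℝ × E => f r.1 (p₀ r.1 + r.2)) q -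
        (Prod.fst ⁻¹' S).indicator (fun r : ℝ × E => f r.1 (p₀ r.1)) q else a₀ q.2 := by
    funext q
    by_cases hq : q.1 ∈ S <;> simp [shiftAt, hq, Function.uncurry]
  rw [h2]
  have h3 : Measurable fun q : ℝ × E => p₀ q.1 := hp₀.comp measurable_fst
  exact Measurable.ite (measurable_fst hS)
    ((H.measurable_indicator hS (h3.add measurable_snd)).sub (H.measurable_indicator hS h3))
    (a₀.measurable.comp measurable_snd)

lemma taylor2_shiftAt (H : UniformC2 S M C k f) (hS : MeasurableSet S) {p₀ : ℝ → E}
    (hp₀ : Measurable p₀) (a₀ : E →L[ℝ] F) (hM : 0 ≤ M) (hC : 0 ≤ C) (hk : 0 ≤ k)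
    (hp₀M : ∀ t ∈ S, ‖p₀ t‖ ≤ M) :
    Taylor2 (C + k * (M + 1) + ‖a₀‖) (shiftAt S p₀ a₀ f)
      (fun t => fderiv ℝ (shiftAt S p₀ a₀ f t) 0)
      (fun t => fderiv ℝ (fderiv ℝ (shiftAt S p₀ a₀ f t)) 0) := by
  have hkM : k ≤ k * (M + 1) := by nlinarith
  have hkM0 : 0 ≤ k * (M + 1) := by positivity
  have ha : 0 ≤ ‖a₀‖ := norm_nonneg _
  have hbd : ∀ t ∈ S, k * ‖p₀ t - 0‖ ≤ k * (M + 1) := fun t ht => by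
    gcongr
    rw [sub_zero]
    linarith [hp₀M t ht]
  have hp₀M' : ∀ t ∈ S, ‖p₀ t‖ ≤ M + 1 := fun t ht => by linarith [hp₀M t ht]
  have hadd : ∀ t ∈ S, ∀ x, ‖x‖ ≤ 1 → ‖p₀ t + x‖ ≤ M + 1 := fun t ht x hx =>
    (norm_add_le _ _).trans (add_le_add (hp₀M t ht) hx)
  have hle : ∀ x : E, k * ‖x‖ ≤ (C + k * (M + 1) + ‖a₀‖) * ‖x‖ := fun x => by
    gcongr
    linarith
  have h00 : ‖(0:E)‖ ≤ M + 1 := by rw [_root_.norm_zero]; positivity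
  refine Taylor2.of_contDiff
    (H.measurable_uncurry_shiftAt hS hp₀ a₀)
    (fun t => ?_) (fun t => ?_) (fun t => ?_) (fun t => ?_) (fun t x hx => ?_)
    (fun t x hx => ?_) <;> by_cases ht : t ∈ S
  · rw [shiftAt_of_mem p₀ a₀ f ht]
    exact ((H.contDiff t ht).comp (contDiff_const.add contDiff_id)).sub contDiff_const
  · rw [shiftAt_of_notMem p₀ a₀ f ht]
    exact a₀.contDiff
  · simp [shiftAt, ht]
  · simp [shiftAt, ht]
  · simp only [fderiv_shiftAt_of_mem p₀ a₀ f ht, add_zero]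
    have h1 := H.lip_fderiv t ht (p₀ t) 0 (hp₀M' t ht) h00
    have h2 := norm_le_norm_add_norm_sub' (fderiv ℝ (f t) (p₀ t)) (fderiv ℝ (f t) 0)
    linarith [H.norm_fderiv t ht, hbd t ht]
  · rw [fderiv_shiftAt_of_notMem p₀ a₀ f ht]
    linarith
  · simp only [fderiv_fderiv_shiftAt_of_mem p₀ a₀ f ht, add_zero]
    have h1 := H.lip_fderiv_fderiv t ht (p₀ t) 0 (hp₀M' t ht) h00
    have h2 := norm_le_norm_add_norm_sub' (fderiv ℝ (fderiv ℝ (f t)) (p₀ t))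
      (fderiv ℝ (fderiv ℝ (f t)) 0)
    linarith [H.norm_fderiv_fderiv t ht, hbd t ht]
  · rw [fderiv_fderiv_shiftAt_of_notMem p₀ a₀ f ht, ContinuousLinearMap.opNorm_zero]
    linarith
  · simp only [fderiv_shiftAt_of_mem p₀ a₀ f ht, add_zero]
    have h1 := H.lip_fderiv t ht _ _ (hadd t ht x hx) (hp₀M' t ht)
    rw [add_sub_cancel_left] at h1
    exact h1.trans (hle x)
  · rw [fderiv_shiftAt_of_notMem p₀ a₀ f ht, sub_self, _root_.norm_zero]
    positivity
  · simp only [fderiv_fderiv_shiftAt_of_mem p₀ a₀ f ht, add_zero]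
    have h1 := H.lip_fderiv_fderiv t ht _ _ (hadd t ht x hx) (hp₀M' t ht)
    rw [add_sub_cancel_left] at h1
    exact h1.trans (hle x)
  · rw [fderiv_fderiv_shiftAt_of_notMem p₀ a₀ f ht, sub_self, ContinuousLinearMap.opNorm_zero]
    positivity

end UniformC2

end Smooth

lemma exists_bddMeas_ae_eq {V : Type*} [NormedAddCommGroup V] [MeasurableSpace V] [BorelSpace V]
    {v : ℝ → V} (hv : Measurable v) (hb : ∃ C : ℝ, ∀ᵐ t ∂mu01, ‖v t‖ ≤ C) :
    ∃ w, BddMeas w ∧ (∀ t, w t = v t ∨ w t = 0) ∧ ∀ᵐ t ∂mu01, w t = v t := by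
  classical
  obtain ⟨C, hC⟩ := hb
  refine ⟨fun t => if ‖v t‖ ≤ C then v t else 0,
    ⟨hv.ite (measurableSet_le hv.norm measurable_const) measurable_const, |C|, fun t => ?_⟩,
    fun t => ?_, ?_⟩
  · by_cases ht : ‖v t‖ ≤ C
    · simpa [ht] using ht.trans (le_abs_self C)
    · simp [ht]
  · by_cases ht : ‖v t‖ ≤ C <;> simp [ht]
  · filter_upwards [hC] with t ht
    simp [ht]

lemma ae_mu01_mem_Icc : ∀ᵐ t ∂mu01, t ∈ Set.Icc (0:ℝ) 1 := ae_restrict_mem measurableSet_Icc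

lemma integral_congr_ae_mu01 {V : Type*} [NormedAddCommGroup V] [NormedSpace ℝ V] {f h : ℝ → V}
    (hfh : ∀ᵐ t ∂mu01, f t = h t) {t : ℝ} (ht : t ∈ Set.Icc (0:ℝ) 1) :
    ∫ s in (0:ℝ)..t, f s = ∫ s in (0:ℝ)..t, h s := by
  rw [mu01, ae_restrict_iff' measurableSet_Icc] at hfh
  refine intervalIntegral.integral_congr_ae ?_
  filter_upwards [hfh] with s hs h1
  rw [Set.uIoc_of_le ht.1] at h1
  exact hs ⟨h1.1.le, h1.2.trans ht.2⟩

lemma measurable_indicator_of_continuousOn {V : Type*} [NormedAddCommGroup V] [MeasurableSpace V]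
    [BorelSpace V] {S : Set ℝ} (hS : MeasurableSet S) {x : ℝ → V} (hx : ContinuousOn x S) :
    Measurable (S.indicator x) := by
  classical
  rw [← Set.piecewise_eq_indicator]
  exact hx.measurable_piecewise continuousOn_const hS

lemma exists_bddMeas_pair {n l : ℕ} {x : ℝ → Fin n → ℝ} {u : ℝ → Fin l → ℝ}
    (hx : ContinuousOn x (Set.Icc 0 1)) (hu : Measurable u)
    (hb : ∃ C : ℝ, ∀ᵐ t ∂mu01, ‖u t‖ ≤ C) :
    ∃ z : ℝ → (Fin n → ℝ) × (Fin l → ℝ), BddMeas z ∧ (∀ t ∈ Set.Icc (0:ℝ) 1, (z t).1 = x t) ∧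
      ∀ᵐ t ∂mu01, z t = (x t, u t) := by
  obtain ⟨w, hw, -, hwu⟩ := exists_bddMeas_ae_eq hu hb
  obtain ⟨C, hC⟩ := isCompact_Icc.exists_bound_of_continuousOn hx
  refine ⟨fun t => ((Set.Icc (0:ℝ) 1).indicator x t, w t), BddMeas.prodMk
    ⟨measurable_indicator_of_continuousOn measurableSet_Icc hx, |C|, fun t => ?_⟩ hw,
    fun t ht => by simp [ht], ?_⟩
  · by_cases ht : t ∈ Set.Icc (0:ℝ) 1
    · rw [Set.indicator_of_mem ht]
      exact (hC t ht).trans (le_abs_self C)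
    · rw [Set.indicator_of_notMem ht, norm_zero]
      positivity
  · filter_upwards [hwu, ae_mu01_mem_Icc] with t h1 h2
    rw [h1, Set.indicator_of_mem h2]

section Uniform

variable {n l m : ℕ} {L : Fin m → ℝ → (Fin n → ℝ) × (Fin l → ℝ) → ℝ}
  {φ : ℝ → (Fin n → ℝ) × (Fin l → ℝ) → (Fin n → ℝ)} {g : ℝ → (Fin n → ℝ) × (Fin l → ℝ) → ℝ}
  {x₀ : Fin n → ℝ} {xb : ℝ → Fin n → ℝ} {ub : ℝ → Fin l → ℝ}

/-- `S` is a set of full measure on which the almost everywhere hypotheses on the data hold. -/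
structure UniformSet (L : Fin m → ℝ → (Fin n → ℝ) × (Fin l → ℝ) → ℝ)
    (φ : ℝ → (Fin n → ℝ) × (Fin l → ℝ) → (Fin n → ℝ)) (g : ℝ → (Fin n → ℝ) × (Fin l → ℝ) → ℝ)
    (xb : ℝ → Fin n → ℝ) (ub : ℝ → Fin l → ℝ) (S : Set ℝ) (M C k α : ℝ) (i₀ : Fin l) :
    Prop where
  measurableSet : MeasurableSet S
  ae_mem : ∀ᵐ t ∂mu01, t ∈ S
  M_nonneg : 0 ≤ M
  C_nonneg : 0 ≤ C
  k_nonneg : 0 ≤ k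
  α_pos : 0 < α
  measurable : Measurable (S.indicator fun t => (xb t, ub t))
  norm_le : ∀ t ∈ S, ‖(xb t, ub t)‖ ≤ M
  uniformL : ∀ j, UniformC2 S M C k (L j)
  uniformφ : UniformC2 S M C k φ
  uniformg : UniformC2 S M C k g
  regular : ∀ t ∈ S, α ≤ |fderiv ℝ (g t) (xb t, ub t) (0, Pi.single i₀ 1)|
  feasible : ∀ t ∈ S, g t (xb t, ub t) ≤ 0

lemma exists_uniformSet (hH1 : HypH1 L φ g) (hH2 : HypH2 g xb ub)
    (hfeas : FeasibleMCP φ g x₀ xb ub) :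
    ∃ S M C k α i₀, UniformSet L φ g xb ub S M C k α i₀ := by
  obtain ⟨hLm, hLc, hφc, hgc, hφ2, hg2, hLl, hφl, ⟨C₁, hL0⟩, C₂, hφ0⟩ := hH1
  obtain ⟨i₀, α, hα, hreg⟩ := hH2
  obtain ⟨hxc, hum, ⟨C₃, hub⟩, -, hg0⟩ := hfeas
  obtain ⟨C₄, hxb⟩ := isCompact_Icc.exists_bound_of_continuousOn hxc
  set M := max (max C₃ C₄) 0 with hM
  have hM0 : 0 ≤ M := le_max_right _ _
  set C := max (max C₁ C₂) 0 with hC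
  obtain ⟨k₁, hk₁, hLl⟩ := hLl (M + 1) (by positivity)
  obtain ⟨k₂, hk₂, hφl⟩ := hφl (M + 1) (by positivity)
  set k := max k₁ k₂ with hk
  have hk1 : k₁ ≤ k := le_max_left _ _
  have hk2 : k₂ ≤ k := le_max_right _ _
  have hC1 : C₁ ≤ C := (le_max_left _ _).trans (le_max_left _ _)
  have hC2 : C₂ ≤ C := (le_max_right _ _).trans (le_max_left _ _)
  have hev := hLc.and (hreg.and (hub.and (hg0.and (hLl.and (hL0.and (hφ0.and ae_mu01_mem_Icc))))))
  obtain ⟨S, hSae, hSm, hS⟩ := hev.exists_measurable_mem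
  have hkle : ∀ p₁ p₂ : (Fin n → ℝ) × (Fin l → ℝ), k₁ * ‖p₁ - p₂‖ ≤ k * ‖p₁ - p₂‖ ∧
      k₂ * ‖p₁ - p₂‖ ≤ k * ‖p₁ - p₂‖ := fun p₁ p₂ => by constructor <;> gcongr
  have hIcc : S ⊆ Set.Icc 0 1 := fun t ht => (hS t ht).2.2.2.2.2.2.2
  refine ⟨S, M, C, k, α, i₀, hSm, hSae, hM0, le_max_right _ _,
    hk₁.le.trans hk1, hα, ?_, ?_, ?_, ?_, ?_, ?_, ?_⟩
  · have h1 : S.indicator (fun t => (xb t, ub t)) =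
        fun t => (S.indicator xb t, S.indicator ub t) := by
      funext t
      by_cases ht : t ∈ S <;> simp [ht, Prod.zero_eq_mk]
    rw [h1]
    exact (measurable_indicator_of_continuousOn hSm (hxc.mono hIcc)).prodMk (hum.indicator hSm)
  · intro t ht
    exact max_le ((hxb t (hIcc ht)).trans ((le_max_right _ _).trans (le_max_left _ _)))
      ((hS t ht).2.2.1.trans ((le_max_left _ _).trans (le_max_left _ _)))
  · intro j
    have h0 := fun t ht => (hS t ht).2.2.2.2.2.1 j
    have h1 := fun t ht p₁ p₂ h₁ h₂ => ((hS t ht).2.2.2.2.1 j p₁ p₂ h₁ h₂).trans (hkle p₁ p₂).1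
    simp only [← Real.norm_eq_abs] at h0 h1
    refine ⟨hLm j, fun t ht => (hS t ht).1 j, fun t ht => ?_, fun t ht => ?_, fun t ht => ?_,
      fun t ht p₁ p₂ h₁ h₂ => ?_, fun t ht p₁ p₂ h₁ h₂ => ?_, fun t ht p₁ p₂ h₁ h₂ => ?_⟩
    · linarith [h0 t ht, norm_nonneg (L j t 0), norm_nonneg (fderiv ℝ (L j t) 0),
        norm_nonneg (fderiv ℝ (fderiv ℝ (L j t)) 0)]
    · linarith [h0 t ht, norm_nonneg (L j t 0), norm_nonneg (fderiv ℝ (L j t) 0),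
        norm_nonneg (fderiv ℝ (fderiv ℝ (L j t)) 0)]
    · linarith [h0 t ht, norm_nonneg (L j t 0), norm_nonneg (fderiv ℝ (L j t) 0),
        norm_nonneg (fderiv ℝ (fderiv ℝ (L j t)) 0)]
    all_goals
      linarith [h1 t ht p₁ p₂ h₁ h₂, norm_nonneg (L j t p₁ - L j t p₂),
        norm_nonneg (fderiv ℝ (L j t) p₁ - fderiv ℝ (L j t) p₂),
        norm_nonneg (fderiv ℝ (fderiv ℝ (L j t)) p₁ - fderiv ℝ (fderiv ℝ (L j t)) p₂)]
  · have h0 := fun t ht => (hS t ht).2.2.2.2.2.2.1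
    have h1 := fun t p₁ p₂ h₁ h₂ => (hφl t p₁ p₂ h₁ h₂).trans (hkle p₁ p₂).2
    simp only [← Real.norm_eq_abs] at h0 h1
    refine ⟨fun p => (hφc.comp (Continuous.prodMk_left p)).measurable, fun t _ => hφ2 t,
      fun t ht => ?_, fun t ht => ?_, fun t ht => ?_,
      fun t ht p₁ p₂ h₁ h₂ => ?_, fun t ht p₁ p₂ h₁ h₂ => ?_, fun t ht p₁ p₂ h₁ h₂ => ?_⟩
    iterate 3
      linarith [h0 t ht, norm_nonneg (φ t 0), norm_nonneg (fderiv ℝ (φ t) 0),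
        norm_nonneg (fderiv ℝ (fderiv ℝ (φ t)) 0), norm_nonneg (g t 0),
        norm_nonneg (fderiv ℝ (g t) 0), norm_nonneg (fderiv ℝ (fderiv ℝ (g t)) 0)]
    all_goals
      linarith [h1 t p₁ p₂ h₁ h₂, norm_nonneg (φ t p₁ - φ t p₂),
        norm_nonneg (fderiv ℝ (φ t) p₁ - fderiv ℝ (φ t) p₂),
        norm_nonneg (fderiv ℝ (fderiv ℝ (φ t)) p₁ - fderiv ℝ (fderiv ℝ (φ t)) p₂),
        norm_nonneg (g t p₁ - g t p₂), norm_nonneg (fderiv ℝ (g t) p₁ - fderiv ℝ (g t) p₂),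
        norm_nonneg (fderiv ℝ (fderiv ℝ (g t)) p₁ - fderiv ℝ (fderiv ℝ (g t)) p₂)]
  · have h0 := fun t ht => (hS t ht).2.2.2.2.2.2.1
    have h1 := fun t p₁ p₂ h₁ h₂ => (hφl t p₁ p₂ h₁ h₂).trans (hkle p₁ p₂).2
    simp only [← Real.norm_eq_abs] at h0 h1
    refine ⟨fun p => (hgc.comp (Continuous.prodMk_left p)).measurable, fun t _ => hg2 t,
      fun t ht => ?_, fun t ht => ?_, fun t ht => ?_,
      fun t ht p₁ p₂ h₁ h₂ => ?_, fun t ht p₁ p₂ h₁ h₂ => ?_, fun t ht p₁ p₂ h₁ h₂ => ?_⟩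
    iterate 3
      linarith [h0 t ht, norm_nonneg (φ t 0), norm_nonneg (fderiv ℝ (φ t) 0),
        norm_nonneg (fderiv ℝ (fderiv ℝ (φ t)) 0), norm_nonneg (g t 0),
        norm_nonneg (fderiv ℝ (g t) 0), norm_nonneg (fderiv ℝ (fderiv ℝ (g t)) 0)]
    all_goals
      linarith [h1 t p₁ p₂ h₁ h₂, norm_nonneg (φ t p₁ - φ t p₂),
        norm_nonneg (fderiv ℝ (φ t) p₁ - fderiv ℝ (φ t) p₂),
        norm_nonneg (fderiv ℝ (fderiv ℝ (φ t)) p₁ - fderiv ℝ (fderiv ℝ (φ t)) p₂),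
        norm_nonneg (g t p₁ - g t p₂), norm_nonneg (fderiv ℝ (g t) p₁ - fderiv ℝ (g t) p₂),
        norm_nonneg (fderiv ℝ (fderiv ℝ (g t)) p₁ - fderiv ℝ (fderiv ℝ (g t)) p₂)]
  · exact fun t ht => (hS t ht).2.1
  · exact fun t ht => (hS t ht).2.2.2.1

end Uniform

namespace UniformSet

variable {n l m : ℕ} {L : Fin m → ℝ → (Fin n → ℝ) × (Fin l → ℝ) → ℝ}
  {φ : ℝ → (Fin n → ℝ) × (Fin l → ℝ) → (Fin n → ℝ)} {g : ℝ → (Fin n → ℝ) × (Fin l → ℝ) → ℝ}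
  {x₀ : Fin n → ℝ} {xb : ℝ → Fin n → ℝ} {ub : ℝ → Fin l → ℝ} {S : Set ℝ} {M C k α : ℝ}
  {i₀ : Fin l} (H : UniformSet L φ g xb ub S M C k α i₀)
include H

lemma norm_indicator_le (t : ℝ) (ht : t ∈ S) : ‖S.indicator (fun t => (xb t, ub t)) t‖ ≤ M := by
  rw [Set.indicator_of_mem ht]
  exact H.norm_le t ht

lemma taylor2 {F : Type*} [NormedAddCommGroup F] [NormedSpace ℝ F] [MeasurableSpace F]
    [BorelSpace F] [SecondCountableTopology F] {f : ℝ → (Fin n → ℝ) × (Fin l → ℝ) → F}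
    (hf : UniformC2 S M C k f) (a₀ : (Fin n → ℝ) × (Fin l → ℝ) →L[ℝ] F) {K : ℝ}
    (hK : C + k * (M + 1) + ‖a₀‖ ≤ K) :
    Taylor2 K (shiftAt S (S.indicator fun t => (xb t, ub t)) a₀ f)
      (fun t => fderiv ℝ (shiftAt S (S.indicator fun t => (xb t, ub t)) a₀ f t) 0)
      (fun t => fderiv ℝ (fderiv ℝ (shiftAt S (S.indicator fun t => (xb t, ub t)) a₀ f t)) 0) :=
  (hf.taylor2_shiftAt H.measurableSet H.measurable a₀ H.M_nonneg H.C_nonneg H.k_nonneg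
    H.norm_indicator_le).mono hK

/-- The problem translated to the reference pair `(xb, ub)`. -/
noncomputable def toLocalProblem : LocalProblem n l m :=
  let p₀ : ℝ → (Fin n → ℝ) × (Fin l → ℝ) := S.indicator fun t => (xb t, ub t)
  let a₀ : (Fin n → ℝ) × (Fin l → ℝ) →L[ℝ] ℝ :=
    α • (ContinuousLinearMap.proj i₀).comp (ContinuousLinearMap.snd ℝ (Fin n → ℝ) (Fin l → ℝ))
  { K := C + k * (M + 1) + ‖a₀‖
    α := α
    e := Pi.single i₀ 1
    L := fun j => shiftAt S p₀ 0 (L j)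
    AL := fun j t => fderiv ℝ (shiftAt S p₀ 0 (L j) t) 0
    BL := fun j t => fderiv ℝ (fderiv ℝ (shiftAt S p₀ 0 (L j) t)) 0
    φ := shiftAt S p₀ 0 φ
    Aφ := fun t => fderiv ℝ (shiftAt S p₀ 0 φ t) 0
    Bφ := fun t => fderiv ℝ (fderiv ℝ (shiftAt S p₀ 0 φ t)) 0
    g := shiftAt S p₀ a₀ g
    Ag := fun t => fderiv ℝ (shiftAt S p₀ a₀ g t) 0
    Bg := fun t => fderiv ℝ (fderiv ℝ (shiftAt S p₀ a₀ g t)) 0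
    g0 := S.indicator fun t => g t (p₀ t)
    taylorL := fun j => H.taylor2 (H.uniformL j) 0 (by simp)
    taylorφ := H.taylor2 H.uniformφ 0 (by simp)
    taylorg := H.taylor2 H.uniformg a₀ le_rfl
    norm_e := by rw [Pi.norm_single, norm_one]
    α_pos := H.α_pos
    regular := fun t => by
      by_cases ht : t ∈ S
      · simpa [fderiv_shiftAt_of_mem _ _ _ ht, p₀, ht] using H.regular t ht
      · simpa [fderiv_shiftAt_of_notMem _ _ _ ht, a₀] using le_abs_self α
    bddMeas_g0 := H.uniformg.bddMeas_indicator H.measurableSet H.M_nonneg H.k_nonneg H.measurable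
      fun t ht => (H.norm_indicator_le t ht).trans (by linarith)
    g0_nonpos := Eventually.of_forall fun t => by
      by_cases ht : t ∈ S
      · simpa [p₀, ht] using H.feasible t ht
      · simp [ht] }

section Values

variable {t : ℝ} (ht : t ∈ S)
include ht

lemma L_eq (j : Fin m) (h : (Fin n → ℝ) × (Fin l → ℝ)) :
    H.toLocalProblem.L j t h = L j t ((xb t, ub t) + h) - L j t (xb t, ub t) := by
  simp [toLocalProblem, shiftAt, ht]

lemma φ_eq (h : (Fin n → ℝ) × (Fin l → ℝ)) :
    H.toLocalProblem.φ t h = φ t ((xb t, ub t) + h) - φ t (xb t, ub t) := by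
  simp [toLocalProblem, shiftAt, ht]

lemma g_eq (h : (Fin n → ℝ) × (Fin l → ℝ)) :
    H.toLocalProblem.g t h = g t ((xb t, ub t) + h) - g t (xb t, ub t) := by
  simp [toLocalProblem, shiftAt, ht]

lemma g0_eq : H.toLocalProblem.g0 t = g t (xb t, ub t) := by
  simp [toLocalProblem, ht]

lemma AL_eq (j : Fin m) : H.toLocalProblem.AL j t = fderiv ℝ (L j t) (xb t, ub t) := by
  simp [toLocalProblem, fderiv_shiftAt_of_mem _ _ _ ht, ht]

lemma Aφ_eq : H.toLocalProblem.Aφ t = fderiv ℝ (φ t) (xb t, ub t) := by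
  simp [toLocalProblem, fderiv_shiftAt_of_mem _ _ _ ht, ht]

lemma Ag_eq : H.toLocalProblem.Ag t = fderiv ℝ (g t) (xb t, ub t) := by
  simp [toLocalProblem, fderiv_shiftAt_of_mem _ _ _ ht, ht]

lemma BL_eq (j : Fin m) : H.toLocalProblem.BL j t = fderiv ℝ (fderiv ℝ (L j t)) (xb t, ub t) := by
  simp [toLocalProblem, fderiv_fderiv_shiftAt_of_mem _ _ _ ht, ht]

lemma Bφ_eq : H.toLocalProblem.Bφ t = fderiv ℝ (fderiv ℝ (φ t)) (xb t, ub t) := by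
  simp [toLocalProblem, fderiv_fderiv_shiftAt_of_mem _ _ _ ht, ht]

lemma Bg_eq : H.toLocalProblem.Bg t = fderiv ℝ (fderiv ℝ (g t)) (xb t, ub t) := by
  simp [toLocalProblem, fderiv_fderiv_shiftAt_of_mem _ _ _ ht, ht]

end Values

lemma integral_shift_eq {F : Type*} [NormedAddCommGroup F] [NormedSpace ℝ F] [MeasurableSpace F]
    [BorelSpace F] [SecondCountableTopology F] {f f' : ℝ → (Fin n → ℝ) × (Fin l → ℝ) → F}
    (hf : UniformC2 S M C k f)
    (hf' : ∀ t ∈ S, ∀ h, f' t h = f t ((xb t, ub t) + h) - f t (xb t, ub t))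
    {h : ℝ → (Fin n → ℝ) × (Fin l → ℝ)} (hh : Measurable h) (hh1 : ∀ t, ‖h t‖ ≤ 1) {t : ℝ}
    (ht : t ∈ Set.Icc (0:ℝ) 1) :
    ∫ s in (0:ℝ)..t, f' s (h s) = (∫ s in (0:ℝ)..t, f s (xb s + (h s).1, ub s + (h s).2)) -
      ∫ s in (0:ℝ)..t, f s (xb s, ub s) := by
  set p₀ : ℝ → (Fin n → ℝ) × (Fin l → ℝ) := S.indicator fun t => (xb t, ub t) with hp₀
  have h1 := hf.bddMeas_indicator H.measurableSet H.M_nonneg H.k_nonneg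
    (H.measurable.add hh) fun t ht => (norm_add_le _ _).trans
      (add_le_add (H.norm_indicator_le t ht) (hh1 t))
  have h0 := hf.bddMeas_indicator H.measurableSet H.M_nonneg H.k_nonneg H.measurable
    fun t ht => (H.norm_indicator_le t ht).trans (by linarith)
  rw [integral_congr_ae_mu01 (f := fun s => f s (xb s + (h s).1, ub s + (h s).2))
      (h := S.indicator fun t => f t ((p₀ + h) t)) ?_ ht,
    integral_congr_ae_mu01 (f := fun s => f s (xb s, ub s))
      (h := S.indicator fun t => f t (p₀ t)) ?_ ht,
    ← intervalIntegral.integral_sub (h1.intervalIntegrable _ _) (h0.intervalIntegrable _ _)]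
  · refine integral_congr_ae_mu01 ?_ ht
    filter_upwards [H.ae_mem] with s hs
    simp [hs, hf' s hs]
  · filter_upwards [H.ae_mem] with s hs
    simp [hs, hp₀]
  · filter_upwards [H.ae_mem] with s hs
    simp [hs, hp₀, Prod.add_def]

lemma isPareto (hfeas : FeasibleMCP φ g x₀ xb ub) {ε : ℝ}
    (hPareto : ∀ x u, FeasibleMCP φ g x₀ x u →
      (∀ t ∈ Set.Icc (0:ℝ) 1, ‖x t - xb t‖ ≤ ε) → (∀ᵐ t ∂mu01, ‖u t - ub t‖ ≤ ε) →
      ¬ (∀ j, (∫ t in (0:ℝ)..1, L j t (x t, u t)) < ∫ t in (0:ℝ)..1, L j t (xb t, ub t))) :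
    H.toLocalProblem.IsPareto ε := by
  obtain ⟨hxc, hum, ⟨B, hB⟩, hst, -⟩ := hfeas
  intro h hh hh1 hhε hhc hheq hhg hL
  refine hPareto (fun t => xb t + (h t).1) (fun t => ub t + (h t).2)
    ⟨hxc.add hhc, hum.add hh.1.snd, ⟨B + 1, ?_⟩, fun t ht => ?_, ?_⟩ (fun t _ => ?_)
    (Eventually.of_forall fun t => ?_) fun j => ?_
  · filter_upwards [hB] with t ht
    exact (norm_add_le _ _).trans (add_le_add ht ((norm_snd_le (h t)).trans (hh1 t)))
  · beta_reduce
    rw [hheq t ht, H.integral_shift_eq H.uniformφ (fun s hs => H.φ_eq hs) hh.1 hh1 ht,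
      hst t ht]
    abel
  · filter_upwards [hhg, H.ae_mem] with t ht htS
    rw [H.g0_eq htS, H.g_eq htS, add_sub_cancel] at ht
    exact ht
  · rw [add_sub_cancel_left]
    exact (norm_fst_le (h t)).trans (hhε t)
  · rw [add_sub_cancel_left]
    exact (norm_snd_le (h t)).trans (hhε t)
  · have h1 := hL j
    rw [H.integral_shift_eq (H.uniformL j) (fun s hs => H.L_eq hs j) hh.1 hh1
      (Set.right_mem_Icc.2 zero_le_one)] at h1
    linarith

lemma exists_isCritical {x : ℝ → Fin n → ℝ} {u : ℝ → Fin l → ℝ}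
    (hxu : MemC0 L φ g xb ub x u) :
    ∃ z, H.toLocalProblem.IsCritical z ∧ ∀ᵐ t ∂mu01, z t = (x t, u t) := by
  obtain ⟨hxc, hum, hb, hdesc, hst, c, hc, v, -, -, hv0, hvg⟩ := hxu
  obtain ⟨z, hz, hzx, hzae⟩ := exists_bddMeas_pair hxc hum hb
  refine ⟨z, ⟨hz, fun t ht => ?_, fun j => ?_, c, hc.le, ?_⟩, hzae⟩
  · rw [hzx t ht, hst t ht]
    refine integral_congr_ae_mu01 ?_ ht
    filter_upwards [H.ae_mem, hzae] with s hs h1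
    rw [H.Aφ_eq hs, h1]
  · rw [integral_congr_ae_mu01 (h := fun t => fderiv ℝ (L j t) (xb t, ub t) (x t, u t)) ?_
      (Set.right_mem_Icc.2 zero_le_one)]
    · exact hdesc j
    · filter_upwards [H.ae_mem, hzae] with s hs h1
      rw [H.AL_eq hs, h1]
  · filter_upwards [H.ae_mem, hzae, hv0, hvg] with s hs h1 h2 h3
    rw [H.Ag_eq hs, H.g0_eq hs, h1, h3]
    nlinarith

end UniformSet

lemma BddMeas.integrableOn_Icc {V : Type*} [NormedAddCommGroup V] [MeasurableSpace V]
    [BorelSpace V] [SecondCountableTopology V] {h : ℝ → V} (hh : BddMeas h) :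
    IntegrableOn h (Set.Icc 0 1) :=
  (intervalIntegrable_iff_integrableOn_Icc_of_le zero_le_one).1 (hh.intervalIntegrable 0 1)

lemma intervalIntegral_apply {n : ℕ} {q : ℝ → Fin n → ℝ} (hq : BddMeas q) {a b : ℝ} (i : Fin n) :
    (∫ t in a..b, q t) i = ∫ t in a..b, q t i :=
  ((ContinuousLinearMap.proj (R := ℝ) (φ := fun _ : Fin n => ℝ) i).intervalIntegral_comp_comm
    (hq.intervalIntegrable a b)).symm

/-- **Second-order necessary optimality conditions for (MCP)** (Theorem 2.1):
if `(x̄, ū)` is a locally weak Pareto solution under (H1)–(H2), then for every critical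
direction `z = (x,u) ∈ 𝒞(z̄)` there are multipliers `λ ∈ ℝ^m₊`, `|λ| = 1`, an absolutely
continuous adjoint state `p̄` and `θ ∈ L¹` satisfying (i) `θ ∈ N(Q; g[·])`,
(ii) the adjoint equation with `p̄(1) = 0`, (iii) stationarity in `u`, and
(iv) the second-order non-negativity condition. -/
theorem secondOrder_necessary_condition_MCP {n l m : ℕ}
    (L : Fin m → ℝ → (Fin n → ℝ) × (Fin l → ℝ) → ℝ)
    (φ : ℝ → (Fin n → ℝ) × (Fin l → ℝ) → (Fin n → ℝ))
    (g : ℝ → (Fin n → ℝ) × (Fin l → ℝ) → ℝ)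
    (x₀ : Fin n → ℝ) (xb : ℝ → Fin n → ℝ) (ub : ℝ → Fin l → ℝ)
    (hH1 : HypH1 L φ g) (hH2 : HypH2 g xb ub)
    (hfeas : FeasibleMCP φ g x₀ xb ub)
    -- `z̄ = (x̄, ū)` is a locally weak Pareto solution of (MCP)
    (hPareto : ∃ ε > 0, ∀ x u, FeasibleMCP φ g x₀ x u →
      (∀ t ∈ Set.Icc (0:ℝ) 1, ‖x t - xb t‖ ≤ ε) →
      (∀ᵐ t ∂mu01, ‖u t - ub t‖ ≤ ε) →
      ¬ (∀ j, (∫ t in (0:ℝ)..1, L j t (x t, u t)) <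
              ∫ t in (0:ℝ)..1, L j t (xb t, ub t)))
    (x : ℝ → Fin n → ℝ) (u : ℝ → Fin l → ℝ)
    (hz : MemCriticalCone L φ g xb ub x u) :
    ∃ (lam : Fin m → ℝ) (p : ℝ → Fin n → ℝ) (θ : ℝ → ℝ),
      (∀ j, 0 ≤ lam j) ∧ (∑ j, lam j ^ 2 = 1) ∧
      Measurable θ ∧ IntegrableOn θ (Set.Icc 0 1) ∧
      -- (i): `θ ∈ N(Q; g[·])`
      (∀ v : ℝ → ℝ, Measurable v → (∃ C : ℝ, ∀ᵐ t ∂mu01, |v t| ≤ C) →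
        (∀ᵐ t ∂mu01, v t ≤ 0) →
        (∫ t in (0:ℝ)..1, θ t * (v t - g t (xb t, ub t))) ≤ 0) ∧
      -- (ii): `p̄` is absolutely continuous, satisfies the adjoint equation a.e.,
      -- and `p̄(1) = 0`
      (∃ q : ℝ → Fin n → ℝ, IntegrableOn q (Set.Icc 0 1) ∧
        (∀ t ∈ Set.Icc (0:ℝ) 1, p t = p 0 + ∫ s in (0:ℝ)..t, q s) ∧
        (∀ᵐ t ∂mu01, q t = fun i =>
          -(∑ j, lam j * fderiv ℝ (L j t) (xb t, ub t) (Pi.single i 1, 0)) -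
          (∑ k, fderiv ℝ (φ t) (xb t, ub t) (Pi.single i 1, 0) k * p t k) -
          θ t * fderiv ℝ (g t) (xb t, ub t) (Pi.single i 1, 0)) ∧
        p 1 = 0) ∧
      -- (iii): stationarity in `u`
      (∀ᵐ t ∂mu01, ∀ i : Fin l,
        (∑ j, lam j * fderiv ℝ (L j t) (xb t, ub t) (0, Pi.single i 1)) +
        (∑ k, p t k * fderiv ℝ (φ t) (xb t, ub t) (0, Pi.single i 1) k) +
        θ t * fderiv ℝ (g t) (xb t, ub t) (0, Pi.single i 1) = 0) ∧
      -- (iv): second-order non-negativity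
      0 ≤ ∫ t in (0:ℝ)..1,
        ((∑ j, lam j * fderiv ℝ (fderiv ℝ (L j t)) (xb t, ub t) (x t, u t) (x t, u t)) +
         (∑ k, p t k * fderiv ℝ (fderiv ℝ (φ t)) (xb t, ub t) (x t, u t) (x t, u t) k) +
         θ t * fderiv ℝ (fderiv ℝ (g t)) (xb t, ub t) (x t, u t) (x t, u t)) := by
  obtain ⟨S, M, C, k, α, i₀, H⟩ := exists_uniformSet hH1 hH2 hfeas
  obtain ⟨ε, hε, hPareto⟩ := hPareto
  have hP := H.isPareto hfeas hPareto
  obtain ⟨hxc, hum, hub, xk, uk, hk, hlim⟩ := hz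
  obtain ⟨z, hzB, -, hzae⟩ := exists_bddMeas_pair hxc hum hub
  choose zk hzk hzkae using fun k => H.exists_isCritical (hk k)
  obtain ⟨W⟩ := H.toLocalProblem.nonempty_adjointFamily
  obtain ⟨lam, hlam, hhess⟩ := LocalProblem.exists_isMultiplier hε hP W hzB hzk fun ε hε => by
    obtain ⟨N, hN⟩ := hlim ε hε
    refine ⟨N, fun k hkN => ?_⟩
    filter_upwards [hzae, hzkae k, (hN k hkN).2, ae_mu01_mem_Icc] with t h1 h2 h3 h4
    rw [h1, h2]
    exact max_le ((hN k hkN).1 t h4) h3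
  have h01 : (1:ℝ) ∈ Set.Icc (0:ℝ) 1 := Set.right_mem_Icc.2 zero_le_one
  have hlamB : ∀ {f : Fin m → ℝ → ℝ}, (∀ j, BddMeas (f j)) →
      BddMeas fun t => ∑ j, lam j * f j t := fun hf =>
    BddMeas.sum _ fun j _ => (BddMeas.const (lam j)).mul (hf j)
  have hint : ∀ {f : Fin m → ℝ → ℝ}, (∀ j, BddMeas (f j)) → ∀ a b,
      ∑ j, lam j * ∫ t in a..b, f j t = ∫ t in a..b, ∑ j, lam j * f j t := fun hf a b => by
    rw [intervalIntegral.integral_finsetSum fun j _ =>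
      ((BddMeas.const (lam j)).mul (hf j)).intervalIntegrable a b]
    simp only [intervalIntegral.integral_const_mul]
  have hθB : BddMeas fun t => ∑ j, lam j * W.θ j t := hlamB W.bddMeas_θ
  have hhamB : ∀ i j, BddMeas fun t => -W.ham j t (Pi.single i 1, 0) := fun i j =>
    (W.bddMeas_ham j (BddMeas.const _)).neg
  have hqB : BddMeas fun t i => ∑ j, lam j * -W.ham j t (Pi.single i 1, 0) :=
    BddMeas.pi fun i => hlamB (hhamB i)
  have hham : ∀ t v, ∑ j, lam j * W.ham j t v = (∑ j, lam j * H.toLocalProblem.AL j t v) +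
      (∑ k, (∑ j, lam j * W.p j t k) * H.toLocalProblem.Aφ t v k) +
      (∑ j, lam j * W.θ j t) * H.toLocalProblem.Ag t v := fun t v => by
    simp only [LocalProblem.AdjointFamily.ham, hamDeriv, mul_add, Finset.sum_add_distrib,
      Finset.mul_sum, Finset.sum_mul]
    rw [Finset.sum_comm]
    simp only [mul_assoc]
  refine ⟨lam, fun t k => ∑ j, lam j * W.p j t k, fun t => ∑ j, lam j * W.θ j t, hlam.nonneg,
    hlam.norm_one, hθB.1, hθB.integrableOn_Icc, fun v hv hvb hv0 => ?_,
    ⟨fun t i => ∑ j, lam j * -W.ham j t (Pi.single i 1, 0), hqB.integrableOn_Icc,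
      fun t ht => ?_, ?_, ?_⟩, ?_, ?_⟩
  · obtain ⟨w, hw, -, hwv⟩ := exists_bddMeas_ae_eq hv hvb
    have h1 := hlam.normal w hw (by filter_upwards [hwv, hv0] with t h1 h2; rwa [h1])
    rw [hint fun j => (W.bddMeas_θ j).mul (hw.sub H.toLocalProblem.bddMeas_g0)] at h1
    refine (integral_congr_ae_mu01 ?_ h01).trans_le h1
    filter_upwards [hwv, H.ae_mem] with t h2 h3
    rw [h2, H.g0_eq h3, Finset.sum_mul]
    simp only [mul_assoc]
  · ext i
    rw [Pi.add_apply, intervalIntegral_apply hqB, ← hint (hhamB i)]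
    rw [← Finset.sum_add_distrib]
    refine Finset.sum_congr rfl fun j _ => ?_
    rw [← intervalIntegral_apply (BddMeas.pi fun i => hhamB i j), W.eq j t ht, Pi.add_apply, mul_add]
    rfl
  · filter_upwards [H.ae_mem] with t ht
    funext i
    simp only [mul_neg, Finset.sum_neg_distrib]
    rw [hham, H.Aφ_eq ht, H.Ag_eq ht]
    simp only [H.AL_eq ht, mul_comm (∑ j, lam j * W.p j t _)]
    ring
  · ext i
    simp [W.p_one]
  · filter_upwards [H.ae_mem, hlam.stationary] with t ht h1 i
    rw [← h1 i, hham, H.Aφ_eq ht, H.Ag_eq ht]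
    simp only [H.AL_eq ht]
  · rw [hint fun j => W.bddMeas_hess j hzB] at hhess
    refine hhess.trans_eq (integral_congr_ae_mu01 ?_ h01)
    filter_upwards [H.ae_mem, hzae] with t ht h1
    simp only [LocalProblem.AdjointFamily.hess, h1, H.BL_eq ht, H.Bφ_eq ht, H.Bg_eq ht, mul_add,
      Finset.sum_add_distrib, Finset.mul_sum, Finset.sum_mul]
    rw [Finset.sum_comm]
    simp only [mul_assoc]
end

section
/- Let ν : [0,1] → ℝⁿ be a function of bounded variation that is continuous from the right and vanishes at 0, and let ϑ ∈ L¹([0,1], ℝⁿ). Suppose that −∫₀¹ x(t)ᵀ dν(t) = ∫₀¹ ϑ(s)ᵀ x(s) ds for every x ∈ C([0,1], ℝⁿ), where the left-hand side is a Riemann–Stieltjes integral. Then for every t ∈ [0,1] that is simultaneously a Lebesgue point of s ↦ ϑ(s) and of s ↦ sϑ(s), and for every ξ ∈ ℝⁿ, one has −∫₀¹ x_t(s)ᵀ dν(s) = ∫₀¹ ϑ(s)ᵀ x_t(s) ds, where x_t(s) = ξ·χ_{(t,1]}(s); equivalently, −∫_{(t,1]} ξᵀ dν(s) = ∫_t¹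 ξᵀ ϑ(s) ds. -/
open Filter Topology MeasureTheory

/-- `IsRSIntegral x ν a b I` says that the Riemann–Stieltjes integral
`∫_a^b x(t)ᵀ dν(t)` exists and equals `I`, in the mesh-based sense: Riemann–Stieltjes
sums over tagged partitions of `[a,b]` with small enough mesh are close to `I`. -/
def IsRSIntegral {n : ℕ} (x ν : ℝ → Fin n → ℝ) (a b : ℝ) (I : ℝ) : Prop :=
  ∀ ε > (0:ℝ), ∃ δ > (0:ℝ), ∀ (k : ℕ) (p : Fin (k + 1) → ℝ) (tag : Fin k → ℝ),
    Monotone p → p 0 = a → p (Fin.last k) = b →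
    (∀ i : Fin k, p i.castSucc ≤ tag i ∧ tag i ≤ p i.succ) →
    (∀ i : Fin k, p i.succ - p i.castSucc ≤ δ) →
    |(∑ i : Fin k, ∑ j, x (tag i) j * (ν (p i.succ) j - ν (p i.castSucc) j)) - I| ≤ ε

/-- `t` is a (right) Lebesgue point of `h`:
`(1/(ε−t)) ∫_t^ε ‖h(s) − h(t)‖ ds → 0` as `ε → t⁺`. -/
def RightLebesguePoint {n : ℕ} (h : ℝ → Fin n → ℝ) (t : ℝ) : Prop :=
  Tendsto (fun ε : ℝ => (ε - t)⁻¹ * ∫ s in t..ε, ‖h s - h t‖) (𝓝[>] t) (𝓝 0)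

/-- Mesh-based Riemann–Stieltjes integral `∫_a^b c dg = I` for real-valued functions. -/
def IsRealRSIntegral (c g : ℝ → ℝ) (a b I : ℝ) : Prop :=
  ∀ ε > (0:ℝ), ∃ δ > (0:ℝ), ∀ (k : ℕ) (p : Fin (k + 1) → ℝ) (tag : Fin k → ℝ),
    Monotone p → p 0 = a → p (Fin.last k) = b →
    (∀ i : Fin k, p i.castSucc ≤ tag i ∧ tag i ≤ p i.succ) →
    (∀ i : Fin k, p i.succ - p i.castSucc ≤ δ) →
    |(∑ i : Fin k, c (tag i) * (g (p i.succ) - g (p i.castSucc))) - I| ≤ ε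

lemma isRSIntegral_smul_iff {n : ℕ} (c : ℝ → ℝ) (ξ : Fin n → ℝ) (ν : ℝ → Fin n → ℝ)
    (a b I : ℝ) :
    IsRSIntegral (fun s => c s • ξ) ν a b I ↔
      IsRealRSIntegral c (fun s => ∑ j, ξ j * ν s j) a b I := by
  have h (s u v : ℝ) : ∑ j, (c s • ξ) j * (ν u j - ν v j) =
      c s * (∑ j, ξ j * ν u j - ∑ j, ξ j * ν v j) := by
    rw [← Finset.sum_sub_distrib, Finset.mul_sum]
    refine Finset.sum_congr rfl fun j _ => ?_
    simp only [Pi.smul_apply, smul_eq_mul]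
    ring
  simp only [IsRSIntegral, IsRealRSIntegral, h]

/-- Summation by parts against the increments of a monotone cutoff `c` from `0` to `1`. -/
lemma abs_sum_mul_sub_sub_le {c g : ℕ → ℝ} {N : ℕ} {y η : ℝ}
    (hc : ∀ i < N, c i ≤ c (i + 1)) (h0 : c 0 = 0) (h1 : c N = 1)
    (hg : ∀ i < N, c i ≠ c (i + 1) → |g (i + 1) - y| ≤ η) :
    |∑ i ∈ Finset.range N, c i * (g (i + 1) - g i) - (g N - y)| ≤ η := by
  have key : ∑ i ∈ Finset.range N, c i * (g (i + 1) - g i) - (g N - y) =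
      -∑ i ∈ Finset.range N, (g (i + 1) - y) * (c (i + 1) - c i) := by
    have h := Finset.sum_range_sub (fun i => c i * (g i - y)) N
    simp only [h0, h1, zero_mul, one_mul, sub_zero] at h
    rw [← h, ← Finset.sum_sub_distrib, ← Finset.sum_neg_distrib]
    exact Finset.sum_congr rfl fun i _ => by ring
  have hsum : ∑ i ∈ Finset.range N, η * (c (i + 1) - c i) = η := by
    rw [← Finset.mul_sum, Finset.sum_range_sub, h0, h1]
    ring
  rw [key, abs_neg]
  refine (Finset.abs_sum_le_sum_abs _ _).trans (le_of_le_of_eq (Finset.sum_le_sum ?_) hsum)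
  intro i hi
  have hi := Finset.mem_range.1 hi
  rw [abs_mul, abs_of_nonneg (sub_nonneg.2 (hc i hi))]
  by_cases h : c i = c (i + 1)
  · simp [h]
  · exact mul_le_mul_of_nonneg_right (hg i hi h) (sub_nonneg.2 (hc i hi))

lemma IsRealRSIntegral.abs_sub_le {c g : ℝ → ℝ} {t r ρ η I : ℝ}
    (hI : IsRealRSIntegral c g 0 1 I) (hc : Monotone c) (ht : 0 ≤ t) (hr : r ≤ 1) (hrρ : r < ρ)
    (hc0 : ∀ s ≤ t, c s = 0) (hc1 : ∀ s, r ≤ s → c s = 1)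
    (hg : ∀ s, t < s → s < ρ → |g s - g t| ≤ η) :
    |I - (g 1 - g t)| ≤ η := by
  refine le_of_forall_pos_le_add fun ε hε => ?_
  obtain ⟨δ, hδ, H⟩ := hI ε hε
  obtain ⟨M, hM⟩ := exists_nat_one_div_lt (lt_min hδ (sub_pos.2 hrρ))
  obtain ⟨hMδ, hMρ⟩ := lt_min_iff.1 hM
  set N : ℕ := M + 1 with hN
  have hNpos : (0 : ℝ) < N := by positivity
  have hN1 : (1 : ℝ) / N = 1 / ((M : ℝ) + 1) := by push_cast [hN]; rfl
  let q : ℕ → ℝ := fun i => i / N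
  have hq : Monotone q := fun i j hij => by
    simp only [q]; gcongr
  have hstep (i : ℕ) : q (i + 1) = q i + 1 / N := by
    simp only [q]; push_cast; ring
  have hqN : q N = 1 := div_self hNpos.ne'
  have hq0 : q 0 = 0 := by simp [q]
  have h := H N (fun i => q i) (fun i => q i) (fun i j hij => hq hij) (by simpa using hq0)
    (by simpa using hqN) (fun i => ⟨by simp, hq (by simp)⟩)
    (fun i => by
      have := hstep i
      simp only [Fin.val_succ, Fin.val_castSucc]
      linarith)
  simp only [Fin.val_succ, Fin.val_castSucc] at h
  rw [Fin.sum_univ_eq_sum_range (fun i => c (q i) * (g (q (i + 1)) - g (q i))) N] at h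
  have h2 := abs_sum_mul_sub_sub_le (c := fun i => c (q i)) (g := fun i => g (q i)) (N := N)
    (y := g t) (η := η) (fun i _ => hc (hq i.le_succ)) (hc0 _ (hq0.trans_le ht))
    (hc1 _ (hr.trans_eq hqN.symm)) (fun i _ hne => ?_)
  · simp only [hqN] at h2
    rw [abs_le] at h h2 ⊢
    constructor <;> linarith [h.1, h.2, h2.1, h2.2]
  · have hle : q i ≤ q (i + 1) := hq i.le_succ
    refine hg _ ?_ ?_
    · by_contra! hlt
      exact hne ((hc0 _ (hle.trans hlt)).trans (hc0 _ hlt).symm)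
    · have : q i < r := by
        by_contra! hlt
        exact hne ((hc1 _ hlt).trans (hc1 _ (hlt.trans hle)).symm)
      linarith [hstep i]

lemma sub_eq_neg_integral_of_isRealRSIntegral {g f : ℝ → ℝ}
    (hRC : ∀ t ∈ Set.Ico (0:ℝ) 1, ContinuousWithinAt g (Set.Ioi t) t)
    (hf : IntervalIntegrable f volume 0 1)
    (hkey : ∀ c : ℝ → ℝ, Continuous c →
      IsRealRSIntegral c g 0 1 (-∫ s in (0:ℝ)..1, c s * f s))
    {t : ℝ} (ht : t ∈ Set.Icc (0:ℝ) 1) :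
    g 1 - g t = -∫ s in t..(1:ℝ), f s := by
  rcases ht.2.eq_or_lt with rfl | ht1
  · simp
  let c : ℝ → ℝ → ℝ := fun e s => max 0 (min 1 ((s - t) / e))
  have hcc (e : ℝ) : Continuous (c e) := by fun_prop
  have hc0 {e : ℝ} (he : 0 < e) (s : ℝ) (hs : s ≤ t) : c e s = 0 := by
    have : (s - t) / e ≤ 0 := div_nonpos_of_nonpos_of_nonneg (by linarith) he.le
    exact max_eq_left ((min_le_right _ _).trans this)
  have hc1 {e : ℝ} (he : 0 < e) (s : ℝ) (hs : t + e ≤ s) : c e s = 1 := by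
    have : 1 ≤ (s - t) / e := (one_le_div he).2 (by linarith)
    simp [c, min_eq_left this]
  have hcm {e : ℝ} (he : 0 < e) : Monotone (c e) := fun a b hab => by
    simp only [c]; gcongr
  have hcb (e s : ℝ) : ‖c e s‖ ≤ 1 := by
    rw [Real.norm_of_nonneg (le_max_left _ _)]
    exact max_le zero_le_one (min_le_left _ _)
  have hlim : Tendsto (fun e => ∫ s in (0:ℝ)..1, c e s * f s) (𝓝[>] 0)
      (𝓝 (∫ s in (0:ℝ)..1, (Set.Ioi t).indicator f s)) := by
    refine intervalIntegral.tendsto_integral_filter_of_dominated_convergence (fun s => ‖f s‖)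
      (Eventually.of_forall fun e => ?_) (Eventually.of_forall fun e => ?_) hf.norm ?_
    · exact (hcc e).aestronglyMeasurable.mul hf.def'.aestronglyMeasurable
    · refine Eventually.of_forall fun s _ => ?_
      rw [norm_mul]
      exact mul_le_of_le_one_left (norm_nonneg _) (hcb e s)
    · refine Eventually.of_forall fun s _ => ?_
      refine tendsto_const_nhds.congr' ?_
      rcases le_or_gt s t with hs | hs
      · filter_upwards [self_mem_nhdsWithin] with e he
        rw [hc0 he s hs, zero_mul, Set.indicator_of_notMem (by simpa using hs)]
      · filter_upwards [Ioo_mem_nhdsGT (sub_pos.2 hs)] with e he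
        rw [hc1 he.1 s (by linarith [he.2]), one_mul, Set.indicator_of_mem (Set.mem_Ioi.2 hs)]
  have hind : ∫ s in (0:ℝ)..1, (Set.Ioi t).indicator f s = ∫ s in t..(1:ℝ), f s := by
    rw [intervalIntegral.integral_of_le zero_le_one, intervalIntegral.integral_of_le ht.2,
      setIntegral_indicator measurableSet_Ioi]
    congr 2
    ext s
    simp only [Set.mem_inter_iff, Set.mem_Ioc, Set.mem_Ioi]
    exact ⟨fun h => ⟨h.2, h.1.2⟩, fun h => ⟨⟨ht.1.trans_lt h.1, h.2⟩, h.1⟩⟩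
  rw [hind] at hlim
  refine tendsto_nhds_unique (f := fun _ : ℝ => g 1 - g t) (l := 𝓝[>] (0:ℝ)) tendsto_const_nhds ?_
  refine hlim.neg.congr_dist ?_
  rw [Metric.tendsto_nhds]
  intro η hη
  obtain ⟨ρ, hρ, hgρ⟩ := mem_nhdsGT_iff_exists_Ioo_subset.1
    ((hRC t ⟨ht.1, ht1⟩).eventually (Metric.closedBall_mem_nhds (g t) (half_pos hη)))
  filter_upwards [Ioo_mem_nhdsGT (lt_min (sub_pos.2 ht1) (sub_pos.2 (Set.mem_Ioi.1 hρ)))]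
    with e he
  obtain ⟨he1, heρ⟩ := lt_min_iff.1 he.2
  have := (hkey _ (hcc e)).abs_sub_le (hcm he.1) ht.1 (r := t + e) (ρ := ρ) (η := η / 2)
    (by linarith) (by linarith) (hc0 he.1) (hc1 he.1) (fun s h1 h2 => hgρ ⟨h1, h2⟩)
  rw [Real.dist_0_eq_abs, abs_of_nonneg dist_nonneg, Real.dist_eq]
  linarith

/-- A Riemann–Stieltjes sum of a step function telescopes to an increment of the integrator whose
left endpoint is within the mesh of the jump. -/
lemma exists_sum_indicator_mul_sub_eq (g : ℝ → ℝ) {t b δ : ℝ} (hδ : 0 ≤ δ) (k : ℕ)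
    (p : Fin (k + 1) → ℝ) (tag : Fin k → ℝ) (hp : Monotone p) (h0 : p 0 ≤ t)
    (hb : p (Fin.last k) ≤ b)
    (htag : ∀ i : Fin k, p i.castSucc ≤ tag i ∧ tag i ≤ p i.succ)
    (hmesh : ∀ i : Fin k, p i.succ - p i.castSucc ≤ δ) :
    ∃ r, p 0 ≤ r ∧ r ≤ p (Fin.last k) ∧ (t - δ ≤ r ∨ r = p (Fin.last k)) ∧ r ≤ t + δ ∧
      ∑ i : Fin k, (Set.Ioc t b).indicator (fun _ => (1:ℝ)) (tag i) *
        (g (p i.succ) - g (p i.castSucc)) = g (p (Fin.last k)) - g r := by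
  induction k with
  | zero => exact ⟨p 0, le_rfl, le_rfl, Or.inr rfl, by linarith, by simp⟩
  | succ k ih =>
    have hlast := htag (Fin.last k)
    have hm := hmesh (Fin.last k)
    simp only [Fin.succ_last] at hlast hm
    rcases le_or_gt (tag (Fin.last k)) t with hle | hgt
    · refine ⟨_, hp (Fin.zero_le _), le_rfl, Or.inr rfl, by linarith, ?_⟩
      rw [sub_self]
      refine Finset.sum_eq_zero fun i _ => ?_
      have : tag i ≤ t := by
        rcases (Fin.le_last i).eq_or_lt with rfl | hi
        · exact hle
        · have : p i.succ ≤ p (Fin.last k).castSucc := hp (Fin.succ_le_castSucc_iff.2 hi)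
          linarith [(htag i).2]
      rw [Set.indicator_of_notMem (fun h => this.not_gt h.1), zero_mul]
    · obtain ⟨r, hr0, hr1, hrδ, hrt, hsum⟩ := ih (fun i => p i.castSucc) (fun i => tag i.castSucc)
        (hp.comp (Fin.strictMono_castSucc).monotone) h0
        ((hp (Fin.le_last _)).trans hb) (fun i => htag i.castSucc) (fun i => hmesh i.castSucc)
      refine ⟨r, hr0, hr1.trans (hp (Fin.le_last _)), Or.inl ?_, hrt, ?_⟩
      · rcases hrδ with h | h
        · exact h
        · rw [h]; linarith
      · rw [Fin.sum_univ_castSucc]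
        simp only [Fin.succ_castSucc] at hsum ⊢
        rw [hsum, Set.indicator_of_mem (Set.mem_Ioc.2 ⟨hgt, hlast.2.trans hb⟩), Fin.succ_last]
        ring

lemma isRealRSIntegral_indicator_Ioc {g : ℝ → ℝ} {a b t : ℝ} (ht : t ∈ Set.Icc a b)
    (hg : ContinuousWithinAt g (Set.Icc a b) t) :
    IsRealRSIntegral ((Set.Ioc t b).indicator fun _ => 1) g a b (g b - g t) := by
  intro ε hε
  obtain ⟨δ, hδ, H⟩ := Metric.continuousWithinAt_iff.1 hg ε hε
  refine ⟨δ / 2, half_pos hδ, fun k p tag hp h0 hb htag hmesh => ?_⟩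
  obtain ⟨r, hr0, hr1, hrδ, hrt, hsum⟩ := exists_sum_indicator_mul_sub_eq g (half_pos hδ).le k p tag
    hp (h0.trans_le ht.1) hb.le htag hmesh
  rw [h0] at hr0
  rw [hb] at hr1 hrδ hsum
  have hrδ' : t - δ / 2 ≤ r := hrδ.elim id fun h => by linarith [ht.2]
  have := H ⟨hr0, hr1⟩ (by rw [Real.dist_eq, abs_lt]; constructor <;> linarith)
  rw [hsum, show g b - g r - (g b - g t) = -(g r - g t) by ring, abs_neg]
  exact this.le

/-- Key lemma (Lemma 5.1): if `ν` is right-continuous, of bounded variation on `[0,1]`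
with `ν(0) = 0`, `ϑ ∈ L¹([0,1],ℝⁿ)`, and `−∫₀¹ x(t)ᵀ dν(t) = ∫₀¹ ϑ(s)ᵀ x(s) ds` for
every continuous `x`, then for every common Lebesgue point `t` of `ϑ` and `s ↦ s ϑ(s)`
and every `ξ ∈ ℝⁿ`, one has `−∫₀¹ x_tᵀ dν = ∫₀¹ ϑᵀ x_t` with `x_t = ξ χ_{(t,1]}`;
equivalently `−∫_{(t,1]} ξᵀ dν(s) = ∫_t¹ ξᵀ ϑ(s) ds`. -/
theorem key_lemma_RS_representation {n : ℕ}
    (ν : ℝ → Fin n → ℝ) (ϑ : ℝ → Fin n → ℝ)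
    (hBV : BoundedVariationOn ν (Set.Icc 0 1))
    (hRC : ∀ t ∈ Set.Ico (0:ℝ) 1, ContinuousWithinAt ν (Set.Ioi t) t)
    (hν0 : ν 0 = 0)
    (hϑ : IntegrableOn ϑ (Set.Icc 0 1))
    (hkey : ∀ x : ℝ → Fin n → ℝ, ContinuousOn x (Set.Icc 0 1) →
      IsRSIntegral x ν 0 1 (-(∫ s in (0:ℝ)..1, ∑ j, ϑ s j * x s j))) :
    ∀ t ∈ Set.Icc (0:ℝ) 1, RightLebesguePoint ϑ t →
      RightLebesguePoint (fun s => s • ϑ s) t →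
      ∀ ξ : Fin n → ℝ,
        IsRSIntegral (fun s => Set.indicator (Set.Ioc t 1) (fun _ => ξ) s) ν 0 1
          (-(∫ s in (0:ℝ)..1, ∑ j,
              ϑ s j * Set.indicator (Set.Ioc t 1) (fun _ => ξ) s j)) ∧
        -(∑ j, ξ j * (ν 1 j - ν t j)) = ∫ s in t..(1:ℝ), ∑ j, ξ j * ϑ s j := by
  have hϑj (j : Fin n) : IntervalIntegrable (fun s => ϑ s j) volume 0 1 :=
    (intervalIntegrable_iff_integrableOn_Icc_of_le zero_le_one).2 (Integrable.eval hϑ j)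
  intro t ht _ _ ξ
  set g : ℝ → ℝ := fun s => ∑ j, ξ j * ν s j with hg
  set f : ℝ → ℝ := fun s => ∑ j, ξ j * ϑ s j with hf
  have hfi : IntervalIntegrable f volume 0 1 := by
    have := IntervalIntegrable.sum Finset.univ fun j _ => (hϑj j).const_mul (ξ j)
    rwa [Finset.sum_fn] at this
  have hpair (c : ℝ → ℝ) (s : ℝ) : ∑ j, ϑ s j * (c s • ξ) j = c s * f s := by
    simp only [hf, Finset.mul_sum, Pi.smul_apply, smul_eq_mul]
    exact Finset.sum_congr rfl fun j _ => by ring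
  have hrep {u : ℝ} (hu : u ∈ Set.Icc (0:ℝ) 1) : g 1 - g u = -∫ s in u..(1:ℝ), f s := by
    refine sub_eq_neg_integral_of_isRealRSIntegral (fun v hv => ?_) hfi (fun c hc => ?_) hu
    · exact tendsto_finsetSum _ fun j _ =>
        ((continuousWithinAt_pi.1 (hRC v hv) j).tendsto.const_mul (ξ j))
    · have := hkey (fun s => c s • ξ) (by fun_prop)
      simp only [hpair] at this
      exact (isRSIntegral_smul_iff c ξ ν 0 1 _).1 this
  have hcont : ContinuousOn g (Set.Icc 0 1) := by
    have h : ContinuousOn (fun u => g 1 + ∫ s in u..(1:ℝ), f s) (Set.Icc 0 1) := by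
      have := intervalIntegral.continuousOn_primitive_interval_left (a := 0) (b := 1) (f := f)
        (μ := volume) (by
          rw [Set.uIcc_of_le zero_le_one]
          exact (intervalIntegrable_iff_integrableOn_Icc_of_le zero_le_one).1 hfi)
      rw [Set.uIcc_of_le zero_le_one] at this
      exact continuousOn_const.add this
    exact h.congr fun u hu => by linarith [hrep hu]
  have hstep : (fun s => Set.indicator (Set.Ioc t 1) (fun _ => ξ) s) =
      fun s => (Set.Ioc t 1).indicator (fun _ => (1:ℝ)) s • ξ := by
    funext s
    by_cases hs : s ∈ Set.Ioc t 1 <;> simp [hs]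
  have hint : ∫ s in (0:ℝ)..1, ∑ j, ϑ s j * Set.indicator (Set.Ioc t 1) (fun _ => ξ) s j =
      ∫ s in t..(1:ℝ), f s := by
    have (s : ℝ) : ∑ j, ϑ s j * Set.indicator (Set.Ioc t 1) (fun _ => ξ) s j =
        (Set.Ioc t 1).indicator f s := by
      rw [congrFun hstep s, hpair]
      by_cases hs : s ∈ Set.Ioc t 1 <;> simp [hs]
    simp only [this]
    rw [intervalIntegral.integral_of_le zero_le_one, intervalIntegral.integral_of_le ht.2,
      setIntegral_indicator measurableSet_Ioc,
      Set.inter_eq_right.2 (Set.Ioc_subset_Ioc_left ht.1)]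
  refine ⟨?_, ?_⟩
  · rw [hint, ← hrep ht, hstep, isRSIntegral_smul_iff]
    exact isRealRSIntegral_indicator_Ioc ht (hcont t ht)
  · rw [← neg_eq_iff_eq_neg.2 (hrep ht)]
    simp only [hg, mul_sub, Finset.sum_sub_distrib]
end
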